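/- arXiv:1605.08084 — 3 statements merged into one kernel-verified Lean document; each statement's English description precedes it below -/
import Mathlib

section
/- Let 1 ≤ p ≤ ∞, b, κ, α ∈ ℝ, 0 < T < ∞, and let φ be an admissible weight function (locally absolutely continuous, |φ'| ≤ A φ a.e., v-moderate for a sub-multiplicative v with inf v > 0 and ∫ v(x) e^{-|x|} dx < ∞) which in addition satisfies v e^{-|·|} ∈ L^p(ℝ). Let (u, ρ) be a strong solution on [0,T) of the nonlocal system ∂_t u + u ∂_x u = −∂_x(G * P(u,ρ)), ∂_t ρ + u ∂_x ρ = −(b−1)(∂_x u) ρ, with G(x) = (1/2) e^{-|x|} and P(u,ρ) = (b/2) u² + ((3−b)/2)(∂_x u)² + (κ/2) ρ² − α u, such that u is C¹ in (t,x) and twice continuously differentiable in x, ρ is C¹, u(t,·), ∂_x u(t,·), ρ(t,·) ∈ L²(ℝ) ∩ L^∞(ℝ) for all t, and M := sup_{t ∈ [0,T)} ( ‖u(t,·)‖_{L^∞} + ‖∂_x u(t,·)‖_{L^∞} + ‖ρ(t,·)‖_{L^∞} ) < ∞. If u(0,·) φ, ∂_x u(0,·) φ, ρ(0,·) φ ∈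 L^p(ℝ) and u(0,·) φ^{1/2}, ∂_x u(0,·) φ^{1/2}, ρ(0,·) φ^{1/2} ∈ L²(ℝ), then both sup_{t ∈ [0,T)} ( ‖u(t,·) φ‖_{L^p} + ‖∂_x u(t,·) φ‖_{L^p} + ‖ρ(t,·) φ‖_{L^p} ) and sup_{t ∈ [0,T)} ( ‖u(t,·) φ^{1/2}‖_{L²} + ‖∂_x u(t,·) φ^{1/2}‖_{L²} + ‖ρ(t,·) φ^{1/2}‖_{L²} ) are finite. -/
open MeasureTheory
open scoped ENNReal

/-- The Green's function `G(x) = (1/2) e^{-|x|}` of `(1 - ∂_x²)⁻¹`. -/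
noncomputable def greenG (x : ℝ) : ℝ := (1 / 2) * Real.exp (-|x|)

/-- Convolution `G * h` on `ℝ`. -/
noncomputable def greenConv (h : ℝ → ℝ) : ℝ → ℝ := fun x => ∫ y : ℝ, greenG (x - y) * h y

/-- The nonlocal source term `P(u,ρ) = (b/2) u² + ((3-b)/2) (∂_x u)² + (κ/2) ρ² - α u`. -/
noncomputable def Pterm (b κ α : ℝ) (u w ρ : ℝ → ℝ) : ℝ → ℝ :=
  fun x => b / 2 * u x ^ 2 + (3 - b) / 2 * w x ^ 2 + κ / 2 * ρ x ^ 2 - α * u x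

open Set Function Filter Topology in
lemma flow_exists (V : ℝ → ℝ → ℝ) (hV : Continuous (uncurry V)) (M : NNReal)
    (hb : ∀ s x, |V s x| ≤ M) (hL : ∀ s, LipschitzWith M (V s)) (t : ℝ) (ht : 0 ≤ t) :
    ∃ Y : ℝ → ℝ → ℝ, Continuous (uncurry Y) ∧ (∀ y, Y t y = y) ∧
      (∀ y, ∀ s ∈ Ioo 0 t, HasDerivAt (fun τ => Y τ y) (V s (Y s y)) s) ∧
      (∀ y, ∀ s ∈ Icc 0 t, |Y s y - y| ≤ M * t) ∧
      (∀ s ∈ Icc 0 t, ∀ y z, |y - z| ≤ Real.exp (M * t) * |Y s y - Y s z|) := by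
  have hex : ∀ y : ℝ, ∃ a : ℝ → ℝ, a t = y ∧
      ∀ s ∈ Icc (0:ℝ) t, HasDerivWithinAt a (V s (a s)) (Icc 0 t) s := by
    intro y
    have hpl : IsPicardLindelof V (tmin := 0) (tmax := t) ⟨t, ht, le_rfl⟩ y
        (M * Real.toNNReal t) 0 M M := by
      refine ⟨fun s _ => (hL s).lipschitzOnWith, fun x _ => ?_, fun s _ x _ => ?_, ?_⟩
      · exact (hV.comp (continuous_id.prodMk continuous_const)).continuousOn
      · simpa using hb s x
      · simp [ht]
    exact hpl.exists_eq_forall_mem_Icc_hasDerivWithinAt₀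
  choose a ha0 ha using hex
  have hac : ∀ y, ContinuousOn (a y) (Icc 0 t) := fun y s hs => (ha y s hs).continuousWithinAt
  have hlipt : ∀ y, LipschitzOnWith M (a y) (Icc 0 t) := by
    intro y
    refine Convex.lipschitzOnWith_of_nnnorm_hasDerivWithin_le (convex_Icc 0 t)
      (fun s hs => ha y s hs) (fun s hs => ?_)
    have := hb s (a y s)
    rw [← NNReal.coe_le_coe]; simpa using this
  have hfw : ∀ s ∈ Icc (0:ℝ) t, ∀ y z, |y - z| ≤ Real.exp (M * t) * |a y s - a z s| := by
    intro s hs y z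
    have := dist_le_of_trajectories_ODE (v := V) (K := M) (f := a y) (g := a z) (a := s) (b := t)
      (δ := dist (a y s) (a z s)) hL
      ((hac y).mono (Icc_subset_Icc_left hs.1))
      (fun r hr => ((ha y r ⟨hs.1.trans hr.1, hr.2.le⟩).mono_of_mem_nhdsWithin
        (mem_of_superset (Icc_mem_nhdsGE hr.2) (Icc_subset_Icc_left (hs.1.trans hr.1)))))
      ((hac z).mono (Icc_subset_Icc_left hs.1))
      (fun r hr => ((ha z r ⟨hs.1.trans hr.1, hr.2.le⟩).mono_of_mem_nhdsWithin
        (mem_of_superset (Icc_mem_nhdsGE hr.2) (Icc_subset_Icc_left (hs.1.trans hr.1)))))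
      le_rfl t ⟨hs.2, le_rfl⟩
    rw [ha0, ha0, Real.dist_eq, Real.dist_eq] at this
    refine this.trans ?_
    rw [mul_comm]
    gcongr
    linarith [hs.1]
  have hbw : ∀ s ∈ Icc (0:ℝ) t, ∀ y z, |a y s - a z s| ≤ Real.exp (M * t) * |y - z| := by
    intro s hs y z
    have hder : ∀ y, ∀ r ∈ Ico 0 t,
        HasDerivWithinAt (fun r => a y (t - r)) (- V (t - r) (a y (t - r))) (Ici r) r := by
      intro y r hr
      have h1 := ha y (t - r) ⟨by linarith [hr.2], by linarith [hr.1]⟩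
      have h2 : HasDerivWithinAt (fun r => t - r) (-1) (Icc r t) r := by
        simpa using ((hasDerivAt_id r).const_sub t).hasDerivWithinAt
      have h3 := h1.scomp r h2 (by
        intro q hq
        exact ⟨by linarith [hq.2], by linarith [hq.1, hr.1]⟩)
      have h4 := h3.mono_of_mem_nhdsWithin (Icc_mem_nhdsGE hr.2)
      simp only [neg_smul, one_smul] at h4
      exact h4
    have hcont : ∀ y, ContinuousOn (fun r => a y (t - r)) (Icc 0 t) := by
      intro y
      refine (hac y).comp (by fun_prop) ?_
      intro q hq
      exact ⟨by linarith [hq.2], by linarith [hq.1]⟩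
    have := dist_le_of_trajectories_ODE (v := fun r x => - V (t - r) x) (K := M)
      (f := fun r => a y (t - r)) (g := fun r => a z (t - r)) (a := 0) (b := t)
      (δ := dist y z) (fun r => (hL (t - r)).neg) (hcont y) (hder y) (hcont z) (hder z)
      (by simp [ha0]) (t - s) ⟨by linarith [hs.2], by linarith [hs.1]⟩
    simp only [sub_sub_cancel, Real.dist_eq] at this
    refine this.trans ?_
    rw [mul_comm]
    gcongr
    linarith [hs.1]
  have hproj : ∀ s, (projIcc 0 t ht s : ℝ) ∈ Icc 0 t := fun s => (projIcc 0 t ht s).2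
  refine ⟨fun s y => a y (projIcc 0 t ht s), ?_, ?_, ?_, ?_, ?_⟩
  · have hpt : Continuous fun s : ℝ => ((projIcc 0 t ht s : Icc 0 t) : ℝ) := by fun_prop
    rw [continuous_iff_continuousAt]
    rintro ⟨s, y⟩
    rw [ContinuousAt, tendsto_iff_dist_tendsto_zero]
    have hlim : Tendsto (fun q : ℝ × ℝ => Real.exp (M * t) * |q.2 - y| +
        M * dist ((projIcc 0 t ht q.1 : Icc 0 t) : ℝ) (projIcc 0 t ht s : Icc 0 t)) (𝓝 (s, y))
        (𝓝 0) := by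
      have : Continuous (fun q : ℝ × ℝ => Real.exp (M * t) * |q.2 - y| +
        M * dist ((projIcc 0 t ht q.1 : Icc 0 t) : ℝ) (projIcc 0 t ht s : Icc 0 t)) := by
        fun_prop
      have h := this.tendsto (s, y)
      simpa using h
    refine squeeze_zero (fun _ => dist_nonneg) (fun q => ?_) hlim
    simp only [uncurry]
    refine (dist_triangle _ (a y (projIcc 0 t ht q.1)) _).trans ?_
    gcongr
    · rw [Real.dist_eq]; exact hbw _ (hproj _) _ _
    · exact (hlipt y).dist_le_mul _ (hproj _) _ (hproj _)
  · intro y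
    simp [ha0]
  · intro y s hs
    have h := (ha y s ⟨hs.1.le, hs.2.le⟩).hasDerivAt (Icc_mem_nhds hs.1 hs.2)
    have e : (projIcc 0 t ht s : ℝ) = s := by
      rw [projIcc_of_mem ht ⟨hs.1.le, hs.2.le⟩]
    simp only [e]
    refine h.congr_of_eventuallyEq ?_
    filter_upwards [Icc_mem_nhds hs.1 hs.2] with r hr
    rw [projIcc_of_mem ht hr]
  · intro y s hs
    simp only [projIcc_of_mem ht hs]
    have := (hlipt y).dist_le_mul s hs t ⟨ht, le_rfl⟩
    rw [ha0, Real.dist_eq, Real.dist_eq] at this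
    refine this.trans ?_
    gcongr
    rw [abs_sub_comm, abs_of_nonneg] <;> linarith [hs.1, hs.2]
  · intro s hs y z
    simp only [projIcc_of_mem ht hs]
    exact hfw s hs y z

lemma lintegral_comp_antilip (f : ℝ → ℝ) (hf : Continuous f) (K : NNReal)
    (hK : AntilipschitzWith K f) (g : ℝ → ℝ≥0∞) (hg : Measurable g) :
    ∫⁻ y, g (f y) ≤ K * ∫⁻ y, g y := by
  rw [← lintegral_map hg hf.measurable]
  have : Measure.map f volume ≤ (K : ℝ≥0∞) • (volume : Measure ℝ) := by
    rw [Measure.le_iff]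
    intro s hs
    rw [Measure.map_apply hf.measurable hs]
    have := hK.hausdorffMeasure_preimage_le (d := 1) zero_le_one s
    rw [hausdorffMeasure_real] at this
    simpa using this
  refine (lintegral_mono' this le_rfl).trans ?_
  rw [lintegral_smul_measure]
  rfl

open Set in
lemma scalar_gronwall (T : ℝ) (L : ℝ≥0∞) (hL : L ≠ ⊤) :
    ∃ B : ℝ≥0∞, B ≠ ⊤ ∧ ∀ t₁ ≤ T, ∀ (n : ℝ → ℝ≥0∞) (D n0 : ℝ≥0∞), D ≠ ⊤ →
      (∀ s ∈ Icc 0 t₁, n s ≤ D) →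
      (∀ t ∈ Icc 0 t₁, n t ≤ L * (n0 + ∫⁻ s in Icc 0 t, n s)) →
      ∀ t ∈ Icc 0 t₁, n t ≤ B * n0 := by
  set l : ℝ := 2 * L.toReal + 1 with hl
  have hl0 : 0 < l := by positivity
  refine ⟨ENNReal.ofReal (Real.exp (l * T)) * (2 * L), by finiteness, ?_⟩
  intro t₁ ht₁ n D n0 hD hnD hn
  set S : ℝ≥0∞ := ⨆ s ∈ Icc 0 t₁, ENNReal.ofReal (Real.exp (-(l * s))) * n s with hS
  have hexp : ∀ s : ℝ, ENNReal.ofReal (Real.exp (l * s)) * ENNReal.ofReal (Real.exp (-(l * s))) = 1 := by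
    intro s
    rw [← ENNReal.ofReal_mul (Real.exp_pos _).le, ← Real.exp_add]
    simp
  have hSD : S ≤ D := by
    refine iSup₂_le fun s hs => ?_
    calc _ ≤ 1 * n s := by
          gcongr
          rw [ENNReal.ofReal_le_one, Real.exp_le_one_iff]
          have := mul_nonneg hl0.le hs.1
          linarith
      _ ≤ D := by rw [one_mul]; exact hnD s hs
  have hns : ∀ s ∈ Icc 0 t₁, n s ≤ ENNReal.ofReal (Real.exp (l * s)) * S := by
    intro s hs
    calc n s = ENNReal.ofReal (Real.exp (l * s)) * (ENNReal.ofReal (Real.exp (-(l * s))) * n s) := by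
          rw [← mul_assoc, hexp, one_mul]
      _ ≤ _ := by
          gcongr
          exact le_iSup₂ (f := fun s (_ : s ∈ Icc 0 t₁) => ENNReal.ofReal (Real.exp (-(l * s))) * n s) s hs
  have hint : ∀ t, 0 ≤ t → ∫⁻ s in Icc 0 t, ENNReal.ofReal (Real.exp (l * s)) ≤
      ENNReal.ofReal (Real.exp (l * t) / l) := by
    intro t ht
    have hc : Continuous fun s => Real.exp (l * s) := by fun_prop
    rw [← ofReal_integral_eq_lintegral_ofReal]
    · apply ENNReal.ofReal_le_ofReal
      rw [integral_Icc_eq_integral_Ioc, ← intervalIntegral.integral_of_le ht]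
      rw [intervalIntegral.integral_comp_mul_left _ hl0.ne']
      rw [integral_exp]
      simp only [mul_zero, Real.exp_zero, smul_eq_mul]
      rw [div_eq_inv_mul]
      gcongr
      linarith
    · exact hc.continuousOn.integrableOn_Icc
    · exact Filter.Eventually.of_forall fun s => (Real.exp_pos _).le
  have hkey : S ≤ L * n0 + S / 2 := by
    refine iSup₂_le fun t ht => ?_
    have h1 : ∫⁻ s in Icc 0 t, n s ≤ ENNReal.ofReal (Real.exp (l * t) / l) * S := by
      calc ∫⁻ s in Icc 0 t, n s ≤ ∫⁻ s in Icc 0 t, ENNReal.ofReal (Real.exp (l * s)) * S := by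
            refine setLIntegral_mono' measurableSet_Icc fun s hs => hns s ⟨hs.1, hs.2.trans ht.2⟩
        _ = (∫⁻ s in Icc 0 t, ENNReal.ofReal (Real.exp (l * s))) * S := by
            rw [lintegral_mul_const]
            fun_prop
        _ ≤ _ := by gcongr; exact hint t ht.1
    have h2 : ENNReal.ofReal (Real.exp (-(l * t))) ≤ 1 := by
      rw [ENNReal.ofReal_le_one, Real.exp_le_one_iff]
      have := mul_nonneg hl0.le ht.1
      linarith
    have h3 : L * ENNReal.ofReal (1 / l) ≤ 2⁻¹ := by
      rw [← ENNReal.ofReal_toReal hL, ← ENNReal.ofReal_mul ENNReal.toReal_nonneg]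
      have : (2:ℝ≥0∞)⁻¹ = ENNReal.ofReal (2⁻¹) := by
        rw [ENNReal.ofReal_inv_of_pos two_pos]; simp
      rw [this]
      apply ENNReal.ofReal_le_ofReal
      rw [mul_one_div, div_le_iff₀ hl0, hl]
      have : 0 ≤ L.toReal := ENNReal.toReal_nonneg
      linarith
    calc ENNReal.ofReal (Real.exp (-(l * t))) * n t
        ≤ ENNReal.ofReal (Real.exp (-(l * t))) * (L * (n0 + ENNReal.ofReal (Real.exp (l * t) / l) * S)) := by
          gcongr
          refine (hn t ht).trans ?_
          gcongr
      _ = ENNReal.ofReal (Real.exp (-(l * t))) * (L * n0) +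
          (L * (ENNReal.ofReal (Real.exp (-(l * t))) * ENNReal.ofReal (Real.exp (l * t) / l))) * S := by ring
      _ ≤ 1 * (L * n0) + 2⁻¹ * S := by
          gcongr
          refine le_trans (le_of_eq ?_) h3
          congr 1
          rw [← ENNReal.ofReal_mul (Real.exp_pos _).le, ← mul_div_assoc, ← Real.exp_add]
          simp
      _ = _ := by rw [one_mul, ENNReal.div_eq_inv_mul]
  have hS2 : S ≤ 2 * L * n0 := by
    have hSt : S ≠ ⊤ := ne_top_of_le_ne_top hD hSD
    have h4 : S / 2 + S / 2 ≤ L * n0 + S / 2 := by rw [ENNReal.add_halves]; exact hkey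
    have h5 : S / 2 ≤ L * n0 := by
      refine ENNReal.le_of_add_le_add_right ?_ h4
      exact (ENNReal.div_lt_top hSt two_ne_zero).ne
    calc S = S / 2 + S / 2 := (ENNReal.add_halves S).symm
      _ ≤ L * n0 + L * n0 := by gcongr
      _ = _ := by ring
  intro t ht
  calc n t ≤ ENNReal.ofReal (Real.exp (l * t)) * S := hns t ht
    _ ≤ ENNReal.ofReal (Real.exp (l * T)) * (2 * L * n0) := by
        gcongr
        exact ht.2.trans ht₁
    _ = _ := by ring

lemma jensen_lint {X : Type*} [MeasurableSpace X] (μ : Measure X) (f : X → ℝ≥0∞)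
    (hf : Measurable f) (p : ℝ) (hp : 1 ≤ p) :
    (∫⁻ x, f x ∂μ) ^ p ≤ μ Set.univ ^ (p - 1) * ∫⁻ x, f x ^ p ∂μ := by
  have hp0 : 0 < p := by linarith
  have := eLpNorm'_le_eLpNorm'_mul_rpow_measure_univ (μ := μ) (f := f) zero_lt_one hp
    hf.aestronglyMeasurable
  simp only [eLpNorm', enorm_eq_self, ENNReal.rpow_one, div_one] at this
  calc (∫⁻ x, f x ∂μ) ^ p ≤ ((∫⁻ x, f x ^ p ∂μ) ^ (1 / p) * μ Set.univ ^ (1 - 1 / p)) ^ p := by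
        gcongr
    _ = _ := by
        rw [ENNReal.mul_rpow_of_nonneg _ _ hp0.le, ← ENNReal.rpow_mul, ← ENNReal.rpow_mul,
          mul_comm]
        congr 2
        · field_simp
        · field_simp
          simp

lemma conv_jensen (k h : ℝ → ℝ≥0∞) (hk : Measurable k) (hh : Measurable h) (p : ℝ) (hp : 1 ≤ p)
    (x : ℝ) :
    (∫⁻ z, k (x - z) * h z) ^ p ≤ (∫⁻ z, k z) ^ (p - 1) * ∫⁻ z, k (x - z) * h z ^ p := by
  have hk' : Measurable fun z => k (x - z) := by fun_prop
  have := jensen_lint (volume.withDensity fun z => k (x - z)) h hh p hp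
  rw [lintegral_withDensity_eq_lintegral_mul _ hk' hh,
    lintegral_withDensity_eq_lintegral_mul _ hk' (hh.pow_const p), withDensity_apply _ MeasurableSet.univ,
    Measure.restrict_univ, lintegral_sub_left_eq_self k x] at this
  exact this

open Set in
lemma gron_p (p : ℝ) (hp : 1 ≤ p) (T : ℝ) (K J κ : ℝ≥0∞) (hK : K ≠ ⊤) (hJ : J ≠ ⊤) (hκ : κ ≠ ⊤) :
    ∃ B : ℝ≥0∞, B ≠ ⊤ ∧ ∀ t₁ ≤ T, ∀ (H : ℝ → ℝ → ℝ≥0∞) (k : ℝ → ℝ≥0∞) (D : ℝ≥0∞),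
      Measurable (Function.uncurry H) → Measurable k → ∫⁻ z, k z ≤ κ → D ≠ ⊤ →
      (∀ s ∈ Icc 0 t₁, ∫⁻ x, H s x ^ p ≤ D) →
      (∀ t ∈ Icc 0 t₁, ∃ Y : ℝ → ℝ → ℝ, Measurable (Function.uncurry Y) ∧
        (∀ s ∈ Icc 0 t, ∀ g : ℝ → ℝ≥0∞, Measurable g → ∫⁻ y, g (Y s y) ≤ J * ∫⁻ y, g y) ∧
        ∀ y, H t y ≤ K * (H 0 (Y 0 y) +
          ∫⁻ s in Icc 0 t, (H s (Y s y) + ∫⁻ z, k (Y s y - z) * H s z))) →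
      ∀ t ∈ Icc 0 t₁, ∫⁻ x, H t x ^ p ≤ B * ∫⁻ x, H 0 x ^ p := by
  have hp0 : 0 < p := by linarith
  have hp1 : 0 ≤ p - 1 := by linarith
  set c : ℝ≥0∞ := 2 ^ (p - 1) with hc
  have hcT : c ≠ ⊤ := by simp only [hc]; finiteness
  set τ : ℝ≥0∞ := ENNReal.ofReal T ^ (p - 1) with hτ
  have hτT : τ ≠ ⊤ := by simp only [hτ]; finiteness
  set L : ℝ≥0∞ := K ^ p * c * (J + τ * (c * (J + κ ^ (p - 1) * (κ * J)))) with hL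
  have hLT : L ≠ ⊤ := by simp only [hL]; finiteness
  obtain ⟨B, hB, hG⟩ := scalar_gronwall T L hLT
  refine ⟨B, hB, ?_⟩
  intro t₁ ht₁ H k D hH hk hkκ hD hHD hY
  refine hG t₁ ht₁ (fun t => ∫⁻ x, H t x ^ p) D _ hD hHD ?_
  intro t ht
  obtain ⟨Y, hYm, hYJ, hineq⟩ := hY t ht
  have hHs : ∀ s, Measurable (H s) := fun s => hH.comp measurable_prodMk_left
  have hYs : ∀ s, Measurable (Y s) := fun s => hYm.comp measurable_prodMk_left
  have hHY : Measurable fun q : ℝ × ℝ => H q.1 (Y q.1 q.2) :=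
    hH.comp (measurable_fst.prodMk hYm)
  have hkH : Measurable fun q : (ℝ × ℝ) × ℝ => k (Y q.1.1 q.1.2 - q.2) * H q.1.1 q.2 := by
    refine (hk.comp ((hYm.comp measurable_fst).sub measurable_snd)).mul ?_
    exact hH.comp (measurable_fst.fst.prodMk measurable_snd)
  have hkHp : Measurable fun q : (ℝ × ℝ) × ℝ => k (Y q.1.1 q.1.2 - q.2) * H q.1.1 q.2 ^ p := by
    refine (hk.comp ((hYm.comp measurable_fst).sub measurable_snd)).mul ?_
    exact (hH.comp (measurable_fst.fst.prodMk measurable_snd)).pow_const p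
  have hI : Measurable fun q : ℝ × ℝ => ∫⁻ z, k (Y q.1 q.2 - z) * H q.1 z :=
    hkH.lintegral_prod_right'
  have hIp : Measurable fun q : ℝ × ℝ => ∫⁻ z, k (Y q.1 q.2 - z) * H q.1 z ^ p :=
    hkHp.lintegral_prod_right'
  have hvol : (volume.restrict (Icc 0 t)) univ ^ (p - 1) ≤ τ := by
    rw [Measure.restrict_apply_univ, Real.volume_Icc, hτ]
    gcongr
    linarith [ht.2]
  have hpt : ∀ y, H t y ^ p ≤ K ^ p * c * (H 0 (Y 0 y) ^ p + τ * ∫⁻ s in Icc 0 t,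
      c * (H s (Y s y) ^ p + κ ^ (p - 1) * ∫⁻ z, k (Y s y - z) * H s z ^ p)) := by
    intro y
    calc H t y ^ p ≤ (K * (H 0 (Y 0 y) +
          ∫⁻ s in Icc 0 t, (H s (Y s y) + ∫⁻ z, k (Y s y - z) * H s z))) ^ p := by
          gcongr; exact hineq y
      _ = K ^ p * (H 0 (Y 0 y) +
          ∫⁻ s in Icc 0 t, (H s (Y s y) + ∫⁻ z, k (Y s y - z) * H s z)) ^ p :=
          ENNReal.mul_rpow_of_nonneg _ _ hp0.le
      _ ≤ K ^ p * (c * (H 0 (Y 0 y) ^ p +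
          (∫⁻ s in Icc 0 t, (H s (Y s y) + ∫⁻ z, k (Y s y - z) * H s z)) ^ p)) := by
          gcongr
          exact ENNReal.rpow_add_le_mul_rpow_add_rpow _ _ hp
      _ ≤ K ^ p * (c * (H 0 (Y 0 y) ^ p +
          τ * ∫⁻ s in Icc 0 t, (H s (Y s y) + ∫⁻ z, k (Y s y - z) * H s z) ^ p)) := by
          gcongr
          refine (jensen_lint _ _ ?_ p hp).trans ?_
          · exact (hHY.comp (measurable_id.prodMk measurable_const)).add
              (hI.comp (measurable_id.prodMk measurable_const))
          · gcongr
      _ ≤ K ^ p * (c * (H 0 (Y 0 y) ^ p + τ * ∫⁻ s in Icc 0 t,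
      c * (H s (Y s y) ^ p + κ ^ (p - 1) * ∫⁻ z, k (Y s y - z) * H s z ^ p))) := by
          gcongr with s
          refine (ENNReal.rpow_add_le_mul_rpow_add_rpow _ _ hp).trans ?_
          gcongr
          refine (conv_jensen k (H s) hk (hHs s) p hp _).trans ?_
          gcongr
      _ = _ := by ring
  have hin : ∀ s ∈ Icc 0 t, ∫⁻ y, c * (H s (Y s y) ^ p + κ ^ (p - 1) * ∫⁻ z, k (Y s y - z) * H s z ^ p)
      ≤ (c * (J + κ ^ (p - 1) * (κ * J))) * ∫⁻ x, H s x ^ p := by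
    intro s hs
    have m1 : Measurable fun y => H s (Y s y) ^ p :=
      (hHY.comp measurable_prodMk_left).pow_const p
    have m2 : Measurable fun y => ∫⁻ z, k (Y s y - z) * H s z ^ p :=
      hIp.comp measurable_prodMk_left
    have m3 : Measurable fun q : ℝ × ℝ => k (q.1 - q.2) * H s q.2 ^ p :=
      (hk.comp (measurable_fst.sub measurable_snd)).mul (((hHs s).comp measurable_snd).pow_const p)
    have e1 : ∫⁻ y, H s (Y s y) ^ p ≤ J * ∫⁻ x, H s x ^ p :=
      hYJ s hs (fun x => H s x ^ p) ((hHs s).pow_const p)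
    have e2 : ∫⁻ y, ∫⁻ z, k (Y s y - z) * H s z ^ p ≤ J * (κ * ∫⁻ x, H s x ^ p) := by
      refine (hYJ s hs (fun x => ∫⁻ z, k (x - z) * H s z ^ p) m3.lintegral_prod_right').trans ?_
      gcongr
      rw [lintegral_lintegral_swap m3.aemeasurable]
      calc ∫⁻ z, ∫⁻ x, k (x - z) * H s z ^ p = ∫⁻ z, (∫⁻ x, k x) * H s z ^ p := by
            congr 1; ext z
            rw [lintegral_mul_const _ (by fun_prop), lintegral_sub_right_eq_self k z]
        _ = (∫⁻ x, k x) * ∫⁻ z, H s z ^ p := lintegral_const_mul _ ((hHs s).pow_const p)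
        _ ≤ _ := by gcongr
    rw [lintegral_const_mul c (f := fun y => H s (Y s y) ^ p + κ ^ (p - 1) * ∫⁻ z, k (Y s y - z) * H s z ^ p)
        (m1.add (m2.const_mul _)), lintegral_add_left m1,
      lintegral_const_mul _ m2]
    calc _ ≤ c * (J * (∫⁻ x, H s x ^ p) + κ ^ (p - 1) * (J * (κ * ∫⁻ x, H s x ^ p))) := by gcongr
      _ = _ := by ring
  have M1 : Measurable fun q : ℝ × ℝ => c * (H q.1 (Y q.1 q.2) ^ p +
      κ ^ (p - 1) * ∫⁻ z, k (Y q.1 q.2 - z) * H q.1 z ^ p) :=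
    ((hHY.pow_const p).add (hIp.const_mul _)).const_mul _
  have M0 : Measurable fun y => H 0 (Y 0 y) ^ p :=
      (hHY.comp (measurable_prodMk_left (x := (0:ℝ)))).pow_const p
  have M2 : Measurable fun y => ∫⁻ s in Icc 0 t,
      c * (H s (Y s y) ^ p + κ ^ (p - 1) * ∫⁻ z, k (Y s y - z) * H s z ^ p) :=
    (M1.comp measurable_swap).lintegral_prod_right' (ν := volume.restrict (Icc 0 t))
  calc ∫⁻ x, H t x ^ p ≤ ∫⁻ y, K ^ p * c * (H 0 (Y 0 y) ^ p + τ * ∫⁻ s in Icc 0 t,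
      c * (H s (Y s y) ^ p + κ ^ (p - 1) * ∫⁻ z, k (Y s y - z) * H s z ^ p)) :=
        lintegral_mono hpt
    _ = K ^ p * c * ((∫⁻ y, H 0 (Y 0 y) ^ p) + τ * ∫⁻ s in Icc 0 t, ∫⁻ y,
      c * (H s (Y s y) ^ p + κ ^ (p - 1) * ∫⁻ z, k (Y s y - z) * H s z ^ p)) := by
        rw [lintegral_const_mul (K ^ p * c) (f := fun y => H 0 (Y 0 y) ^ p + τ * ∫⁻ s in Icc 0 t,
          c * (H s (Y s y) ^ p + κ ^ (p - 1) * ∫⁻ z, k (Y s y - z) * H s z ^ p))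
          (M0.add (M2.const_mul _)), lintegral_add_left M0,
          lintegral_const_mul _ M2, lintegral_lintegral_swap]
        exact (M1.comp measurable_swap).aemeasurable
    _ ≤ K ^ p * c * (J * (∫⁻ x, H 0 x ^ p) + τ * ∫⁻ s in Icc 0 t,
        (c * (J + κ ^ (p - 1) * (κ * J))) * ∫⁻ x, H s x ^ p) := by
        have e1 := hYJ 0 ⟨le_rfl, ht.1⟩ (fun x => H 0 x ^ p) ((hHs 0).pow_const p)
        have e2 := setLIntegral_mono' (μ := volume) measurableSet_Icc hin
        exact mul_le_mul' le_rfl (add_le_add e1 (mul_le_mul' le_rfl e2))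
    _ = K ^ p * c * (J * (∫⁻ x, H 0 x ^ p) + τ *
        ((c * (J + κ ^ (p - 1) * (κ * J))) * ∫⁻ s in Icc 0 t, ∫⁻ x, H s x ^ p)) := by
        rw [lintegral_const_mul _ (f := fun s => ∫⁻ x, H s x ^ p) (hH.pow_const p).lintegral_prod_right']
    _ ≤ L * ((∫⁻ x, H 0 x ^ p) + ∫⁻ s in Icc 0 t, ∫⁻ x, H s x ^ p) := by
        rw [hL, mul_assoc (K ^ p * c), mul_add (J + _)]
        refine mul_le_mul' le_rfl (add_le_add (mul_le_mul' le_self_add le_rfl) ?_)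
        rw [← mul_assoc]
        exact mul_le_mul' le_add_self le_rfl

open Set in
lemma gron_top (T : ℝ) (K κ : ℝ≥0∞) (hK : K ≠ ⊤) (hκ : κ ≠ ⊤) :
    ∃ B : ℝ≥0∞, B ≠ ⊤ ∧ ∀ t₁ ≤ T, ∀ (H : ℝ → ℝ → ℝ≥0∞) (k : ℝ → ℝ≥0∞) (D : ℝ≥0∞),
      Measurable k → ∫⁻ z, k z ≤ κ → D ≠ ⊤ →
      (∀ s ∈ Icc 0 t₁, ∀ x, H s x ≤ D) →
      (∀ t ∈ Icc 0 t₁, ∃ Y : ℝ → ℝ → ℝ,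
        ∀ y, H t y ≤ K * (H 0 (Y 0 y) +
          ∫⁻ s in Icc 0 t, (H s (Y s y) + ∫⁻ z, k (Y s y - z) * H s z))) →
      ∀ t ∈ Icc 0 t₁, (⨆ x, H t x) ≤ B * ⨆ x, H 0 x := by
  obtain ⟨B, hB, hG⟩ := scalar_gronwall T (K * (1 + κ)) (by finiteness)
  refine ⟨B, hB, ?_⟩
  intro t₁ ht₁ H k D hk hkκ hD hHD hY
  refine hG t₁ ht₁ (fun t => ⨆ x, H t x) D _ hD (fun s hs => iSup_le (hHD s hs)) ?_
  intro t ht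
  obtain ⟨Y, hineq⟩ := hY t ht
  refine iSup_le fun y => (hineq y).trans ?_
  rw [mul_assoc]
  gcongr
  rw [mul_add]
  gcongr
  · refine (le_iSup (H 0) (Y 0 y)).trans ?_
    exact le_mul_of_one_le_left' (by simp)
  · rw [← lintegral_const_mul' _ _ (by finiteness)]
    refine lintegral_mono fun s => ?_
    simp only
    rw [add_mul, one_mul]
    gcongr
    · exact le_iSup (H s) (Y s y)
    · calc ∫⁻ z, k (Y s y - z) * H s z ≤ ∫⁻ z, k (Y s y - z) * ⨆ x, H s x := by
            gcongr with z; exact le_iSup (H s) z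
        _ = (∫⁻ z, k z) * ⨆ x, H s x := by
            rw [lintegral_mul_const _ (by fun_prop), lintegral_sub_left_eq_self k]
        _ ≤ _ := by gcongr

section green
open Set

lemma integrable_exp_abs (c : ℝ) (hc : 0 < c) :
    Integrable fun x : ℝ => Real.exp (-(c * |x|)) := by
  rw [← integrableOn_univ, ← Iic_union_Ioi (a := (0:ℝ)), integrableOn_union]
  constructor
  · refine (integrableOn_exp_mul_Iic hc 0).congr_fun (fun x hx => ?_) measurableSet_Iic
    simp only [abs_of_nonpos (show x ≤ 0 from hx)]
    ring_nf
  · refine (exp_neg_integrableOn_Ioi 0 hc).congr_fun (fun x hx => ?_) measurableSet_Ioi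
    simp only [abs_of_pos (show 0 < x from hx)]
    ring_nf

lemma integrable_greenG : Integrable greenG := by
  unfold greenG
  have h := integrable_exp_abs 1 one_pos
  simp only [one_mul] at h
  exact h.const_mul _

noncomputable def gI1 (h : ℝ → ℝ) (x : ℝ) : ℝ := ∫ y in Iic x, Real.exp y * h y
noncomputable def gI2 (h : ℝ → ℝ) (x : ℝ) : ℝ := ∫ y in Ioi x, Real.exp (-y) * h y


lemma gI1_int {h : ℝ → ℝ} {Q : ℝ} (hh : Continuous h) (hQ : ∀ x, |h x| ≤ Q)
    (x : ℝ) : IntegrableOn (fun y => Real.exp y * h y) (Iic x) := by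
  refine Integrable.mono' (g := fun y => Q * Real.exp y) ((integrableOn_exp_Iic x).const_mul Q)
    (by fun_prop) (Filter.Eventually.of_forall fun y => ?_)
  rw [norm_mul, Real.norm_eq_abs, Real.norm_eq_abs, abs_of_pos (Real.exp_pos y), mul_comm]
  gcongr
  exact hQ y

lemma gI2_int {h : ℝ → ℝ} {Q : ℝ} (hh : Continuous h) (hQ : ∀ x, |h x| ≤ Q)
    (x : ℝ) : IntegrableOn (fun y => Real.exp (-y) * h y) (Ioi x) := by
  refine Integrable.mono' (g := fun y => Q * Real.exp (-y)) ((integrableOn_exp_neg_Ioi x).const_mul Q)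
    (by fun_prop) (Filter.Eventually.of_forall fun y => ?_)
  rw [norm_mul, Real.norm_eq_abs, Real.norm_eq_abs, abs_of_pos (Real.exp_pos _), mul_comm]
  gcongr
  exact hQ y

lemma gI1_deriv {h : ℝ → ℝ} {Q : ℝ} (hh : Continuous h) (hQ : ∀ x, |h x| ≤ Q)
    (x : ℝ) : HasDerivAt (gI1 h) (Real.exp x * h x) x := by
  have hc : Continuous fun y => Real.exp y * h y := by fun_prop
  have e : gI1 h = fun z => gI1 h x + ∫ y in x..z, Real.exp y * h y := by
    ext z
    have := intervalIntegral.integral_Iic_sub_Iic (gI1_int hh hQ x) (gI1_int hh hQ z)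
    unfold gI1
    linarith
  rw [e]
  exact (intervalIntegral.integral_hasDerivAt_right (hc.intervalIntegrable _ _)
    hc.stronglyMeasurable.stronglyMeasurableAtFilter hc.continuousAt).const_add _

lemma gI2_deriv {h : ℝ → ℝ} {Q : ℝ} (hh : Continuous h) (hQ : ∀ x, |h x| ≤ Q)
    (x : ℝ) : HasDerivAt (gI2 h) (-(Real.exp (-x) * h x)) x := by
  have hc : Continuous fun y => Real.exp (-y) * h y := by fun_prop
  have e : gI2 h = fun z => gI2 h x - ∫ y in x..z, Real.exp (-y) * h y := by
    ext z
    have := intervalIntegral.integral_Ioi_sub_Ioi' (gI2_int hh hQ x) (gI2_int hh hQ z)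
    unfold gI2
    linarith
  rw [e]
  exact (intervalIntegral.integral_hasDerivAt_right (hc.intervalIntegrable _ _)
    hc.stronglyMeasurable.stronglyMeasurableAtFilter hc.continuousAt).const_sub _

lemma green_int {h : ℝ → ℝ} {Q : ℝ} (hh : Continuous h) (hQ : ∀ x, |h x| ≤ Q)
    (x : ℝ) : Integrable fun y => greenG (x - y) * h y := by
  refine (integrable_greenG.comp_sub_left x).mul_bdd (c := Q) hh.aestronglyMeasurable ?_
  exact Filter.Eventually.of_forall hQ

lemma green_eq {h : ℝ → ℝ} {Q : ℝ} (hh : Continuous h) (hQ : ∀ x, |h x| ≤ Q)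
    (x : ℝ) : greenConv h x =
    1 / 2 * (Real.exp (-x) * gI1 h x + Real.exp x * gI2 h x) := by
  unfold greenConv
  have hi := green_int hh hQ x
  rw [← integral_add_compl (measurableSet_Iic (a := x)) hi, compl_Iic]
  unfold gI1 gI2
  rw [mul_add, ← integral_const_mul, ← integral_const_mul, ← integral_const_mul,
    ← integral_const_mul]
  congr 1
  · refine setIntegral_congr_fun measurableSet_Iic fun y hy => ?_
    simp only [greenG]
    rw [abs_of_nonneg (sub_nonneg.2 hy), neg_sub, sub_eq_add_neg, Real.exp_add]
    ring
  · refine setIntegral_congr_fun measurableSet_Ioi fun y hy => ?_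
    simp only [greenG]
    rw [abs_of_neg (sub_neg.2 hy), neg_neg, sub_eq_add_neg, Real.exp_add]
    ring

lemma green_deriv1 {h : ℝ → ℝ} {Q : ℝ} (hh : Continuous h) (hQ : ∀ x, |h x| ≤ Q)
    (x : ℝ) : HasDerivAt (greenConv h)
    (1 / 2 * (Real.exp x * gI2 h x - Real.exp (-x) * gI1 h x)) x := by
  rw [show greenConv h = _ from funext (green_eq hh hQ)]
  have h1 : HasDerivAt (fun x : ℝ => Real.exp (-x)) (-Real.exp (-x)) x := by
    simpa using (hasDerivAt_neg x).exp
  have := ((h1.mul (gI1_deriv hh hQ x)).add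
    ((Real.hasDerivAt_exp x).mul (gI2_deriv hh hQ x))).const_mul (1 / 2)
  refine HasDerivAt.congr_deriv this ?_
  ring

lemma green_deriv {h : ℝ → ℝ} {Q : ℝ} (hh : Continuous h) (hQ : ∀ x, |h x| ≤ Q)
    (x : ℝ) : deriv (greenConv h) x =
    1 / 2 * (Real.exp x * gI2 h x - Real.exp (-x) * gI1 h x) :=
  (green_deriv1 hh hQ x).deriv

lemma green_deriv2 {h : ℝ → ℝ} {Q : ℝ} (hh : Continuous h) (hQ : ∀ x, |h x| ≤ Q)
    (x : ℝ) : HasDerivAt (deriv (greenConv h)) (greenConv h x - h x) x := by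
  rw [show deriv (greenConv h) = _ from funext (green_deriv hh hQ)]
  have h1 : HasDerivAt (fun x : ℝ => Real.exp (-x)) (-Real.exp (-x)) x := by
    simpa using (hasDerivAt_neg x).exp
  have := (((Real.hasDerivAt_exp x).mul (gI2_deriv hh hQ x)).sub
    (h1.mul (gI1_deriv hh hQ x))).const_mul (1 / 2)
  refine HasDerivAt.congr_deriv this ?_
  rw [green_eq hh hQ]
  have e : Real.exp (-x) * Real.exp x = 1 := by rw [← Real.exp_add]; simp
  linear_combination (-h x) * e

lemma green_bound {h : ℝ → ℝ} (x : ℝ) : ‖greenConv h x‖ₑ ≤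
    ∫⁻ y, ENNReal.ofReal (Real.exp (-|x - y|)) * ‖h y‖ₑ := by
  unfold greenConv
  refine (enorm_integral_le_lintegral_enorm _).trans (lintegral_mono fun y => ?_)
  rw [enorm_mul]
  gcongr
  unfold greenG
  rw [Real.enorm_of_nonneg (by positivity)]
  apply ENNReal.ofReal_le_ofReal
  linarith [Real.exp_pos (-|x - y|)]

lemma green_deriv_bound {h : ℝ → ℝ} {Q : ℝ} (hh : Continuous h) (hQ : ∀ x, |h x| ≤ Q)
    (x : ℝ) : ‖deriv (greenConv h) x‖ₑ ≤
    ∫⁻ y, ENNReal.ofReal (Real.exp (-|x - y|)) * ‖h y‖ₑ := by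
  rw [green_deriv hh hQ]
  have b1 : ‖Real.exp (-x) * gI1 h x‖ₑ ≤
      ∫⁻ y in Iic x, ENNReal.ofReal (Real.exp (-|x - y|)) * ‖h y‖ₑ := by
    unfold gI1
    rw [← integral_const_mul]
    refine (enorm_integral_le_lintegral_enorm _).trans
      (setLIntegral_mono' measurableSet_Iic fun y hy => ?_)
    rw [← mul_assoc, ← Real.exp_add, enorm_mul, Real.enorm_of_nonneg (Real.exp_pos _).le,
      abs_of_nonneg (sub_nonneg.2 hy)]
    gcongr
    linarith
  have b2 : ‖Real.exp x * gI2 h x‖ₑ ≤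
      ∫⁻ y in Ioi x, ENNReal.ofReal (Real.exp (-|x - y|)) * ‖h y‖ₑ := by
    unfold gI2
    rw [← integral_const_mul]
    refine (enorm_integral_le_lintegral_enorm _).trans
      (setLIntegral_mono' measurableSet_Ioi fun y hy => ?_)
    rw [← mul_assoc, ← Real.exp_add, enorm_mul, Real.enorm_of_nonneg (Real.exp_pos _).le,
      abs_of_neg (sub_neg.2 hy)]
    gcongr
    linarith
  rw [← lintegral_add_compl _ (measurableSet_Iic (a := x)), compl_Iic]
  calc ‖1 / 2 * (Real.exp x * gI2 h x - Real.exp (-x) * gI1 h x)‖ₑ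
      ≤ 1 * ‖Real.exp x * gI2 h x - Real.exp (-x) * gI1 h x‖ₑ := by
        rw [enorm_mul]
        gcongr
        rw [Real.enorm_of_nonneg (by positivity), ENNReal.ofReal_le_one]
        norm_num
    _ ≤ ‖Real.exp x * gI2 h x‖ₑ + ‖Real.exp (-x) * gI1 h x‖ₑ := by
        rw [one_mul]; exact enorm_sub_le
    _ ≤ _ := by rw [add_comm]; gcongr

lemma green_cont {Q : ℝ} (f : ℝ → ℝ → ℝ) (hf : Continuous (Function.uncurry f))
    (hQ : ∀ s x, |f s x| ≤ Q) :
    Continuous (fun q : ℝ × ℝ => greenConv (f q.1) q.2) := by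
  have e : (fun q : ℝ × ℝ => greenConv (f q.1) q.2) =
      fun q : ℝ × ℝ => ∫ z, greenG z * f q.1 (q.2 - z) := by
    ext q
    unfold greenConv
    rw [← integral_sub_left_eq_self _ _ q.2]
    simp
  rw [e]
  have hG : Continuous greenG := by unfold greenG; fun_prop
  have hf' : ∀ g₁ g₂ : ℝ × ℝ → ℝ, Continuous g₁ → Continuous g₂ →
      Continuous fun q => f (g₁ q) (g₂ q) := fun g₁ g₂ h1 h2 => hf.comp (h1.prodMk h2)
  refine continuous_of_dominated (bound := fun z => Q * ‖greenG z‖) ?_ ?_ ?_ ?_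
  · intro q
    have : Continuous fun z => f q.1 (q.2 - z) :=
      hf.comp (show Continuous (fun z => ((q.1, q.2 - z) : ℝ × ℝ)) by fun_prop)
    exact (hG.mul this).aestronglyMeasurable
  · intro q
    refine Filter.Eventually.of_forall fun z => ?_
    rw [norm_mul, mul_comm]
    gcongr
    exact hQ _ _
  · exact integrable_greenG.norm.const_mul Q
  · refine Filter.Eventually.of_forall fun z => ?_
    exact continuous_const.mul (hf' (fun q => q.1) (fun q => q.2 - z) (by fun_prop) (by fun_prop))

end green

open Set Function Filter Topology in
lemma schwarz_deriv (t₁ : ℝ) (u ux ut utx : ℝ → ℝ → ℝ)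
    (cut : Continuous (uncurry ut)) (cutx : Continuous (uncurry utx))
    (hut : ∀ s ∈ Ioo 0 t₁, ∀ x, HasDerivAt (fun s => u s x) (ut s x) s)
    (hux : ∀ s x, HasDerivAt (u s) (ux s x) x)
    (hutx : ∀ s x, HasDerivAt (ut s) (utx s x) x) :
    ∀ s ∈ Ioo 0 t₁, ∀ x, HasDerivAt (fun s => ux s x) (utx s x) s := by
  intro s0 hs0 x
  have ct : ∀ x, Continuous fun τ => ut τ x := fun x =>
    cut.comp (show Continuous fun τ => ((τ, x) : ℝ × ℝ) by fun_prop)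
  have ctx : ∀ x, Continuous fun τ => utx τ x := fun x =>
    cutx.comp (show Continuous fun τ => ((τ, x) : ℝ × ℝ) by fun_prop)
  have key : ∀ s ∈ Ioo 0 t₁, ux s x = ux s0 x + ∫ τ in s0..s, utx τ x := by
    intro s hs
    have e : u s = fun z => u s0 z + ∫ τ in s0..s, ut τ z := by
      ext z
      rw [intervalIntegral.integral_eq_sub_of_hasDerivAt (f := fun s => u s z)
        (fun τ hτ => hut τ (ordConnected_Ioo.uIcc_subset hs0 hs hτ) z)
        ((ct z).intervalIntegrable _ _)]
      ring
    have hK : IsCompact (uIcc s0 s ×ˢ Icc (x - 1) (x + 1)) := isCompact_uIcc.prod isCompact_Icc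
    obtain ⟨C, hC⟩ := hK.exists_bound_of_continuousOn cutx.continuousOn
    have h1 := (intervalIntegral.hasDerivAt_integral_of_dominated_loc_of_deriv_le
      (μ := volume) (a := s0) (b := s) (F := fun z τ => ut τ z) (F' := fun z τ => utx τ z)
      (x₀ := x) (s := Icc (x - 1) (x + 1)) (bound := fun _ => C)
      (Icc_mem_nhds (by linarith) (by linarith))
      (Eventually.of_forall fun z => (ct z).aestronglyMeasurable)
      ((ct x).intervalIntegrable _ _) (ctx x).aestronglyMeasurable
      (Eventually.of_forall fun τ hτ z hz => hC (τ, z) ⟨uIoc_subset_uIcc hτ, hz⟩)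
      (by simp) (Eventually.of_forall fun τ hτ z hz => hutx τ z)).2
    have h2 := (hux s0 x).add h1
    have h3 := hux s x
    rw [e] at h3
    exact h3.unique h2
  have h4 : HasDerivAt (fun s => ux s0 x + ∫ τ in s0..s, utx τ x) (utx s0 x) s0 :=
    (intervalIntegral.integral_hasDerivAt_right ((ctx x).intervalIntegrable _ _)
      (ctx x).stronglyMeasurable.stronglyMeasurableAtFilter (ctx x).continuousAt).const_add _
  refine h4.congr_of_eventuallyEq ?_
  filter_upwards [Ioo_mem_nhds hs0.1 hs0.2] with s hs using key s hs

open Set Function Filter Topology in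
lemma curve_bound (t t₁ : ℝ) (ht : t ∈ Icc 0 t₁) (f ft fx : ℝ → ℝ → ℝ)
    (cf : Continuous (uncurry f))
    (cft : Continuous (uncurry ft)) (cfx : Continuous (uncurry fx))
    (hft : ∀ s ∈ Ioo 0 t₁, ∀ x, HasDerivAt (fun s => f s x) (ft s x) s)
    (hfx : ∀ s x, HasDerivAt (f s) (fx s x) x)
    (V y : ℝ → ℝ) (hV : Continuous V) (hy : Continuous y)
    (hyd : ∀ s ∈ Ioo 0 t, HasDerivAt y (V s) s) :
    ‖f t (y t)‖ₑ ≤ ‖f 0 (y 0)‖ₑ + ∫⁻ s in Icc 0 t, ‖ft s (y s) + V s * fx s (y s)‖ₑ := by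
  have cy : Continuous fun s => ((s, y s) : ℝ × ℝ) := by fun_prop
  have hd : ∀ s ∈ Ioo 0 t, HasDerivAt (fun s => f s (y s)) (ft s (y s) + V s * fx s (y s)) s := by
    intro s hs
    have hs' : s ∈ Ioo 0 t₁ := ⟨hs.1, hs.2.trans_le ht.2⟩
    have h1 := hasStrictFDerivAt_uncurry_coprod (𝕜 := ℝ) (u := (s, y s)) (f := f)
      (f₁ := fun s x => ContinuousLinearMap.toSpanSingleton ℝ (ft s x))
      (f₂ := fun s x => ContinuousLinearMap.toSpanSingleton ℝ (fx s x))
      (by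
        have : ∀ᶠ v : ℝ × ℝ in 𝓝 (s, y s), v.1 ∈ Ioo 0 t₁ :=
          continuous_fst.continuousAt.eventually (Ioo_mem_nhds hs'.1 hs'.2)
        filter_upwards [this] with v hv
        exact (hft v.1 hv v.2).hasFDerivAt)
      (Eventually.of_forall fun v => (hfx v.1 v.2).hasFDerivAt)
      (by
        have : Continuous (uncurry fun s x => ContinuousLinearMap.toSpanSingleton ℝ (ft s x)) := by
          exact (ContinuousLinearMap.toSpanSingletonCLE (𝕜 := ℝ) (E := ℝ)).continuous.comp cft
        exact this.continuousAt)
      (by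
        have : Continuous (uncurry fun s x => ContinuousLinearMap.toSpanSingleton ℝ (fx s x)) := by
          exact (ContinuousLinearMap.toSpanSingletonCLE (𝕜 := ℝ) (E := ℝ)).continuous.comp cfx
        exact this.continuousAt)
    have h2 := h1.hasFDerivAt.comp_hasDerivAt s ((hasDerivAt_id s).prodMk (hyd s hs))
    refine HasDerivAt.congr_deriv h2 ?_
    simp [HasUncurry.uncurry]
  have ci : Continuous fun s => ft s (y s) + V s * fx s (y s) :=
    (cft.comp cy).add (hV.mul (cfx.comp cy))
  have h3 := intervalIntegral.integral_eq_sub_of_hasDerivAt_of_le ht.1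
    (f := fun s => f s (y s)) (cf.comp cy).continuousOn hd (ci.intervalIntegrable _ _)
  have h4 : f t (y t) = f 0 (y 0) + ∫ s in (0:ℝ)..t, (ft s (y s) + V s * fx s (y s)) := by
    rw [h3]; ring
  rw [h4]
  refine (enorm_add_le _ _).trans ?_
  gcongr
  rw [intervalIntegral.integral_of_le ht.1, ← integral_Icc_eq_integral_Ioc]
  exact enorm_integral_le_lintegral_enorm _

structure ClampedSol (b κ α t₁ : ℝ) (M : NNReal) (u ux uxx ut ρ ρt ρx : ℝ → ℝ → ℝ) : Prop where
  cu : Continuous (Function.uncurry u)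
  cux : Continuous (Function.uncurry ux)
  cuxx : Continuous (Function.uncurry uxx)
  cut : Continuous (Function.uncurry ut)
  cρ : Continuous (Function.uncurry ρ)
  cρt : Continuous (Function.uncurry ρt)
  cρx : Continuous (Function.uncurry ρx)
  bu : ∀ s x, |u s x| ≤ M
  bux : ∀ s x, |ux s x| ≤ M
  bρ : ∀ s x, |ρ s x| ≤ M
  hux : ∀ s x, HasDerivAt (u s) (ux s x) x
  huxx : ∀ s x, HasDerivAt (ux s) (uxx s x) x
  hρx : ∀ s x, HasDerivAt (ρ s) (ρx s x) x
  hut : ∀ s ∈ Set.Ioo 0 t₁, ∀ x, HasDerivAt (fun s => u s x) (ut s x) s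
  hρt : ∀ s ∈ Set.Ioo 0 t₁, ∀ x, HasDerivAt (fun s => ρ s x) (ρt s x) s
  hueq : ∀ s x, ut s x + u s x * ux s x =
    -deriv (greenConv (Pterm b κ α (u s) (ux s) (ρ s))) x
  hρeq : ∀ s x, ρt s x + u s x * ρx s x = -((b - 1) * ux s x * ρ s x)

noncomputable def Fsum (u ux ρ : ℝ → ℝ → ℝ) (s x : ℝ) : ℝ≥0∞ :=
  ‖u s x‖ₑ + ‖ux s x‖ₑ + ‖ρ s x‖ₑ

lemma pterm_bound (b κ α M a c r : ℝ) (ha : |a| ≤ M) (hc : |c| ≤ M) (hr : |r| ≤ M) :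
    |b / 2 * a ^ 2 + (3 - b) / 2 * c ^ 2 + κ / 2 * r ^ 2 - α * a| ≤
      (|b| * M + |3 - b| * M + |κ| * M + |α|) * (|a| + |c| + |r|) := by
  have hM : 0 ≤ M := (abs_nonneg a).trans ha
  have h1 : ∀ d e : ℝ, |e| ≤ M → |d / 2 * e ^ 2| ≤ |d| * M * |e| := by
    intro d e he
    rw [abs_mul, abs_div, abs_pow, abs_of_pos (two_pos : (0:ℝ) < 2), sq]
    have : |d| * (|e| * |e|) ≤ |d| * (M * |e|) := by gcongr
    have h0 : 0 ≤ |d| * (|e| * |e|) := by positivity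
    linarith
  have e1 := h1 b a ha
  have e2 := h1 (3 - b) c hc
  have e3 := h1 κ r hr
  have e4 : |α * a| = |α| * |a| := abs_mul _ _
  have t1 := abs_sub (b / 2 * a ^ 2 + (3 - b) / 2 * c ^ 2 + κ / 2 * r ^ 2) (α * a)
  have t2 := abs_add_three (b / 2 * a ^ 2) ((3 - b) / 2 * c ^ 2) (κ / 2 * r ^ 2)
  have p1 : 0 ≤ |b| * M := by positivity
  have p2 : 0 ≤ |3 - b| * M := by positivity
  have p3 : 0 ≤ |κ| * M := by positivity
  have p4 : 0 ≤ |α| := by positivity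
  have q1 : 0 ≤ |a| := by positivity
  have q2 : 0 ≤ |c| := by positivity
  have q3 : 0 ≤ |r| := by positivity
  generalize |b| * M = B1 at *
  generalize |3 - b| * M = B2 at *
  generalize |κ| * M = B3 at *
  generalize |α| = B4 at *
  generalize |a| = A1 at *
  generalize |c| = A2 at *
  generalize |r| = A3 at *
  nlinarith [mul_nonneg p1 q2, mul_nonneg p1 q3, mul_nonneg p2 q1, mul_nonneg p2 q3,
    mul_nonneg p3 q1, mul_nonneg p3 q2, mul_nonneg p4 q2, mul_nonneg p4 q3, mul_nonneg p4 q1]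

open Set Function in
lemma pointwise_ineq (b κ α : ℝ) (M : NNReal) : ∃ C : ℝ≥0∞, C ≠ ⊤ ∧
    ∀ (t₁ : ℝ) (u ux uxx ut ρ ρt ρx : ℝ → ℝ → ℝ),
      ClampedSol b κ α t₁ M u ux uxx ut ρ ρt ρx →
      ∀ t ∈ Icc 0 t₁, ∃ Y : ℝ → ℝ → ℝ, Continuous (uncurry Y) ∧
        (∀ y, ∀ s ∈ Icc 0 t, |Y s y - y| ≤ M * t) ∧
        (∀ s ∈ Icc 0 t, ∀ y z, |y - z| ≤ Real.exp (M * t) * |Y s y - Y s z|) ∧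
        ∀ y, Fsum u ux ρ t y ≤ C * (Fsum u ux ρ 0 (Y 0 y) + ∫⁻ s in Icc 0 t,
          (Fsum u ux ρ s (Y s y) +
            ∫⁻ z, ENNReal.ofReal (Real.exp (-|Y s y - z|)) * Fsum u ux ρ s z)) := by
  set Cp : ℝ := |b| * M + |3 - b| * M + |κ| * M + |α| with hCp
  have hCp0 : 0 ≤ Cp := by positivity
  set c : ℝ≥0∞ := ENNReal.ofReal Cp with hc
  have hct : c ≠ ⊤ := ENNReal.ofReal_ne_top
  set C : ℝ≥0∞ := 1 + M + 2 * c + ‖b - 1‖ₑ * M with hC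
  have hCt : C ≠ ⊤ := by
    rw [hC]; finiteness
  refine ⟨C, hCt, ?_⟩
  intro t₁ u ux uxx ut ρ ρt ρx S t ht
  have hM0 : (0:ℝ) ≤ M := M.2
  have hLip : ∀ s, LipschitzWith M (u s) := fun s =>
    lipschitzWith_of_nnnorm_deriv_le (fun x => (S.hux s x).differentiableAt) (fun x => by
      rw [(S.hux s x).deriv, ← NNReal.coe_le_coe]; simpa using S.bux s x)
  obtain ⟨Y, cY, hYt, hYd, hYb, hYa⟩ := flow_exists u S.cu M S.bu hLip t ht.1
  refine ⟨Y, cY, hYb, hYa, fun y => ?_⟩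
  set F := Fsum u ux ρ with hF
  set P : ℝ → ℝ → ℝ := fun s => Pterm b κ α (u s) (ux s) (ρ s) with hP
  have hPb : ∀ s x, ‖P s x‖ₑ ≤ c * F s x := by
    intro s x
    have := pterm_bound b κ α M _ _ _ (S.bu s x) (S.bux s x) (S.bρ s x)
    rw [hF, Fsum, hc, Real.enorm_eq_ofReal_abs, Real.enorm_eq_ofReal_abs,
      Real.enorm_eq_ofReal_abs, Real.enorm_eq_ofReal_abs,
      ← ENNReal.ofReal_add (by positivity) (by positivity),
      ← ENNReal.ofReal_add (by positivity) (by positivity), ← ENNReal.ofReal_mul hCp0]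
    exact ENNReal.ofReal_le_ofReal this
  have hPQ : ∀ s x, |P s x| ≤ Cp * (3 * M) := by
    intro s x
    refine (pterm_bound b κ α M _ _ _ (S.bu s x) (S.bux s x) (S.bρ s x)).trans ?_
    gcongr
    linarith [S.bu s x, S.bux s x, S.bρ s x]
  have cP : Continuous (uncurry P) := by
    have h1 := S.cu
    have h2 := S.cux
    have h3 := S.cρ
    simp only [hP, Pterm, uncurry_def] at *
    fun_prop
  have cPs : ∀ s, Continuous (P s) := fun s =>
    cP.comp (show Continuous fun x => ((s, x) : ℝ × ℝ) by fun_prop)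
  set utx : ℝ → ℝ → ℝ := fun s x =>
    -(ux s x * ux s x + u s x * uxx s x) - (greenConv (P s) x - P s x) with hutx
  have cutx : Continuous (uncurry utx) := by
    have h1 := S.cu
    have h2 := S.cux
    have h3 := S.cuxx
    have h4 := green_cont P cP hPQ
    simp only [hutx, uncurry_def] at *
    fun_prop
  have dutx : ∀ s x, HasDerivAt (ut s) (utx s x) x := by
    intro s x
    have e : ut s = fun x => -(u s x * ux s x) - deriv (greenConv (P s)) x := by
      ext x; linarith [S.hueq s x]
    rw [e]
    exact ((S.hux s x).mul (S.huxx s x)).neg.sub (green_deriv2 (cPs s) (hPQ s) x)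
  have hsch := schwarz_deriv t₁ u ux ut utx S.cut cutx S.hut S.hux dutx
  have cyy : Continuous fun s => Y s y := cY.comp (show Continuous fun s => ((s, y) : ℝ × ℝ) by fun_prop)
  have cV : Continuous fun s => u s (Y s y) :=
    S.cu.comp (show Continuous fun s => ((s, Y s y) : ℝ × ℝ) by fun_prop)
  have k1 := curve_bound t t₁ ht u ut ux S.cu S.cut S.cux S.hut S.hux _ _ cV cyy (hYd y)
  have k2 := curve_bound t t₁ ht ux utx uxx S.cux cutx S.cuxx hsch S.huxx _ _ cV cyy (hYd y)
  have k3 := curve_bound t t₁ ht ρ ρt ρx S.cρ S.cρt S.cρx S.hρt S.hρx _ _ cV cyy (hYd y)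
  rw [hYt] at k1 k2 k3
  set I : ℝ → ℝ≥0∞ := fun s => ∫⁻ z, ENNReal.ofReal (Real.exp (-|Y s y - z|)) * F s z with hI
  have hPI : ∀ s, ∫⁻ z, ENNReal.ofReal (Real.exp (-|Y s y - z|)) * ‖P s z‖ₑ ≤ c * I s := by
    intro s
    rw [hI, ← lintegral_const_mul' _ _ hct]
    refine lintegral_mono fun z => ?_
    calc _ ≤ ENNReal.ofReal (Real.exp (-|Y s y - z|)) * (c * F s z) :=
          mul_le_mul' le_rfl (hPb s z)
      _ = _ := by ring
  have mb : ∀ a : ℝ, |a| ≤ M → ‖a‖ₑ ≤ M := by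
    intro a ha
    rw [Real.enorm_eq_ofReal_abs]
    exact (ENNReal.ofReal_le_ofReal ha).trans_eq (by simp)
  have j1 : ∀ s, ‖ut s (Y s y) + u s (Y s y) * ux s (Y s y)‖ₑ ≤ c * I s := by
    intro s
    rw [S.hueq, enorm_neg]
    exact (green_deriv_bound (cPs s) (hPQ s) _).trans (hPI s)
  have j2 : ∀ s, ‖utx s (Y s y) + u s (Y s y) * uxx s (Y s y)‖ₑ ≤
      M * F s (Y s y) + c * F s (Y s y) + c * I s := by
    intro s
    have e : utx s (Y s y) + u s (Y s y) * uxx s (Y s y) =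
        -(ux s (Y s y) * ux s (Y s y)) + P s (Y s y) + -greenConv (P s) (Y s y) := by
      simp only [hutx]; ring
    rw [e]
    refine (enorm_add_le _ _).trans (add_le_add ((enorm_add_le _ _).trans (add_le_add ?_ (hPb _ _))) ?_)
    · rw [enorm_neg, enorm_mul]
      refine mul_le_mul' (mb _ (S.bux _ _)) ?_
      rw [hF, Fsum]
      exact le_add_right le_add_self
    · rw [enorm_neg]
      exact (green_bound _).trans (hPI s)
  have j3 : ∀ s, ‖ρt s (Y s y) + u s (Y s y) * ρx s (Y s y)‖ₑ ≤ ‖b - 1‖ₑ * M * F s (Y s y) := by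
    intro s
    rw [S.hρeq, enorm_neg, enorm_mul, enorm_mul]
    refine mul_le_mul' (mul_le_mul' le_rfl (mb _ (S.bux _ _))) ?_
    rw [hF, Fsum]
    exact le_add_self
  have hC1 : (1:ℝ≥0∞) ≤ C := by rw [hC, add_assoc, add_assoc]; exact le_self_add
  calc F t y ≤ (‖u 0 (Y 0 y)‖ₑ + ∫⁻ s in Icc 0 t, c * I s) +
        (‖ux 0 (Y 0 y)‖ₑ + ∫⁻ s in Icc 0 t, (M * F s (Y s y) + c * F s (Y s y) + c * I s)) +
        (‖ρ 0 (Y 0 y)‖ₑ + ∫⁻ s in Icc 0 t, ‖b - 1‖ₑ * M * F s (Y s y)) :=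
        add_le_add (add_le_add
          (k1.trans (add_le_add le_rfl (lintegral_mono j1)))
          (k2.trans (add_le_add le_rfl (lintegral_mono j2))))
          (k3.trans (add_le_add le_rfl (lintegral_mono j3)))
    _ = F 0 (Y 0 y) + ((∫⁻ s in Icc 0 t, c * I s) +
        (∫⁻ s in Icc 0 t, (M * F s (Y s y) + c * F s (Y s y) + c * I s)) +
        (∫⁻ s in Icc 0 t, ‖b - 1‖ₑ * M * F s (Y s y))) := by
        rw [hF, Fsum]; ring
    _ ≤ F 0 (Y 0 y) + ∫⁻ s in Icc 0 t, (c * I s + (M * F s (Y s y) + c * F s (Y s y) + c * I s) +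
        ‖b - 1‖ₑ * M * F s (Y s y)) :=
        add_le_add le_rfl ((add_le_add (le_lintegral_add _ _) le_rfl).trans (le_lintegral_add _ _))
    _ ≤ C * F 0 (Y 0 y) + ∫⁻ s in Icc 0 t, C * (F s (Y s y) + I s) := by
        refine add_le_add ?_ (lintegral_mono fun s => ?_)
        · exact le_mul_of_one_le_left' hC1
        · have e : c * I s + (M * F s (Y s y) + c * F s (Y s y) + c * I s) +
              ‖b - 1‖ₑ * M * F s (Y s y) + (F s (Y s y) + c * F s (Y s y) + (1 + M + ‖b - 1‖ₑ * M) * I s) =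
              C * (F s (Y s y) + I s) := by
            rw [hC]; ring
          rw [← e]
          exact le_self_add
    _ = _ := by
        rw [lintegral_const_mul' _ _ hCt, mul_add]

open Set Function in
lemma weighted_step (b κ α T : ℝ) (hT : 0 ≤ T) (M : NNReal) (w : ℝ → ℝ) (hw0 : ∀ x, 0 ≤ w x)
    (Bw : ℝ) (hBw : ∀ x, |x| ≤ M * T → w x ≤ Bw) (k : ℝ → ℝ≥0∞)
    (hk : k =ᵐ[volume] fun x => ENNReal.ofReal (w x * Real.exp (-|x|))) :
    ∃ K : ℝ≥0∞, K ≠ ⊤ ∧ ∀ ψ : ℝ → ℝ, (∀ x, 0 ≤ ψ x) → (∀ x y, ψ (x + y) ≤ w x * ψ y) →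
    ∀ t₁ ≤ T, ∀ (u ux uxx ut ρ ρt ρx : ℝ → ℝ → ℝ),
      ClampedSol b κ α t₁ M u ux uxx ut ρ ρt ρx →
      ∀ t ∈ Icc 0 t₁, ∃ Y : ℝ → ℝ → ℝ, Measurable (uncurry Y) ∧
        (∀ s ∈ Icc 0 t, ∀ g : ℝ → ℝ≥0∞, Measurable g →
          ∫⁻ y, g (Y s y) ≤ ENNReal.ofReal (Real.exp (M * T)) * ∫⁻ y, g y) ∧
        ∀ y, Fsum u ux ρ t y * ENNReal.ofReal (ψ y) ≤
          K * (Fsum u ux ρ 0 (Y 0 y) * ENNReal.ofReal (ψ (Y 0 y)) + ∫⁻ s in Icc 0 t,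
          (Fsum u ux ρ s (Y s y) * ENNReal.ofReal (ψ (Y s y)) +
            ∫⁻ z, k (Y s y - z) * (Fsum u ux ρ s z * ENNReal.ofReal (ψ z)))) := by
  obtain ⟨C, hC, hmain⟩ := pointwise_ineq b κ α M
  have hBw0 : 0 ≤ Bw := (hw0 0).trans (hBw 0 (by simp; positivity))
  refine ⟨C * ENNReal.ofReal Bw, by finiteness, ?_⟩
  intro ψ hψ0 hψ t₁ ht₁ u ux uxx ut ρ ρt ρx S t ht
  obtain ⟨Y, cY, hYb, hYa, hY⟩ := hmain t₁ u ux uxx ut ρ ρt ρx S t ht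
  have htT : t ≤ T := ht.2.trans ht₁
  refine ⟨Y, cY.measurable, ?_, fun y => ?_⟩
  · intro s hs g hg
    have hc : Continuous (Y s) := cY.comp (show Continuous fun x => ((s, x) : ℝ × ℝ) by fun_prop)
    have := lintegral_comp_antilip (Y s) hc (Real.toNNReal (Real.exp (M * T))) ?_ g hg
    · exact this
    · refine AntilipschitzWith.of_le_mul_dist fun x y => ?_
      rw [Real.coe_toNNReal _ (Real.exp_pos _).le, Real.dist_eq, Real.dist_eq]
      refine (hYa s hs x y).trans ?_
      gcongr
  · set F := Fsum u ux ρ with hF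
    set B := ENNReal.ofReal Bw with hB
    have hy : ∀ s ∈ Icc 0 t, ENNReal.ofReal (ψ y) ≤ B * ENNReal.ofReal (ψ (Y s y)) := by
      intro s hs
      rw [hB, ← ENNReal.ofReal_mul hBw0]
      apply ENNReal.ofReal_le_ofReal
      have h1 := hψ (y - Y s y) (Y s y)
      rw [sub_add_cancel] at h1
      refine h1.trans (mul_le_mul_of_nonneg_right (hBw _ ?_) (hψ0 _))
      rw [abs_sub_comm]
      exact (hYb y s hs).trans (by gcongr)
    have hy0 := hy 0 ⟨le_rfl, ht.1⟩
    have hz : ∀ x z, ENNReal.ofReal (ψ x) ≤ ENNReal.ofReal (w (x - z)) * ENNReal.ofReal (ψ z) := by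
      intro x z
      rw [← ENNReal.ofReal_mul (hw0 _)]
      apply ENNReal.ofReal_le_ofReal
      have h1 := hψ (x - z) z
      rwa [sub_add_cancel] at h1
    have hk' : ∀ a : ℝ, ∀ᵐ z, k (a - z) = ENNReal.ofReal (w (a - z) * Real.exp (-|a - z|)) :=
      fun a => (quasiMeasurePreserving_sub_left volume a).ae_eq_comp hk
    have hin : ∀ s ∈ Icc 0 t, (F s (Y s y) + ∫⁻ z, ENNReal.ofReal (Real.exp (-|Y s y - z|)) * F s z)
        * ENNReal.ofReal (ψ y) ≤ B * (F s (Y s y) * ENNReal.ofReal (ψ (Y s y)) +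
            ∫⁻ z, k (Y s y - z) * (F s z * ENNReal.ofReal (ψ z))) := by
      intro s hs
      rw [add_mul, mul_add]
      refine add_le_add ?_ ?_
      · refine (mul_le_mul' le_rfl (hy s hs)).trans_eq (by ring)
      · rw [← lintegral_mul_const' _ _ ENNReal.ofReal_ne_top,
          ← lintegral_const_mul' _ _ ENNReal.ofReal_ne_top]
        refine lintegral_mono_ae ?_
        filter_upwards [hk' (Y s y)] with z hkz
        rw [hkz, ENNReal.ofReal_mul (hw0 _)]
        refine (mul_le_mul' le_rfl ((hy s hs).trans (mul_le_mul' le_rfl (hz _ z)))).trans_eq ?_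
        ring
    calc F t y * ENNReal.ofReal (ψ y) ≤ _ := mul_le_mul' (hY y) le_rfl
      _ = C * (F 0 (Y 0 y) * ENNReal.ofReal (ψ y) + ∫⁻ s in Icc 0 t,
          (F s (Y s y) + ∫⁻ z, ENNReal.ofReal (Real.exp (-|Y s y - z|)) * F s z)
            * ENNReal.ofReal (ψ y)) := by
          rw [lintegral_mul_const' _ _ ENNReal.ofReal_ne_top]; ring
      _ ≤ C * (B * (F 0 (Y 0 y) * ENNReal.ofReal (ψ (Y 0 y))) + ∫⁻ s in Icc 0 t,
          B * (F s (Y s y) * ENNReal.ofReal (ψ (Y s y)) +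
            ∫⁻ z, k (Y s y - z) * (F s z * ENNReal.ofReal (ψ z)))) := by
          refine mul_le_mul' le_rfl (add_le_add ?_ (setLIntegral_mono' measurableSet_Icc hin))
          exact (mul_le_mul' le_rfl hy0).trans_eq (by ring)
      _ = _ := by
          rw [lintegral_const_mul' _ _ ENNReal.ofReal_ne_top]; ring

noncomputable def psiN (φ : ℝ → ℝ) (N : ℕ) (x : ℝ) : ℝ := min (φ x) (N * Real.exp (-|x| / 2))

lemma psiN_nonneg (φ : ℝ → ℝ) (hφ : ∀ x, 0 < φ x) (N : ℕ) (x : ℝ) : 0 ≤ psiN φ N x :=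
  le_min (hφ x).le (by positivity)

lemma psiN_le (φ : ℝ → ℝ) (N : ℕ) (x : ℝ) : psiN φ N x ≤ φ x := min_le_left _ _

lemma psiN_cont (φ : ℝ → ℝ) (hφ : Continuous φ) (N : ℕ) : Continuous (psiN φ N) := by
  unfold psiN; fun_prop

lemma psiN_mod (φ w : ℝ → ℝ) (hφ : ∀ x, 0 < φ x) (hw : ∀ x, 0 ≤ w x)
    (hmod : ∀ x y, φ (x + y) ≤ w x * φ y) (N : ℕ) (x y : ℝ) :
    psiN φ N (x + y) ≤ (w x + Real.exp (|x| / 2)) * psiN φ N y := by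
  have h0 := hw x
  have he := Real.exp_pos (|x| / 2)
  have h2 : (N : ℝ) * Real.exp (-|x + y| / 2) ≤ Real.exp (|x| / 2) * (N * Real.exp (-|y| / 2)) := by
    rw [mul_left_comm, ← Real.exp_add]
    gcongr
    have := abs_sub (x + y) x
    rw [add_sub_cancel_left] at this
    linarith
  have h3 := hmod x y
  have h4 : 0 ≤ (N : ℝ) * Real.exp (-|y| / 2) := by positivity
  have h5 := (hφ y).le
  unfold psiN
  rcases le_total (φ y) (N * Real.exp (-|y| / 2)) with h | h
  · rw [min_eq_left h]
    refine (min_le_left _ _).trans ?_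
    nlinarith
  · rw [min_eq_right h]
    refine (min_le_right _ _).trans ?_
    nlinarith

open Filter in
lemma psiN_eventually (φ : ℝ → ℝ) (x : ℝ) : ∀ᶠ N : ℕ in atTop, psiN φ N x = φ x := by
  obtain ⟨n, hn⟩ := exists_nat_ge (φ x / Real.exp (-|x| / 2))
  filter_upwards [eventually_ge_atTop n] with N hN
  refine min_eq_left ?_
  rw [div_le_iff₀ (Real.exp_pos _)] at hn
  refine hn.trans ?_
  have : (n:ℝ) ≤ N := by exact_mod_cast hN
  gcongr

lemma Fsum_le (b κ α t₁ : ℝ) (M : NNReal) (u ux uxx ut ρ ρt ρx : ℝ → ℝ → ℝ)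
    (S : ClampedSol b κ α t₁ M u ux uxx ut ρ ρt ρx) (s x : ℝ) : Fsum u ux ρ s x ≤ 3 * M := by
  have mb : ∀ a : ℝ, |a| ≤ M → ‖a‖ₑ ≤ M := by
    intro a ha
    rw [Real.enorm_eq_ofReal_abs]
    exact (ENNReal.ofReal_le_ofReal ha).trans_eq (by simp)
  unfold Fsum
  calc _ ≤ (M : ℝ≥0∞) + M + M :=
        add_le_add (add_le_add (mb _ (S.bu s x)) (mb _ (S.bux s x))) (mb _ (S.bρ s x))
    _ = _ := by ring

lemma Fsum_cont (b κ α t₁ : ℝ) (M : NNReal) (u ux uxx ut ρ ρt ρx : ℝ → ℝ → ℝ)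
    (S : ClampedSol b κ α t₁ M u ux uxx ut ρ ρt ρx) :
    Continuous (Function.uncurry (Fsum u ux ρ)) :=
  (S.cu.enorm.add S.cux.enorm).add S.cρ.enorm

lemma ae_le_of_cont (g : ℝ → ℝ≥0∞) (hg : Continuous g) (c : ℝ≥0∞) (h : ∀ᵐ x, g x ≤ c) (x : ℝ) :
    g x ≤ c := by
  by_contra hx
  have ho : IsOpen {x | c < g x} := isOpen_lt continuous_const hg
  have h0 : volume {x | c < g x} = 0 := by
    have := ae_iff.1 h
    simpa only [not_le] using this
  rw [ho.measure_eq_zero_iff (μ := volume)] at h0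
  have : x ∈ ({x | c < g x} : Set ℝ) := not_le.1 hx
  rw [h0] at this
  exact this

lemma Fsum_mul (u ux ρ : ℝ → ℝ → ℝ) (s x r : ℝ) (hr : 0 ≤ r) :
    Fsum u ux ρ s x * ENNReal.ofReal r = ‖u s x * r‖ₑ + ‖ux s x * r‖ₑ + ‖ρ s x * r‖ₑ := by
  simp only [Fsum, enorm_mul, Real.enorm_of_nonneg hr]
  ring

open Set Function Filter in
lemma main_bound (p : ℝ≥0∞) (hp : 1 ≤ p) (b κ α T : ℝ) (hT : 0 ≤ T) (M : NNReal) (φ w : ℝ → ℝ)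
    (hφ : ∀ x, 0 < φ x) (hφc : Continuous φ) (hw : ∀ x, 0 ≤ w x)
    (hmod : ∀ x y, φ (x + y) ≤ w x * φ y)
    (hwi : Integrable (fun x => w x * Real.exp (-|x|)))
    (hwl : ∀ R : ℝ, ∃ C : ℝ, ∀ x, |x| ≤ R → w x ≤ C) :
    ∃ B : ℝ≥0∞, B ≠ ⊤ ∧ ∀ t₁ ∈ Icc 0 T, ∀ (u ux uxx ut ρ ρt ρx : ℝ → ℝ → ℝ),
      ClampedSol b κ α t₁ M u ux uxx ut ρ ρt ρx →
      eLpNorm (fun x => Fsum u ux ρ t₁ x * ENNReal.ofReal (φ x)) p volume ≤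
        B * eLpNorm (fun x => Fsum u ux ρ 0 x * ENNReal.ofReal (φ x)) p volume := by
  set w' : ℝ → ℝ := fun x => w x + Real.exp (|x| / 2) with hw'
  have hw'0 : ∀ x, 0 ≤ w' x := fun x => add_nonneg (hw x) (Real.exp_pos _).le
  have hw'i : Integrable (fun x => w' x * Real.exp (-|x|)) := by
    have h1 := hwi.add (integrable_exp_abs (1/2) (by norm_num))
    refine h1.congr (Eventually.of_forall fun x => ?_)
    simp only [hw', Pi.add_apply, add_mul]
    congr 1
    rw [← Real.exp_add]
    ring_nf
  obtain ⟨Cw, hCw⟩ := hwl (M * T)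
  have hBw : ∀ x, |x| ≤ M * T → w' x ≤ Cw + Real.exp (M * T / 2) := by
    intro x hx
    refine add_le_add (hCw x hx) ?_
    gcongr
  have hm := hw'i.aestronglyMeasurable.aemeasurable.ennreal_ofReal
  set k := hm.mk _ with hk
  have hkm : Measurable k := hm.measurable_mk
  have hke : k =ᵐ[volume] fun x => ENNReal.ofReal (w' x * Real.exp (-|x|)) := hm.ae_eq_mk.symm
  have hki : ∫⁻ z, k z ≠ ⊤ := by
    rw [lintegral_congr_ae hke]
    exact ((hasFiniteIntegral_iff_ofReal (Eventually.of_forall fun x =>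
      mul_nonneg (hw'0 x) (Real.exp_pos _).le)).1 hw'i.2).ne
  obtain ⟨K, hK, hstep⟩ := weighted_step b κ α T hT M w' hw'0 _ hBw k hke
  have hψle : ∀ N x, ENNReal.ofReal (psiN φ N x) ≤ ENNReal.ofReal (φ x) := fun N x =>
    ENNReal.ofReal_le_ofReal (psiN_le φ N x)
  have hψle2 : ∀ (N : ℕ) x, ENNReal.ofReal (psiN φ N x) ≤
      N * ENNReal.ofReal (Real.exp (-|x| / 2)) := fun N x => by
    refine (ENNReal.ofReal_le_ofReal (min_le_right _ _)).trans_eq ?_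
    rw [ENNReal.ofReal_mul (by positivity), ENNReal.ofReal_natCast]
  rcases eq_or_ne p ⊤ with rfl | hpt
  · obtain ⟨B, hB, hgr⟩ := gron_top T K _ hK hki
    refine ⟨B, hB, ?_⟩
    intro t₁ ht₁ u ux uxx ut ρ ρt ρx S
    have cF := Fsum_cont _ _ _ _ _ _ _ _ _ _ _ _ S
    have cF0 : Continuous fun x => Fsum u ux ρ 0 x * ENNReal.ofReal (φ x) := by
      simp_rw [fun x => Fsum_mul u ux ρ 0 x (φ x) (hφ x).le]
      have h0 : Continuous fun x : ℝ => (((0:ℝ), x) : ℝ × ℝ) := by fun_prop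
      exact (((S.cu.comp h0).mul hφc).enorm.add ((S.cux.comp h0).mul hφc).enorm).add
        ((S.cρ.comp h0).mul hφc).enorm
    have hb := Fsum_le _ _ _ _ _ _ _ _ _ _ _ _ S
    rw [eLpNorm_exponent_top, eLpNorm_exponent_top]
    set E := eLpNormEssSup (fun x => Fsum u ux ρ 0 x * ENNReal.ofReal (φ x)) volume with hE
    have h0E : ∀ x, Fsum u ux ρ 0 x * ENNReal.ofReal (φ x) ≤ E :=
      ae_le_of_cont _ cF0 E (enorm_ae_le_eLpNormEssSup
        (fun x => Fsum u ux ρ 0 x * ENNReal.ofReal (φ x)) volume)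
    have hN : ∀ (N : ℕ) x, Fsum u ux ρ t₁ x * ENNReal.ofReal (psiN φ N x) ≤ B * E := by
      intro N x
      have h1 := hgr t₁ ht₁.2 (fun s x => Fsum u ux ρ s x * ENNReal.ofReal (psiN φ N x)) k
        (3 * M * N) hkm le_rfl (by finiteness) ?_ ?_ t₁ ⟨ht₁.1, le_rfl⟩
      · refine (le_iSup (fun x => Fsum u ux ρ t₁ x * ENNReal.ofReal (psiN φ N x)) x).trans
          (h1.trans (mul_le_mul' le_rfl (iSup_le fun z => ?_)))
        exact (mul_le_mul' le_rfl (hψle N z)).trans (h0E z)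
      · intro s _ x
        refine mul_le_mul' (hb s x) ((hψle2 N x).trans ?_)
        refine mul_le_of_le_one_right' ?_
        rw [ENNReal.ofReal_le_one, Real.exp_le_one_iff]
        linarith [abs_nonneg x]
      · intro t ht
        obtain ⟨Y, _, _, hY⟩ := hstep (psiN φ N) (psiN_nonneg φ hφ N)
          (psiN_mod φ w hφ hw hmod N) t₁ ht₁.2 u ux uxx ut ρ ρt ρx S t ht
        exact ⟨Y, hY⟩
    refine eLpNormEssSup_le_of_ae_enorm_bound (Eventually.of_forall fun x => ?_)
    obtain ⟨N, hNx⟩ := (psiN_eventually φ x).exists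
    have := hN N x
    rwa [hNx] at this
  · set q := p.toReal with hq
    have hq1 : 1 ≤ q := by
      rw [hq]
      exact (ENNReal.toReal_mono hpt hp).trans_eq' (by simp)
    have hp0 : p ≠ 0 := (one_pos.trans_le hp).ne'
    obtain ⟨B, hB, hgr⟩ := gron_p q hq1 T K (ENNReal.ofReal (Real.exp (M * T))) _ hK
      ENNReal.ofReal_ne_top hki
    refine ⟨B ^ (1 / q), by finiteness, ?_⟩
    intro t₁ ht₁ u ux uxx ut ρ ρt ρx S
    have cF := Fsum_cont _ _ _ _ _ _ _ _ _ _ _ _ S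
    have hb := Fsum_le _ _ _ _ _ _ _ _ _ _ _ _ S
    have cFt : Measurable (Fsum u ux ρ t₁) := 
      (cF.comp (show Continuous fun x => ((t₁, x) : ℝ × ℝ) by fun_prop)).measurable
    have hN : ∀ N : ℕ, ∫⁻ x, (Fsum u ux ρ t₁ x * ENNReal.ofReal (psiN φ N x)) ^ q ≤
        B * ∫⁻ x, (Fsum u ux ρ 0 x * ENNReal.ofReal (φ x)) ^ q := by
      intro N
      have hψm : Measurable (psiN φ N) := (psiN_cont φ hφc N).measurable
      have h1 := hgr t₁ ht₁.2 (fun s x => Fsum u ux ρ s x * ENNReal.ofReal (psiN φ N x)) k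
        (∫⁻ x, (3 * M * (N * ENNReal.ofReal (Real.exp (-|x| / 2)))) ^ q)
        (cF.measurable.mul (hψm.comp measurable_snd).ennreal_ofReal) hkm le_rfl ?_ ?_ ?_ t₁
        ⟨ht₁.1, le_rfl⟩
      · refine h1.trans (mul_le_mul' le_rfl (lintegral_mono fun x => ?_))
        exact ENNReal.rpow_le_rpow (mul_le_mul' le_rfl (hψle N x)) (by positivity)
      · have e : ∀ x : ℝ, (3 * M * (N * ENNReal.ofReal (Real.exp (-|x| / 2)))) ^ q =
            (3 * (M:ℝ≥0∞) * N) ^ q * ENNReal.ofReal (Real.exp (-(q / 2 * |x|))) := by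
          intro x
          rw [← mul_assoc, ENNReal.mul_rpow_of_nonneg _ _ (by positivity),
            ENNReal.ofReal_rpow_of_nonneg (Real.exp_pos _).le (by positivity), ← Real.exp_mul]
          ring_nf
        simp_rw [e]
        have hf : (3 * (M:ℝ≥0∞) * N) ^ q ≠ ⊤ := by finiteness
        rw [lintegral_const_mul' _ _ hf]
        refine ENNReal.mul_ne_top hf ?_
        exact ((hasFiniteIntegral_iff_ofReal (Eventually.of_forall fun x =>
          (Real.exp_pos _).le)).1 (integrable_exp_abs (q / 2) (by positivity)).2).ne
      · intro s _
        refine lintegral_mono fun x => ENNReal.rpow_le_rpow ?_ (by positivity)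
        exact mul_le_mul' (hb s x) (hψle2 N x)
      · exact hstep (psiN φ N) (psiN_nonneg φ hφ N) (psiN_mod φ w hφ hw hmod N) t₁ ht₁.2
          u ux uxx ut ρ ρt ρx S
    have hlim : ∫⁻ x, (Fsum u ux ρ t₁ x * ENNReal.ofReal (φ x)) ^ q ≤
        B * ∫⁻ x, (Fsum u ux ρ 0 x * ENNReal.ofReal (φ x)) ^ q := by
      have h1 := lintegral_liminf_le (μ := volume) (u := atTop) (f := fun (N : ℕ) x =>
        (Fsum u ux ρ t₁ x * ENNReal.ofReal (psiN φ N x)) ^ q) (fun N =>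
          ((cFt.mul (psiN_cont φ hφc N).measurable.ennreal_ofReal).pow_const q))
      have h2 : ∀ x, liminf (fun N : ℕ => (Fsum u ux ρ t₁ x * ENNReal.ofReal (psiN φ N x)) ^ q)
          atTop = (Fsum u ux ρ t₁ x * ENNReal.ofReal (φ x)) ^ q := by
        intro x
        refine Tendsto.liminf_eq (tendsto_const_nhds.congr' ?_)
        filter_upwards [psiN_eventually φ x] with N hN
        rw [hN]
      simp_rw [h2] at h1
      refine h1.trans ?_
      have h3 := liminf_le_liminf (f := atTop) (Eventually.of_forall hN)
      simpa using h3
    rw [eLpNorm_eq_lintegral_rpow_enorm_toReal hp0 hpt,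
      eLpNorm_eq_lintegral_rpow_enorm_toReal hp0 hpt]
    simp only [enorm_eq_self]
    rw [← ENNReal.mul_rpow_of_nonneg _ _ (by positivity)]
    exact ENNReal.rpow_le_rpow hlim (by positivity)

lemma weight_loc_bound (v : ℝ → ℝ) (hv_pos : ∀ x, 0 < v x)
    (hv_sub : ∀ x y : ℝ, v (x + y) ≤ v x * v y)
    (hv_int : Integrable (fun x => v x * Real.exp (-|x|)) volume) (R : ℝ) :
    ∃ C : ℝ, ∀ x, |x| ≤ R → v x ≤ C := by
  have hloc : ∀ a b : ℝ, IntervalIntegrable v volume a b := by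
    intro a b
    have h1 : IntegrableOn (fun x => v x * Real.exp (-|x|)) (Set.uIcc a b) := hv_int.integrableOn
    have h2 := h1.mul_continuousOn (g' := fun x => Real.exp |x|) (by fun_prop) isCompact_uIcc
    rw [intervalIntegrable_iff']
    refine h2.congr_fun (fun x _ => ?_) measurableSet_uIcc
    simp only [mul_assoc, ← Real.exp_add]
    simp
  refine ⟨(∫ y in (-(R + 1))..(R + 1), v y) ^ 2, fun x hx => ?_⟩
  have hR : 0 ≤ R := (abs_nonneg x).trans hx
  obtain ⟨hx1, hx2⟩ := abs_le.1 hx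
  set I := ∫ y in (-(R + 1))..(R + 1), v y with hI
  have hpt : ∀ y, 2 * √(v x) ≤ v (x - y) + v y := by
    intro y
    have h1 := hv_sub (x - y) y
    rw [sub_add_cancel] at h1
    have ha := hv_pos (x - y)
    have hb := hv_pos y
    have h2 : √(v x) ≤ (v (x - y) + v y) / 2 := by
      apply Real.sqrt_le_iff.2
      constructor
      · positivity
      · nlinarith [sq_nonneg (v (x - y) - v y)]
    linarith
  have i1 : IntervalIntegrable (fun y => v (x - y)) volume 0 1 := by
    have := (hloc (x - 0) (x - 1)).comp_sub_left x
    simpa using this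
  have h3 := intervalIntegral.integral_mono_on (a := 0) (b := 1) (μ := volume) zero_le_one
    (by simp : IntervalIntegrable (fun _ => 2 * √(v x)) volume 0 1) (i1.add (hloc 0 1))
    (fun y _ => hpt y)
  rw [intervalIntegral.integral_add i1 (hloc 0 1),
    intervalIntegral.integral_comp_sub_left (fun y => v y)] at h3
  have hnn : ∀ s : Set ℝ, 0 ≤ᵐ[volume.restrict s] v := fun s =>
    Filter.Eventually.of_forall fun y => (hv_pos y).le
  have h4 : ∫ y in (x - 1)..(x - 0), v y ≤ I :=
    intervalIntegral.integral_mono_interval (by linarith) (by linarith) (by linarith) (hnn _)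
      (hloc _ _)
  have h5 : ∫ y in (0:ℝ)..1, v y ≤ I :=
    intervalIntegral.integral_mono_interval (by linarith) (by linarith) (by linarith) (hnn _)
      (hloc _ _)
  have h6 : √(v x) ≤ I := by
    simp at h3 h4
    linarith
  have h7 : 0 ≤ √(v x) := Real.sqrt_nonneg _
  calc v x = √(v x) ^ 2 := (Real.sq_sqrt (hv_pos x).le).symm
    _ ≤ I ^ 2 := by gcongr

/-- Clamping of the time variable to `[0, t₁]`. -/
noncomputable def clampT (t₁ s : ℝ) : ℝ := max 0 (min s t₁)

lemma clampT_cont (t₁ : ℝ) : Continuous (clampT t₁) := by unfold clampT; fun_prop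

lemma clampT_mem (T t₁ : ℝ) (h : t₁ ∈ Set.Ico 0 T) (s : ℝ) : clampT t₁ s ∈ Set.Ico 0 T :=
  ⟨le_max_left _ _, max_lt (h.1.trans_lt h.2) ((min_le_right _ _).trans_lt h.2)⟩

lemma clampT_eq (t₁ s : ℝ) (h : s ∈ Set.Icc 0 t₁) : clampT t₁ s = s := by
  rw [clampT, min_eq_left h.2, max_eq_right h.1]

lemma clamp_cont (T t₁ : ℝ) (h : t₁ ∈ Set.Ico 0 T) (f : ℝ → ℝ → ℝ)
    (hf : ContinuousOn (fun q : ℝ × ℝ => f q.1 q.2) (Set.Ico 0 T ×ˢ (Set.univ : Set ℝ))) :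
    Continuous (Function.uncurry fun s => f (clampT t₁ s)) := by
  have hc := clampT_cont t₁
  exact hf.comp_continuous (f := fun q : ℝ × ℝ => ((clampT t₁ q.1, q.2) : ℝ × ℝ)) (by fun_prop)
    (fun q => ⟨clampT_mem T t₁ h q.1, trivial⟩)

open Set Filter Topology in
lemma clamp_deriv (T t₁ : ℝ) (h : t₁ ∈ Set.Ico 0 T) (f ft : ℝ → ℝ → ℝ)
    (hf : ∀ t ∈ Set.Ico (0 : ℝ) T, ∀ x : ℝ,
      HasDerivWithinAt (fun s => f s x) (ft t x) (Set.Ico 0 T) t) :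
    ∀ s ∈ Ioo 0 t₁, ∀ x, HasDerivAt (fun s => f (clampT t₁ s) x) (ft (clampT t₁ s) x) s := by
  intro s hs x
  rw [clampT_eq t₁ s ⟨hs.1.le, hs.2.le⟩]
  have hsT : s < T := hs.2.trans h.2
  have h1 := (hf s ⟨hs.1.le, hsT⟩ x).hasDerivAt (Ico_mem_nhds hs.1 hsT)
  refine h1.congr_of_eventuallyEq ?_
  filter_upwards [Icc_mem_nhds hs.1 hs.2] with r hr
  rw [clampT_eq t₁ r hr]

open Set in
lemma final_weight (p : ℝ≥0∞) (hp : 1 ≤ p) (b κ α T : ℝ) (hT : 0 ≤ T) (M : NNReal) (φ w : ℝ → ℝ)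
    (hφ : ∀ x, 0 < φ x) (hφc : Continuous φ) (hw : ∀ x, 0 ≤ w x)
    (hmod : ∀ x y, φ (x + y) ≤ w x * φ y)
    (hwi : Integrable (fun x => w x * Real.exp (-|x|)))
    (hwl : ∀ R : ℝ, ∃ C : ℝ, ∀ x, |x| ≤ R → w x ≤ C)
    (u ux uxx ut ρ ρt ρx : ℝ → ℝ → ℝ)
    (hcl : ∀ t₁ ∈ Ico 0 T, ClampedSol b κ α t₁ M (fun s => u (clampT t₁ s))
      (fun s => ux (clampT t₁ s)) (fun s => uxx (clampT t₁ s)) (fun s => ut (clampT t₁ s))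
      (fun s => ρ (clampT t₁ s)) (fun s => ρt (clampT t₁ s)) (fun s => ρx (clampT t₁ s)))
    (hu0 : MemLp (fun x => u 0 x * φ x) p volume)
    (hux0 : MemLp (fun x => ux 0 x * φ x) p volume)
    (hρ0 : MemLp (fun x => ρ 0 x * φ x) p volume) :
    (⨆ t ∈ Set.Ico (0 : ℝ) T,
      (eLpNorm (fun x => u t x * φ x) p volume +
        eLpNorm (fun x => ux t x * φ x) p volume +
        eLpNorm (fun x => ρ t x * φ x) p volume)) < ⊤ := by
  obtain ⟨B, hB, hmain⟩ := main_bound p hp b κ α T hT M φ w hφ hφc hw hmod hwi hwl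
  set E0 := eLpNorm (fun x => Fsum u ux ρ 0 x * ENNReal.ofReal (φ x)) p volume with hE0
  have hE0t : E0 < ⊤ := by
    have e : (fun x => Fsum u ux ρ 0 x * ENNReal.ofReal (φ x)) =
        (fun x => ‖u 0 x * φ x‖ₑ) + (fun x => ‖ux 0 x * φ x‖ₑ) + (fun x => ‖ρ 0 x * φ x‖ₑ) := by
      ext x
      exact Fsum_mul u ux ρ 0 x (φ x) (hφ x).le
    have m1 := hu0.1.enorm.aestronglyMeasurable
    have m2 := hux0.1.enorm.aestronglyMeasurable
    have m3 := hρ0.1.enorm.aestronglyMeasurable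
    rw [hE0, e]
    refine (eLpNorm_add_le (m1.add m2) m3 hp).trans_lt ?_
    refine (add_le_add (eLpNorm_add_le m1 m2 hp) le_rfl).trans_lt ?_
    simp only [eLpNorm_enorm]
    exact ENNReal.add_lt_top.2 ⟨ENNReal.add_lt_top.2 ⟨hu0.2, hux0.2⟩, hρ0.2⟩
  refine lt_of_le_of_lt (b := B * E0 + B * E0 + B * E0) ?_ (by finiteness)
  refine iSup₂_le fun t ht => ?_
  have h1 := hmain t ⟨ht.1, ht.2.le⟩ _ _ _ _ _ _ _ (hcl t ht)
  have e1 : ∀ x, Fsum (fun s => u (clampT t s)) (fun s => ux (clampT t s))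
      (fun s => ρ (clampT t s)) t x = Fsum u ux ρ t x := by
    intro x; simp only [Fsum, clampT_eq t t ⟨ht.1, le_rfl⟩]
  have e2 : ∀ x, Fsum (fun s => u (clampT t s)) (fun s => ux (clampT t s))
      (fun s => ρ (clampT t s)) 0 x = Fsum u ux ρ 0 x := by
    intro x; simp only [Fsum, clampT_eq t 0 ⟨le_rfl, ht.1⟩]
  simp only [e1, e2] at h1
  have h2 : ∀ f : ℝ → ℝ, (∀ x, ‖f x‖ₑ ≤ Fsum u ux ρ t x) →
      eLpNorm (fun x => f x * φ x) p volume ≤ B * E0 := by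
    intro f hf
    refine le_trans (eLpNorm_mono_enorm fun x => ?_) h1
    rw [enorm_eq_self, enorm_mul, Real.enorm_of_nonneg (hφ x).le]
    exact mul_le_mul' (hf x) le_rfl
  refine add_le_add (add_le_add (h2 _ fun x => ?_) (h2 _ fun x => ?_)) (h2 _ fun x => ?_)
  · exact le_add_right le_self_add
  · exact le_add_right le_add_self
  · exact le_add_self

/-- Persistence in the limit case: for an admissible weight `φ` with in
addition `v e^{-|·|} ∈ L^p`, a strong solution `(u,ρ)` of the nonlocal two-component
Camassa–Holm system on `[0,T)` with `M < ∞`, `u(0)φ, ∂_x u(0)φ, ρ(0)φ ∈ L^p` and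
`u(0)φ^{1/2}, ∂_x u(0)φ^{1/2}, ρ(0)φ^{1/2} ∈ L²` has
`sup_{t<T} (‖u(t)φ‖_{L^p} + ‖∂_x u(t)φ‖_{L^p} + ‖ρ(t)φ‖_{L^p}) < ∞` and
`sup_{t<T} (‖u(t)φ^{1/2}‖_{L²} + ‖∂_x u(t)φ^{1/2}‖_{L²} + ‖ρ(t)φ^{1/2}‖_{L²}) < ∞`. -/
theorem stmt12 (p : ℝ≥0∞) (hp : 1 ≤ p) (b κ α T A C₀ M : ℝ)
    (hT : 0 < T) (hA : 0 < A) (hC₀ : 0 < C₀)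
    -- the admissible weight φ and the sub-multiplicative weight v
    (φ v : ℝ → ℝ) (hφ_pos : ∀ x, 0 < φ x) (hv_pos : ∀ x, 0 < v x)
    (hφ_cont : Continuous φ)
    (hφ' : ∀ᵐ x : ℝ ∂volume, |deriv φ x| ≤ A * φ x)
    (hv_sub : ∀ x y : ℝ, v (x + y) ≤ v x * v y)
    (hv_inf : ∃ δ > (0 : ℝ), ∀ x, δ ≤ v x)
    (hv_int : Integrable (fun x => v x * Real.exp (-|x|)) volume)
    (hmod : ∀ x y : ℝ, φ (x + y) ≤ C₀ * v x * φ y)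
    -- the additional limit-case assumption v e^{-|·|} ∈ L^p
    (hvLp : MemLp (fun x => v x * Real.exp (-|x|)) p volume)
    -- the strong solution (u, ρ) of the nonlocal system, with derivatives ut, ux, uxx, ρt, ρx
    (u ux uxx ut ρ ρt ρx : ℝ → ℝ → ℝ)
    (hu_cont : ContinuousOn (fun q : ℝ × ℝ => u q.1 q.2)
      (Set.Ico 0 T ×ˢ (Set.univ : Set ℝ)))
    (hux_cont : ContinuousOn (fun q : ℝ × ℝ => ux q.1 q.2)
      (Set.Ico 0 T ×ˢ (Set.univ : Set ℝ)))
    (huxx_cont : ContinuousOn (fun q : ℝ × ℝ => uxx q.1 q.2)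
      (Set.Ico 0 T ×ˢ (Set.univ : Set ℝ)))
    (hut_cont : ContinuousOn (fun q : ℝ × ℝ => ut q.1 q.2)
      (Set.Ico 0 T ×ˢ (Set.univ : Set ℝ)))
    (hρ_cont : ContinuousOn (fun q : ℝ × ℝ => ρ q.1 q.2)
      (Set.Ico 0 T ×ˢ (Set.univ : Set ℝ)))
    (hρt_cont : ContinuousOn (fun q : ℝ × ℝ => ρt q.1 q.2)
      (Set.Ico 0 T ×ˢ (Set.univ : Set ℝ)))
    (hρx_cont : ContinuousOn (fun q : ℝ × ℝ => ρx q.1 q.2)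
      (Set.Ico 0 T ×ˢ (Set.univ : Set ℝ)))
    (hux : ∀ t ∈ Set.Ico (0 : ℝ) T, ∀ x : ℝ, HasDerivAt (u t) (ux t x) x)
    (huxx : ∀ t ∈ Set.Ico (0 : ℝ) T, ∀ x : ℝ, HasDerivAt (ux t) (uxx t x) x)
    (hut : ∀ t ∈ Set.Ico (0 : ℝ) T, ∀ x : ℝ,
      HasDerivWithinAt (fun s => u s x) (ut t x) (Set.Ico 0 T) t)
    (hρx : ∀ t ∈ Set.Ico (0 : ℝ) T, ∀ x : ℝ, HasDerivAt (ρ t) (ρx t x) x)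
    (hρt : ∀ t ∈ Set.Ico (0 : ℝ) T, ∀ x : ℝ,
      HasDerivWithinAt (fun s => ρ s x) (ρt t x) (Set.Ico 0 T) t)
    -- the nonlocal system
    (hueq : ∀ t ∈ Set.Ico (0 : ℝ) T, ∀ x : ℝ,
      ut t x + u t x * ux t x =
        -deriv (greenConv (Pterm b κ α (u t) (ux t) (ρ t))) x)
    (hρeq : ∀ t ∈ Set.Ico (0 : ℝ) T, ∀ x : ℝ,
      ρt t x + u t x * ρx t x = -((b - 1) * ux t x * ρ t x))
    -- integrability of the solution
    (hL2Linf : ∀ t ∈ Set.Ico (0 : ℝ) T,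
      MemLp (u t) 2 volume ∧ MemLp (u t) ⊤ volume ∧
      MemLp (ux t) 2 volume ∧ MemLp (ux t) ⊤ volume ∧
      MemLp (ρ t) 2 volume ∧ MemLp (ρ t) ⊤ volume)
    -- the uniform bound M
    (hM : ∀ t ∈ Set.Ico (0 : ℝ) T,
      eLpNorm (u t) ⊤ volume + eLpNorm (ux t) ⊤ volume + eLpNorm (ρ t) ⊤ volume ≤
        ENNReal.ofReal M)
    -- weighted initial data
    (hu0 : MemLp (fun x => u 0 x * φ x) p volume)
    (hux0 : MemLp (fun x => ux 0 x * φ x) p volume)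
    (hρ0 : MemLp (fun x => ρ 0 x * φ x) p volume)
    (hu0' : MemLp (fun x => u 0 x * φ x ^ ((1 : ℝ) / 2)) 2 volume)
    (hux0' : MemLp (fun x => ux 0 x * φ x ^ ((1 : ℝ) / 2)) 2 volume)
    (hρ0' : MemLp (fun x => ρ 0 x * φ x ^ ((1 : ℝ) / 2)) 2 volume) :
    (⨆ t ∈ Set.Ico (0 : ℝ) T,
      (eLpNorm (fun x => u t x * φ x) p volume +
        eLpNorm (fun x => ux t x * φ x) p volume +
        eLpNorm (fun x => ρ t x * φ x) p volume)) < ⊤ ∧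
    (⨆ t ∈ Set.Ico (0 : ℝ) T,
      (eLpNorm (fun x => u t x * φ x ^ ((1 : ℝ) / 2)) 2 volume +
        eLpNorm (fun x => ux t x * φ x ^ ((1 : ℝ) / 2)) 2 volume +
        eLpNorm (fun x => ρ t x * φ x ^ ((1 : ℝ) / 2)) 2 volume)) < ⊤ := by
  set M' : NNReal := Real.toNNReal M with hM'
  have bd : ∀ (f : ℝ → ℝ), Continuous f → eLpNorm f ⊤ volume ≤ ENNReal.ofReal M →
      ∀ x, |f x| ≤ M' := by
    intro f hf hle x
    have h1 : ‖f x‖ₑ ≤ ENNReal.ofReal M := by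
      refine ae_le_of_cont (fun x => ‖f x‖ₑ) hf.enorm _ ?_ x
      filter_upwards [enorm_ae_le_eLpNormEssSup f volume] with y hy
      rw [eLpNorm_exponent_top] at hle
      exact hy.trans hle
    rw [Real.enorm_eq_ofReal_abs] at h1
    have h2 : Real.toNNReal |f x| ≤ M' := ENNReal.coe_le_coe.1 h1
    have h3 := NNReal.coe_le_coe.2 h2
    rwa [Real.coe_toNNReal _ (abs_nonneg _)] at h3
  have hcl : ∀ t₁ ∈ Set.Ico 0 T, ClampedSol b κ α t₁ M' (fun s => u (clampT t₁ s))
      (fun s => ux (clampT t₁ s)) (fun s => uxx (clampT t₁ s)) (fun s => ut (clampT t₁ s))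
      (fun s => ρ (clampT t₁ s)) (fun s => ρt (clampT t₁ s)) (fun s => ρx (clampT t₁ s)) := by
    intro t₁ ht₁
    have hm := clampT_mem T t₁ ht₁
    have cslice : ∀ f : ℝ → ℝ → ℝ, Continuous (Function.uncurry fun s => f (clampT t₁ s)) →
        ∀ s, Continuous (f (clampT t₁ s)) := fun f hf s =>
      hf.comp (show Continuous fun x => ((s, x) : ℝ × ℝ) by fun_prop)
    have cu := clamp_cont T t₁ ht₁ u hu_cont
    have cux := clamp_cont T t₁ ht₁ ux hux_cont
    have cρ := clamp_cont T t₁ ht₁ ρ hρ_cont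
    exact
      { cu := cu
        cux := cux
        cuxx := clamp_cont T t₁ ht₁ uxx huxx_cont
        cut := clamp_cont T t₁ ht₁ ut hut_cont
        cρ := cρ
        cρt := clamp_cont T t₁ ht₁ ρt hρt_cont
        cρx := clamp_cont T t₁ ht₁ ρx hρx_cont
        bu := fun s x => bd _ (cslice u cu s)
          ((le_add_right le_self_add).trans (hM _ (hm s))) x
        bux := fun s x => bd _ (cslice ux cux s)
          ((le_add_right le_add_self).trans (hM _ (hm s))) x
        bρ := fun s x => bd _ (cslice ρ cρ s) (le_add_self.trans (hM _ (hm s))) x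
        hux := fun s x => hux _ (hm s) x
        huxx := fun s x => huxx _ (hm s) x
        hρx := fun s x => hρx _ (hm s) x
        hut := clamp_deriv T t₁ ht₁ u ut hut
        hρt := clamp_deriv T t₁ ht₁ ρ ρt hρt
        hueq := fun s x => hueq _ (hm s) x
        hρeq := fun s x => hρeq _ (hm s) x }
  have hvl := weight_loc_bound v hv_pos hv_sub hv_int
  have hi1 : Integrable (fun x => C₀ * v x * Real.exp (-|x|)) := by
    simpa only [mul_assoc] using hv_int.const_mul C₀
  have hw0 : ∀ x, 0 ≤ C₀ * v x := fun x => (mul_pos hC₀ (hv_pos x)).le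
  constructor
  · refine final_weight p hp b κ α T hT.le M' φ (fun x => C₀ * v x) hφ_pos hφ_cont hw0 hmod hi1 ?_
      u ux uxx ut ρ ρt ρx hcl hu0 hux0 hρ0
    intro R
    obtain ⟨C, hC⟩ := hvl R
    exact ⟨C₀ * C, fun x hx => mul_le_mul_of_nonneg_left (hC x hx) hC₀.le⟩
  · refine final_weight 2 (by norm_num) b κ α T hT.le M' (fun x => φ x ^ ((1 : ℝ) / 2))
      (fun x => 1 + C₀ * v x) (fun x => Real.rpow_pos_of_pos (hφ_pos x) _)
      (hφ_cont.rpow_const fun x => Or.inl (hφ_pos x).ne') (fun x => by linarith [hw0 x])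
      ?_ ?_ ?_ u ux uxx ut ρ ρt ρx hcl hu0' hux0' hρ0'
    · intro x y
      have h1 := Real.rpow_le_rpow (hφ_pos _).le (hmod x y) (by norm_num : (0:ℝ) ≤ 1 / 2)
      rw [Real.mul_rpow (hw0 x) (hφ_pos y).le] at h1
      refine h1.trans (mul_le_mul_of_nonneg_right ?_ (Real.rpow_pos_of_pos (hφ_pos y) _).le)
      rw [← Real.sqrt_eq_rpow]
      apply Real.sqrt_le_iff.2
      have h2 := hw0 x
      constructor
      · linarith
      · nlinarith
    · have h1 := (integrable_exp_abs 1 one_pos).add hi1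
      refine h1.congr (Filter.Eventually.of_forall fun x => ?_)
      simp only [Pi.add_apply, one_mul, add_mul]
    · intro R
      obtain ⟨C, hC⟩ := hvl R
      exact ⟨1 + C₀ * C, fun x hx => by
        have := mul_le_mul_of_nonneg_left (hC x hx) hC₀.le
        linarith⟩
end

section
/- Let b, κ, α ∈ ℝ, 0 < T < ∞, c > 0, and let (u, ρ) be a strong solution on [0,T) of the nonlocal system ∂_t u + u ∂_x u = −∂_x(G * P(u,ρ)), ∂_t ρ + u ∂_x ρ = −(b−1)(∂_x u) ρ, with G(x) = (1/2) e^{-|x|} and P(u,ρ) = (b/2) u² + ((3−b)/2)(∂_x u)² + (κ/2) ρ² − α u, such that u is C¹ in (t,x) and twice continuously differentiable in x, ρ is C¹, u(t,·), ∂_x u(t,·), ρ(t,·) ∈ L²(ℝ) ∩ L^∞(ℝ) for all t, and M := sup_{t ∈ [0,T)} ( ‖u(t,·)‖_{L^∞} + ‖∂_x u(t,·)‖_{L^∞} + ‖ρ(t,·)‖_{L^∞} ) < ∞. If there is C > 0 with |u(0,x)| + |∂_x u(0,x)| + |ρ(0,x)| ≤ C (1+|x|)^{-c} for all x ∈ ℝ,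 then there is C' > 0 such that |u(t,x)| + |∂_x u(t,x)| + |ρ(t,x)| ≤ C' (1+|x|)^{-c} uniformly for all (t,x) ∈ [0,T) × ℝ. -/
open MeasureTheory
open scoped ENNReal

/-- Integrability of `exp (-|z|/2)`. -/
lemma cha_int0 : Integrable (fun z : ℝ => Real.exp (-(|z| / 2))) := by
  refine Integrable.mono' (integrable_inv_one_add_sq.const_mul 8)
    (by fun_prop) (Filter.Eventually.of_forall fun z => ?_)
  rw [Real.norm_eq_abs, abs_of_pos (Real.exp_pos _), Real.exp_neg]
  have h := Real.quadratic_le_exp_of_nonneg (x := |z| / 2) (by positivity)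
  have h2 : (1 + z ^ 2) / 8 ≤ Real.exp (|z| / 2) := by
    have : |z| ^ 2 = z ^ 2 := sq_abs z
    nlinarith [abs_nonneg z]
  calc (Real.exp (|z| / 2))⁻¹ ≤ ((1 + z ^ 2) / 8)⁻¹ := by gcongr
    _ = 8 * (1 + z ^ 2)⁻¹ := by field_simp

/-- Integral constant. -/
noncomputable def chaJ : ℝ := ∫ z : ℝ, Real.exp (-(|z| / 2))

lemma cha_J_nonneg : 0 ≤ chaJ := integral_nonneg fun _ => (Real.exp_pos _).le

lemma cha_int1 (x : ℝ) : Integrable (fun y : ℝ => Real.exp (-(|x - y| / 2))) :=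
  cha_int0.comp_sub_left x

lemma cha_J_eq (x : ℝ) : ∫ y : ℝ, Real.exp (-(|x - y| / 2)) = chaJ :=
  integral_sub_left_eq_self (fun z : ℝ => Real.exp (-(|z| / 2))) volume x

lemma cha_int2 (x : ℝ) : Integrable (fun y : ℝ => Real.exp (-|x - y|)) := by
  refine Integrable.mono' (cha_int1 x) (by fun_prop) (Filter.Eventually.of_forall fun y => ?_)
  rw [Real.norm_eq_abs, abs_of_pos (Real.exp_pos _)]
  apply Real.exp_le_exp.2
  linarith [abs_nonneg (x - y)]

lemma cha_int3 {h : ℝ → ℝ} (hc : Continuous h) {D : ℝ} (hb : ∀ y, |h y| ≤ D) (x : ℝ) :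
    Integrable (fun y : ℝ => Real.exp (-|x - y|) * h y) := by
  refine Integrable.mono' ((cha_int2 x).mul_const D) (by fun_prop)
    (Filter.Eventually.of_forall fun y => ?_)
  rw [Real.norm_eq_abs, abs_mul, abs_of_pos (Real.exp_pos _)]
  gcongr
  exact hb y

/-- left part of the convolution -/
noncomputable def chaL (h : ℝ → ℝ) (x : ℝ) : ℝ := ∫ y in Set.Iic x, Real.exp (-|x - y|) * h y
/-- right part of the convolution -/
noncomputable def chaR (h : ℝ → ℝ) (x : ℝ) : ℝ := ∫ y in Set.Ioi x, Real.exp (-|x - y|) * h y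

lemma cha_L_eq (h : ℝ → ℝ) (x : ℝ) :
    chaL h x = Real.exp (-x) * ∫ y in Set.Iic x, Real.exp y * h y := by
  unfold chaL
  rw [← integral_const_mul]
  refine setIntegral_congr_fun measurableSet_Iic fun y hy => ?_
  have hy' : y ≤ x := hy
  rw [abs_of_nonneg (by linarith), ← mul_assoc, ← Real.exp_add]
  congr 2; ring

lemma cha_R_eq (h : ℝ → ℝ) (x : ℝ) :
    chaR h x = Real.exp x * ∫ y in Set.Ioi x, Real.exp (-y) * h y := by
  unfold chaR
  rw [← integral_const_mul]
  refine setIntegral_congr_fun measurableSet_Ioi fun y hy => ?_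
  have hy' : x < y := hy
  rw [abs_of_neg (by linarith), ← mul_assoc, ← Real.exp_add]
  congr 2; ring

lemma cha_intL {h : ℝ → ℝ} (hc : Continuous h) {D : ℝ} (hb : ∀ y, |h y| ≤ D) (x : ℝ) :
    IntegrableOn (fun y => Real.exp y * h y) (Set.Iic x) := by
  have h1 := ((cha_int3 hc hb x).integrableOn (s := Set.Iic x)).const_mul (Real.exp x)
  refine IntegrableOn.congr_fun h1 (fun y hy => ?_) measurableSet_Iic
  have hy' : y ≤ x := hy
  rw [abs_of_nonneg (by linarith), ← mul_assoc, ← Real.exp_add]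
  congr 2; ring

lemma cha_intR {h : ℝ → ℝ} (hc : Continuous h) {D : ℝ} (hb : ∀ y, |h y| ≤ D) (x : ℝ) :
    IntegrableOn (fun y => Real.exp (-y) * h y) (Set.Ioi x) := by
  have h1 := ((cha_int3 hc hb x).integrableOn (s := Set.Ioi x)).const_mul (Real.exp (-x))
  refine IntegrableOn.congr_fun h1 (fun y hy => ?_) measurableSet_Ioi
  have hy' : x < y := hy
  rw [abs_of_neg (by linarith), ← mul_assoc, ← Real.exp_add]
  congr 2; ring

lemma cha_L_deriv {h : ℝ → ℝ} (hc : Continuous h) {D : ℝ} (hb : ∀ y, |h y| ≤ D) (x : ℝ) :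
    HasDerivAt (chaL h) (-chaL h x + h x) x := by
  have hcc : Continuous (fun y => Real.exp y * h y) := by fun_prop
  have h1 : HasDerivAt (fun x => ∫ y in Set.Iic x, Real.exp y * h y) (Real.exp x * h x) x := by
    have h2 : (fun x => ∫ y in Set.Iic x, Real.exp y * h y) =
        fun x => (∫ y in Set.Iic 0, Real.exp y * h y) + ∫ y in (0 : ℝ)..x, Real.exp y * h y := by
      funext x
      rw [← intervalIntegral.integral_Iic_sub_Iic (cha_intL hc hb 0) (cha_intL hc hb x)]
      ring
    rw [h2]
    exact (hcc.integral_hasStrictDerivAt 0 x).hasDerivAt.const_add _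
  have h3 : HasDerivAt (fun x : ℝ => Real.exp (-x)) (-Real.exp (-x)) x := by
    simpa using (hasDerivAt_neg x).exp
  have h4 := h3.mul h1
  have h5 : chaL h = (fun x : ℝ => Real.exp (-x)) * (fun x => ∫ y in Set.Iic x, Real.exp y * h y) :=
    funext fun x => cha_L_eq h x
  rw [h5]
  refine h4.congr_deriv ?_
  rw [← mul_assoc (Real.exp (-x)) (Real.exp x) (h x), ← Real.exp_add]; simp

lemma cha_R_deriv {h : ℝ → ℝ} (hc : Continuous h) {D : ℝ} (hb : ∀ y, |h y| ≤ D) (x : ℝ) :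
    HasDerivAt (chaR h) (chaR h x - h x) x := by
  have hcc : Continuous (fun y => Real.exp (-y) * h y) := by fun_prop
  have h1 : HasDerivAt (fun x => ∫ y in Set.Ioi x, Real.exp (-y) * h y)
      (-(Real.exp (-x) * h x)) x := by
    have h2 : (fun x => ∫ y in Set.Ioi x, Real.exp (-y) * h y) =
        fun x => (∫ y in Set.Ioi 0, Real.exp (-y) * h y)
          - ∫ y in (0 : ℝ)..x, Real.exp (-y) * h y := by
      funext x
      rw [← intervalIntegral.integral_Ioi_sub_Ioi' (cha_intR hc hb 0) (cha_intR hc hb x)]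
      ring
    rw [h2]
    exact (hcc.integral_hasStrictDerivAt 0 x).hasDerivAt.const_sub _
  have h4 := (Real.hasDerivAt_exp x).mul h1
  have h5 : chaR h = Real.exp * (fun x => ∫ y in Set.Ioi x, Real.exp (-y) * h y) :=
    funext fun x => cha_R_eq h x
  rw [h5]
  refine h4.congr_deriv ?_
  rw [mul_neg, ← mul_assoc (Real.exp x) (Real.exp (-x)) (h x), ← Real.exp_add]; simp
  ring

lemma cha_conv_eq {h : ℝ → ℝ} (hc : Continuous h) {D : ℝ} (hb : ∀ y, |h y| ≤ D) :
    greenConv h = fun x => (1 / 2) * (chaL h x + chaR h x) := by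
  funext x
  unfold greenConv greenG chaL chaR
  rw [intervalIntegral.integral_Iic_add_Ioi (cha_int3 hc hb x).integrableOn
    (cha_int3 hc hb x).integrableOn, ← integral_const_mul]
  congr 1; funext y; ring

/-- The explicit derivative of the convolution. -/
noncomputable def chaQ' (h : ℝ → ℝ) (x : ℝ) : ℝ := (1 / 2) * (chaR h x - chaL h x)

lemma cha_conv_deriv {h : ℝ → ℝ} (hc : Continuous h) {D : ℝ} (hb : ∀ y, |h y| ≤ D) (x : ℝ) :
    deriv (greenConv h) x = chaQ' h x := by
  rw [cha_conv_eq hc hb]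
  have := (((cha_L_deriv hc hb x).add (cha_R_deriv hc hb x)).const_mul (1 / 2)).deriv
  unfold chaQ'
  simp only [Pi.add_apply] at this
  convert this using 1
  ring

lemma cha_Q'_deriv {h : ℝ → ℝ} (hc : Continuous h) {D : ℝ} (hb : ∀ y, |h y| ≤ D) (x : ℝ) :
    HasDerivAt (chaQ' h) ((1 / 2) * (chaR h x + chaL h x) - h x) x := by
  have := ((cha_R_deriv hc hb x).sub (cha_L_deriv hc hb x)).const_mul (1 / 2)
  have e : (1 / 2) * (chaR h x + chaL h x) - h x
      = 1 / 2 * (chaR h x - h x - (-chaL h x + h x)) := by ring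
  rw [e]
  exact this

/-- Weighted bound of the two halves. -/
lemma cha_LR_bound {h w : ℝ → ℝ} (hc : Continuous h) {D : ℝ} (hb : ∀ y, |h y| ≤ D)
    {Kc S : ℝ} (hS : 0 ≤ S) (hw : ∀ x y, w y ≤ Kc * Real.exp (|x - y| / 2) * w x)
    (hh : ∀ y, |h y| ≤ S * w y) (x : ℝ) :
    |chaL h x| + |chaR h x| ≤ S * (Kc * chaJ) * w x := by
  have hi := (cha_int3 hc hb x).norm
  have e1 : |chaL h x| ≤ ∫ y in Set.Iic x, ‖Real.exp (-|x - y|) * h y‖ :=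
    norm_integral_le_integral_norm (fun y => Real.exp (-|x - y|) * h y)
  have e2 : |chaR h x| ≤ ∫ y in Set.Ioi x, ‖Real.exp (-|x - y|) * h y‖ :=
    norm_integral_le_integral_norm (fun y => Real.exp (-|x - y|) * h y)
  have e3 := intervalIntegral.integral_Iic_add_Ioi (b := x) hi.integrableOn hi.integrableOn
  have e4 : ∫ y, ‖Real.exp (-|x - y|) * h y‖ ≤
      ∫ y, (S * Kc * w x) * Real.exp (-(|x - y| / 2)) := by
    refine integral_mono hi ((cha_int1 x).const_mul _) fun y => ?_
    simp only
    rw [Real.norm_eq_abs, abs_mul, abs_of_pos (Real.exp_pos _)]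
    calc Real.exp (-|x - y|) * |h y|
        ≤ Real.exp (-|x - y|) * (S * (Kc * Real.exp (|x - y| / 2) * w x)) := by
          gcongr
          exact (hh y).trans (by gcongr; exact hw x y)
      _ = (S * Kc * w x) * (Real.exp (-|x - y|) * Real.exp (|x - y| / 2)) := by ring
      _ = (S * Kc * w x) * Real.exp (-(|x - y| / 2)) := by
          rw [← Real.exp_add]; congr 2; ring
  rw [integral_const_mul, cha_J_eq] at e4
  nlinarith

lemma cha_Q'_bound {h w : ℝ → ℝ} (hc : Continuous h) {D : ℝ} (hb : ∀ y, |h y| ≤ D)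
    {Kc S : ℝ} (hS : 0 ≤ S) (hw : ∀ x y, w y ≤ Kc * Real.exp (|x - y| / 2) * w x)
    (hh : ∀ y, |h y| ≤ S * w y) (x : ℝ) :
    |chaQ' h x| ≤ S * (Kc * chaJ) * w x := by
  have := cha_LR_bound hc hb hS hw hh x
  unfold chaQ'
  rw [abs_mul, abs_of_pos (by norm_num : (0 : ℝ) < 1 / 2)]
  have h2 := abs_sub (chaR h x) (chaL h x)
  have h3 := abs_nonneg (chaR h x - chaL h x)
  linarith

lemma cha_Q''_bound {h w : ℝ → ℝ} (hc : Continuous h) {D : ℝ} (hb : ∀ y, |h y| ≤ D)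
    {Kc S : ℝ} (hS : 0 ≤ S) (hw : ∀ x y, w y ≤ Kc * Real.exp (|x - y| / 2) * w x)
    (hh : ∀ y, |h y| ≤ S * w y) (x : ℝ) :
    |(1 / 2) * (chaR h x + chaL h x) - h x| ≤ S * (Kc * chaJ + 1) * w x := by
  have := cha_LR_bound hc hb hS hw hh x
  have h1 := hh x
  rw [abs_le]
  have a1 := le_abs_self (chaR h x)
  have a2 := neg_abs_le (chaR h x)
  have a3 := le_abs_self (chaL h x)
  have a4 := neg_abs_le (chaL h x)
  have a5 := le_abs_self (h x)
  have a6 := neg_abs_le (h x)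
  have a7 := abs_nonneg (chaR h x)
  have a8 := abs_nonneg (chaL h x)
  constructor <;> nlinarith

/-- Chain rule along a curve. -/
lemma cha_chain {T t0 : ℝ} {v vt vx : ℝ → ℝ → ℝ} (ht0 : t0 < T)
    (hvx_cont : ContinuousOn (fun q : ℝ × ℝ => vx q.1 q.2) (Set.Ico 0 T ×ˢ (Set.univ : Set ℝ)))
    (hvx : ∀ t ∈ Set.Ico (0 : ℝ) T, ∀ x : ℝ, HasDerivAt (v t) (vx t x) x)
    (hvt : ∀ t ∈ Set.Ico (0 : ℝ) T, ∀ x : ℝ,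
      HasDerivWithinAt (fun s => v s x) (vt t x) (Set.Ico 0 T) t)
    {q : ℝ → ℝ} {q' s : ℝ} (hs : s ∈ Set.Icc 0 t0)
    (hq : HasDerivWithinAt q q' (Set.Icc 0 t0) s) :
    HasDerivWithinAt (fun r => v r (q r)) (vt s (q s) + q' * vx s (q s)) (Set.Icc 0 t0) s := by
  have hsub : Set.Icc 0 t0 ⊆ Set.Ico 0 T := fun r hr => ⟨hr.1, hr.2.trans_lt ht0⟩
  have h1 : HasDerivWithinAt (fun r => v r (q s)) (vt s (q s)) (Set.Icc 0 t0) s :=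
    (hvt s (hsub hs) (q s)).mono hsub
  have h2 : HasDerivWithinAt (fun r => vx s (q s) * q r) (vx s (q s) * q') (Set.Icc 0 t0) s :=
    hq.const_mul _
  have h3 : HasDerivWithinAt (fun r => v r (q r) - v r (q s) - vx s (q s) * (q r - q s)) 0
      (Set.Icc 0 t0) s := by
    rw [hasDerivWithinAt_iff_isLittleO]
    simp only [sub_self, mul_zero, sub_zero, smul_eq_mul]
    have hO : (fun r => q r - q s) =O[nhdsWithin s (Set.Icc 0 t0)] fun r => r - s :=
      hq.hasFDerivWithinAt.isBigO_sub
    refine Asymptotics.IsLittleO.trans_isBigO ?_ hO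
    rw [Asymptotics.isLittleO_iff]
    intro ε hε
    have hcv := hvx_cont (s, q s) ⟨hsub hs, Set.mem_univ _⟩
    rw [Metric.continuousWithinAt_iff] at hcv
    obtain ⟨δ, hδ, hd⟩ := hcv ε hε
    have e1 : ∀ᶠ r in nhdsWithin s (Set.Icc 0 t0), dist r s < δ :=
      nhdsWithin_le_nhds (Metric.ball_mem_nhds s hδ)
    have e2 : ∀ᶠ r in nhdsWithin s (Set.Icc 0 t0), dist (q r) (q s) < δ :=
      hq.continuousWithinAt (Metric.ball_mem_nhds (q s) hδ)
    filter_upwards [e1, e2, self_mem_nhdsWithin] with r hr1 hr2 hr3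
    have key := (convex_ball (q s) δ).norm_image_sub_le_of_norm_hasDerivWithin_le
      (f := fun y => v r y - vx s (q s) * y) (f' := fun y => vx r y - vx s (q s)) (C := ε)
      (x := q s) (y := q r)
      (fun y _ => by
        have := (hvx r (hsub hr3) y).sub ((hasDerivAt_id y).const_mul (vx s (q s)))
        simp only [mul_one] at this
        exact this.hasDerivWithinAt)
      (fun y hy => by
        have := hd (x := (r, y)) ⟨hsub hr3, Set.mem_univ _⟩ (by
          rw [Prod.dist_eq]; exact max_lt hr1 hy)
        rw [dist_eq_norm] at this
        exact this.le)
      (Metric.mem_ball_self hδ) hr2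
    refine le_trans (le_of_eq ?_) key
    congr 1; ring
  have h4 := (h3.add h1).add (h2.sub_const (vx s (q s) * q s))
  refine (h4.congr_deriv (by ring)).congr_of_eventuallyEq
    (Filter.Eventually.of_forall fun r => ?_) ?_ <;> simp only [Pi.add_apply] <;> ring

lemma cha_grow {t0 E l : ℝ} (ht0 : 0 ≤ t0) (hE : 0 ≤ E) (hl : 0 < l) {f f' : ℝ → ℝ}
    (hf : ∀ s ∈ Set.Icc 0 t0, HasDerivWithinAt f (f' s) (Set.Icc 0 t0) s)
    (hb : ∀ s ∈ Set.Icc 0 t0, |f' s| ≤ E * Real.exp (l * s)) :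
    |f t0| ≤ |f 0| + E / l * Real.exp (l * t0) := by
  have h := image_norm_le_of_norm_deriv_right_le_deriv_boundary (f := f) (f' := f') (a := 0) (b := t0)
    (B := fun s => |f 0| + E / l * (Real.exp (l * s) - 1)) (B' := fun s => E * Real.exp (l * s))
    (fun s hs => (hf s hs).continuousWithinAt)
    (fun s hs => (hf s (Set.Ico_subset_Icc_self hs)).mono_of_mem_nhdsWithin
      (Icc_mem_nhdsGE_of_mem hs))
    (by simp)
    (fun s => by
      have h1 : HasDerivAt (fun s => Real.exp (l * s)) (Real.exp (l * s) * l) s := by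
        simpa using ((hasDerivAt_id s).const_mul l).exp
      refine (((h1.sub_const 1).const_mul (E / l)).const_add |f 0|).congr_deriv ?_
      field_simp)
    (fun s hs => hb s (Set.Ico_subset_Icc_self hs)) (x := t0) ⟨ht0, le_rfl⟩
  simp only [Real.norm_eq_abs] at h
  have : 0 ≤ E / l := by positivity
  linarith

lemma cha_sup {f : ℝ → ℝ} (hf : Continuous f) {M : ℝ}
    (h : eLpNorm f ⊤ volume ≤ ENNReal.ofReal M) (x : ℝ) : |f x| ≤ max M 0 := by
  rw [eLpNorm_exponent_top] at h
  have h1 : ∀ᵐ y ∂(volume : Measure ℝ), |f y| ≤ max M 0 := by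
    filter_upwards [ae_le_eLpNormEssSup (f := f) (μ := volume)] with y hy
    have h2 := hy.trans h
    rw [← ofReal_norm] at h2
    rcases le_or_gt 0 M with hM | hM
    · exact ((ENNReal.ofReal_le_ofReal_iff hM).1 h2).trans (le_max_left _ _)
    · rw [ENNReal.ofReal_of_nonpos hM.le, nonpos_iff_eq_zero, ENNReal.ofReal_eq_zero] at h2
      exact h2.trans (le_max_right _ _)
  have hd : Dense {y | |f y| ≤ max M 0} := Measure.dense_of_ae h1
  have hcl : IsClosed {y | |f y| ≤ max M 0} := isClosed_le (by fun_prop) continuous_const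
  have := hd.closure_eq
  rw [hcl.closure_eq] at this
  exact (Set.eq_univ_iff_forall.1 this) x

/-- Existence of backward characteristics. -/
lemma cha_char {T t0 M x0 : ℝ} {u ux : ℝ → ℝ → ℝ} (hM : 0 ≤ M) (h0 : 0 ≤ t0) (ht0 : t0 < T)
    (hu_cont : ContinuousOn (fun q : ℝ × ℝ => u q.1 q.2) (Set.Ico 0 T ×ˢ (Set.univ : Set ℝ)))
    (hux : ∀ t ∈ Set.Ico (0 : ℝ) T, ∀ x : ℝ, HasDerivAt (u t) (ux t x) x)
    (bu : ∀ t ∈ Set.Ico (0 : ℝ) T, ∀ x : ℝ, |u t x| ≤ M)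
    (bux : ∀ t ∈ Set.Ico (0 : ℝ) T, ∀ x : ℝ, |ux t x| ≤ M) :
    ∃ q : ℝ → ℝ, q t0 = x0 ∧
      (∀ s ∈ Set.Icc 0 t0, HasDerivWithinAt q (u s (q s)) (Set.Icc 0 t0) s) ∧
      ∀ s ∈ Set.Icc 0 t0, |q s - x0| ≤ M * T := by
  have hsub : Set.Icc 0 t0 ⊆ Set.Ico 0 T := fun r hr => ⟨hr.1, hr.2.trans_lt ht0⟩
  have hT : 0 ≤ T := h0.trans ht0.le
  have hPL : IsPicardLindelof u (tmin := 0) (tmax := t0) ⟨t0, h0, le_rfl⟩ x0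
      (M.toNNReal * T.toNNReal) 0 M.toNNReal M.toNNReal := by
    refine ⟨fun t ht => ?_, fun x _ => ?_, fun t ht x _ => ?_, ?_⟩
    · refine LipschitzOnWith.of_dist_le_mul fun x _ y _ => ?_
      rw [dist_eq_norm, dist_eq_norm, Real.coe_toNNReal _ hM]
      exact convex_univ.norm_image_sub_le_of_norm_hasDerivWithin_le (f := u t) (f' := ux t)
        (fun z _ => (hux t (hsub ht) z).hasDerivWithinAt) (fun z _ => bux t (hsub ht) z)
        (Set.mem_univ y) (Set.mem_univ x)
    · exact hu_cont.comp (f := fun r : ℝ => (r, x)) (by fun_prop)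
        fun r hr => ⟨hsub hr, Set.mem_univ _⟩
    · rw [Real.coe_toNNReal _ hM]; exact bu t (hsub ht) x
    · simp only [sub_self, sub_zero, NNReal.coe_mul, NNReal.coe_zero]
      rw [Real.coe_toNNReal _ hM, Real.coe_toNNReal _ hT, max_eq_right h0]
      gcongr
  obtain ⟨q, hq0, hq⟩ := hPL.exists_eq_forall_mem_Icc_hasDerivWithinAt₀
  refine ⟨q, hq0, hq, fun s hs => ?_⟩
  have := (convex_Icc 0 t0).norm_image_sub_le_of_norm_hasDerivWithin_le (f := q) (C := M)
    hq (fun r hr => bu r (hsub hr) (q r)) (⟨h0, le_rfl⟩ : t0 ∈ Set.Icc 0 t0) hs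
  simp only at hq0
  rw [hq0] at this
  refine this.trans ?_
  gcongr
  rw [Real.norm_eq_abs, abs_le]
  constructor <;> linarith [hs.1, hs.2]

/-- `(1+r)^c` grows slower than an exponential. -/
lemma cha_pow_le {c : ℝ} (hc : 0 < c) {r : ℝ} (hr : 0 ≤ r) :
    (1 + r) ^ c ≤ (1 + 2 * c) ^ c * Real.exp (r / 2) := by
  have hm : 0 < 1 + 2 * c := by linarith
  have h1 : 1 + r ≤ (1 + 2 * c) * Real.exp (r / (1 + 2 * c)) := by
    have := Real.add_one_le_exp (r / (1 + 2 * c))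
    calc 1 + r ≤ (1 + 2 * c) * (r / (1 + 2 * c) + 1) := by
          rw [mul_add, mul_div_cancel₀ _ hm.ne']; linarith
      _ ≤ _ := by gcongr
  calc (1 + r) ^ c ≤ ((1 + 2 * c) * Real.exp (r / (1 + 2 * c))) ^ c := by gcongr
    _ = (1 + 2 * c) ^ c * Real.exp (r / (1 + 2 * c) * c) := by
        rw [Real.mul_rpow hm.le (Real.exp_pos _).le, ← Real.exp_mul]
    _ ≤ _ := by
        gcongr
        rw [div_mul_eq_mul_div, div_le_div_iff₀ hm (by norm_num)]
        nlinarith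

lemma cha_weight {c ε : ℝ} (hc : 0 < c) (hε : 0 ≤ ε) (x y : ℝ) :
    (1 + |y|) ^ (-c) + ε ≤ (1 + 2 * c) ^ c * Real.exp (|x - y| / 2) * ((1 + |x|) ^ (-c) + ε) := by
  have h1 := cha_pow_le hc (abs_nonneg (x - y))
  have h2 : 1 ≤ (1 + |x - y|) ^ c := Real.one_le_rpow (by linarith [abs_nonneg (x - y)]) hc.le
  have hx : 0 < 1 + |x| := by positivity
  have hy : 0 < 1 + |y| := by positivity
  have h3 : (1 + |y|) ^ (-c) ≤ (1 + |x - y|) ^ c * (1 + |x|) ^ (-c) := by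
    rw [Real.rpow_neg hx.le, Real.rpow_neg hy.le, ← div_eq_mul_inv, inv_eq_one_div,
      div_le_div_iff₀ (by positivity) (by positivity), one_mul,
      ← Real.mul_rpow (by positivity) hy.le]
    gcongr
    have : |x| ≤ |x - y| + |y| := by simpa using abs_add_le (x - y) y
    nlinarith [abs_nonneg (x - y), abs_nonneg y]
  have h4 : 0 ≤ (1 + |x|) ^ (-c) := by positivity
  calc _ ≤ (1 + |x - y|) ^ c * ((1 + |x|) ^ (-c) + ε) := by nlinarith
    _ ≤ _ := by gcongr

lemma cha_P_bound {b κ α M : ℝ} (hM : 0 ≤ M) {u w r : ℝ → ℝ} {x : ℝ}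
    (hu : |u x| ≤ M) (hw : |w x| ≤ M) (hr : |r x| ≤ M) :
    |Pterm b κ α u w r x| ≤
      ((|b| / 2 + |3 - b| / 2 + |κ| / 2) * M + |α|) * (|u x| + |w x| + |r x|) := by
  unfold Pterm
  have e1 : |b / 2 * u x ^ 2| ≤ |b| / 2 * (M * |u x|) := by
    rw [abs_mul, abs_div, abs_pow, abs_two, sq]; gcongr
  have e2 : |(3 - b) / 2 * w x ^ 2| ≤ |3 - b| / 2 * (M * |w x|) := by
    rw [abs_mul, abs_div, abs_pow, abs_two, sq]; gcongr
  have e3 : |κ / 2 * r x ^ 2| ≤ |κ| / 2 * (M * |r x|) := by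
    rw [abs_mul, abs_div, abs_pow, abs_two, sq]; gcongr
  have e4 : |α * u x| = |α| * |u x| := abs_mul _ _
  have t1 := abs_sub (b / 2 * u x ^ 2 + (3 - b) / 2 * w x ^ 2 + κ / 2 * r x ^ 2) (α * u x)
  have t2 := abs_add_three (b / 2 * u x ^ 2) ((3 - b) / 2 * w x ^ 2) (κ / 2 * r x ^ 2)
  have p1 : 0 ≤ |b| / 2 * M := by positivity
  have p2 : 0 ≤ |3 - b| / 2 * M := by positivity
  have p3 : 0 ≤ |κ| / 2 * M := by positivity
  have p4 := abs_nonneg α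
  have q1 := abs_nonneg (u x)
  have q2 := abs_nonneg (w x)
  have q3 := abs_nonneg (r x)
  have m1 := mul_nonneg p1 (add_nonneg q2 q3)
  have m2 := mul_nonneg p2 (add_nonneg q1 q3)
  have m3 := mul_nonneg p3 (add_nonneg q1 q2)
  have m4 := mul_nonneg p4 (add_nonneg q2 q3)
  linarith

/-- The bootstrap step. -/
lemma cha_step (b κ α T M C : ℝ)
    (u ux uxx ut ρ ρt ρx : ℝ → ℝ → ℝ) (hM : 0 ≤ M)
    (hu_cont : ContinuousOn (fun q : ℝ × ℝ => u q.1 q.2)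
      (Set.Ico 0 T ×ˢ (Set.univ : Set ℝ)))
    (hux_cont : ContinuousOn (fun q : ℝ × ℝ => ux q.1 q.2)
      (Set.Ico 0 T ×ˢ (Set.univ : Set ℝ)))
    (hρx_cont : ContinuousOn (fun q : ℝ × ℝ => ρx q.1 q.2)
      (Set.Ico 0 T ×ˢ (Set.univ : Set ℝ)))
    (hux : ∀ t ∈ Set.Ico (0 : ℝ) T, ∀ x : ℝ, HasDerivAt (u t) (ux t x) x)
    (huxx : ∀ t ∈ Set.Ico (0 : ℝ) T, ∀ x : ℝ, HasDerivAt (ux t) (uxx t x) x)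
    (hut : ∀ t ∈ Set.Ico (0 : ℝ) T, ∀ x : ℝ,
      HasDerivWithinAt (fun s => u s x) (ut t x) (Set.Ico 0 T) t)
    (hρx : ∀ t ∈ Set.Ico (0 : ℝ) T, ∀ x : ℝ, HasDerivAt (ρ t) (ρx t x) x)
    (hρt : ∀ t ∈ Set.Ico (0 : ℝ) T, ∀ x : ℝ,
      HasDerivWithinAt (fun s => ρ s x) (ρt t x) (Set.Ico 0 T) t)
    (hueq : ∀ t ∈ Set.Ico (0 : ℝ) T, ∀ x : ℝ,
      ut t x + u t x * ux t x =
        -deriv (greenConv (Pterm b κ α (u t) (ux t) (ρ t))) x)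
    (hρeq : ∀ t ∈ Set.Ico (0 : ℝ) T, ∀ x : ℝ,
      ρt t x + u t x * ρx t x = -((b - 1) * ux t x * ρ t x))
    (bu : ∀ t ∈ Set.Ico (0 : ℝ) T, ∀ x : ℝ, |u t x| ≤ M)
    (bux : ∀ t ∈ Set.Ico (0 : ℝ) T, ∀ x : ℝ, |ux t x| ≤ M)
    (bρ : ∀ t ∈ Set.Ico (0 : ℝ) T, ∀ x : ℝ, |ρ t x| ≤ M)
    {w : ℝ → ℝ} {Kc A1 K A l B : ℝ} (hKc : 0 ≤ Kc) (hC : 0 ≤ C) (hw0 : ∀ x, 0 ≤ w x)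
    (hw : ∀ x y, w y ≤ Kc * Real.exp (|x - y| / 2) * w x)
    (hdecay0 : ∀ x : ℝ, |u 0 x| + |ux 0 x| + |ρ 0 x| ≤ C * w x)
    (hA1 : A1 = (|b| / 2 + |3 - b| / 2 + |κ| / 2) * M + |α|)
    (hK : K = Kc * Real.exp ((M * T + 1) / 2))
    (hA : A = A1 * (Kc * chaJ) + (A1 * (Kc * chaJ + 1) + M) + |b - 1| * M)
    (hl : 0 < l) (hB : 0 ≤ B)
    (hboot : ∀ t ∈ Set.Ico (0 : ℝ) T, ∀ x : ℝ,
      |u t x| + |ux t x| + |ρ t x| ≤ B * Real.exp (l * t) * w x) :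
    ∀ t ∈ Set.Ico (0 : ℝ) T, ∀ x : ℝ,
      |u t x| + |ux t x| + |ρ t x| ≤ (K * C + K * A / l * B) * Real.exp (l * t) * w x := by
  intro t0 ht0 x0
  have hJ := cha_J_nonneg
  have hA1' : 0 ≤ A1 := by rw [hA1]; positivity
  have hK' : 0 ≤ K := by rw [hK]; positivity
  have hsub : Set.Icc 0 t0 ⊆ Set.Ico 0 T := fun r hr => ⟨hr.1, hr.2.trans_lt ht0.2⟩
  have h0mem : (0 : ℝ) ∈ Set.Icc 0 t0 := ⟨le_rfl, ht0.1⟩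
  obtain ⟨q, hq0, hq, hqx⟩ := cha_char (x0 := x0) hM ht0.1 ht0.2 hu_cont hux bu bux
  -- weight comparison
  have hwK : ∀ y, |y - x0| ≤ M * T + 1 → w y ≤ K * w x0 := by
    intro y hy
    refine (hw x0 y).trans ?_
    rw [hK, abs_sub_comm]
    have := hw0 x0
    gcongr
  have hwq : ∀ s ∈ Set.Icc 0 t0, w (q s) ≤ K * w x0 := fun s hs =>
    hwK _ ((hqx s hs).trans (by linarith))
  -- source term
  have hPc : ∀ s ∈ Set.Ico 0 T, Continuous (Pterm b κ α (u s) (ux s) (ρ s)) := by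
    intro s hs
    have c1 : Continuous (u s) :=
      continuous_iff_continuousAt.2 fun x => (hux s hs x).continuousAt
    have c2 : Continuous (ux s) :=
      continuous_iff_continuousAt.2 fun x => (huxx s hs x).continuousAt
    have c3 : Continuous (ρ s) :=
      continuous_iff_continuousAt.2 fun x => (hρx s hs x).continuousAt
    unfold Pterm
    fun_prop
  have hPb0 : ∀ s ∈ Set.Ico 0 T, ∀ y, |Pterm b κ α (u s) (ux s) (ρ s) y| ≤
      A1 * (|u s y| + |ux s y| + |ρ s y|) := by
    intro s hs y
    rw [hA1]
    exact cha_P_bound hM (bu s hs y) (bux s hs y) (bρ s hs y)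
  have hPb : ∀ s ∈ Set.Ico 0 T, ∀ y, |Pterm b κ α (u s) (ux s) (ρ s) y| ≤ A1 * (M + M + M) :=
    fun s hs y => (hPb0 s hs y).trans (by
      gcongr
      exacts [bu s hs y, bux s hs y, bρ s hs y])
  have hPw : ∀ s ∈ Set.Ico 0 T, ∀ y, |Pterm b κ α (u s) (ux s) (ρ s) y| ≤
      A1 * (B * Real.exp (l * s)) * w y := by
    intro s hs y
    refine (hPb0 s hs y).trans ?_
    rw [mul_assoc]
    gcongr
    exact hboot s hs y
  have hS : ∀ s, 0 ≤ A1 * (B * Real.exp (l * s)) := fun s => by positivity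
  have hwx0 := hw0 x0
  -- estimate of u
  have Eu : |u t0 x0| ≤ |u 0 (q 0)| +
      (A1 * B * (Kc * chaJ) * (K * w x0)) / l * Real.exp (l * t0) := by
    have := cha_grow (f := fun s => u s (q s))
      (f' := fun s => ut s (q s) + u s (q s) * ux s (q s)) ht0.1
      (E := A1 * B * (Kc * chaJ) * (K * w x0)) (by positivity) hl
      (fun s hs => cha_chain ht0.2 hux_cont hux hut hs (hq s hs))
      (fun s hs => by
        have hs' := hsub hs
        rw [hueq s hs', abs_neg, cha_conv_deriv (hPc s hs') (hPb s hs')]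
        refine (cha_Q'_bound (hPc s hs') (hPb s hs') (hS s) hw (hPw s hs') (q s)).trans ?_
        calc A1 * (B * Real.exp (l * s)) * (Kc * chaJ) * w (q s)
            ≤ A1 * (B * Real.exp (l * s)) * (Kc * chaJ) * (K * w x0) := by
              gcongr; exact hwq s hs
          _ = _ := by ring)
    simp only [hq0] at this
    exact this
  -- estimate of ρ
  have Er : |ρ t0 x0| ≤ |ρ 0 (q 0)| +
      (|b - 1| * M * B * (K * w x0)) / l * Real.exp (l * t0) := by
    have := cha_grow (f := fun s => ρ s (q s))
      (f' := fun s => ρt s (q s) + u s (q s) * ρx s (q s)) ht0.1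
      (E := |b - 1| * M * B * (K * w x0)) (by positivity) hl
      (fun s hs => cha_chain ht0.2 hρx_cont hρx hρt hs (hq s hs))
      (fun s hs => by
        have hs' := hsub hs
        rw [hρeq s hs', abs_neg, abs_mul, abs_mul]
        have h1 : |ρ s (q s)| ≤ B * Real.exp (l * s) * w (q s) :=
          le_trans (by linarith [abs_nonneg (u s (q s)), abs_nonneg (ux s (q s))])
            (hboot s hs' (q s))
        calc |b - 1| * |ux s (q s)| * |ρ s (q s)|
            ≤ |b - 1| * M * (B * Real.exp (l * s) * (K * w x0)) := by
              gcongr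
              · exact bux s hs' _
              · refine h1.trans ?_
                gcongr; exact hwq s hs
          _ = _ := by ring)
    simp only [hq0] at this
    exact this
  -- estimate of the difference quotients of u
  have Ez : ∀ z : ℝ, |z| ≤ 1 → |u t0 (x0 + z) - u t0 x0| ≤ |u 0 (q 0 + z) - u 0 (q 0)| +
      (|z| * ((A1 * (Kc * chaJ + 1) + M) * B * (K * w x0))) / l * Real.exp (l * t0) := by
    intro z hz
    have := cha_grow (f := fun s => u s (q s + z) - u s (q s))
      (f' := fun s => (ut s (q s + z) + u s (q s) * ux s (q s + z))
        - (ut s (q s) + u s (q s) * ux s (q s))) ht0.1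
      (E := |z| * ((A1 * (Kc * chaJ + 1) + M) * B * (K * w x0))) (by positivity) hl
      (fun s hs => (cha_chain (q := fun s => q s + z) ht0.2 hux_cont hux hut hs
        ((hq s hs).add_const z)).sub
        (cha_chain ht0.2 hux_cont hux hut hs (hq s hs)))
      (fun s hs => by
        have hs' := hsub hs
        have i1 := hueq s hs' (q s)
        have i2 := hueq s hs' (q s + z)
        rw [cha_conv_deriv (hPc s hs') (hPb s hs')] at i1 i2
        have hmem1 : q s ∈ Metric.closedBall (q s) 1 := Metric.mem_closedBall_self zero_le_one
        have hmem2 : q s + z ∈ Metric.closedBall (q s) 1 := by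
          rw [Metric.mem_closedBall, Real.dist_eq]; simpa using hz
        have hball : ∀ y ∈ Metric.closedBall (q s) 1, w y ≤ K * w x0 := by
          intro y hy
          rw [Metric.mem_closedBall, Real.dist_eq] at hy
          apply hwK
          have := abs_add_le (y - q s) (q s - x0)
          rw [sub_add_sub_cancel] at this
          linarith [hqx s hs]
        have j1 := (convex_closedBall (q s) 1).norm_image_sub_le_of_norm_hasDerivWithin_le
          (f := chaQ' (Pterm b κ α (u s) (ux s) (ρ s)))
          (C := A1 * (B * Real.exp (l * s)) * (Kc * chaJ + 1) * (K * w x0))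
          (fun y _ => (cha_Q'_deriv (hPc s hs') (hPb s hs') y).hasDerivWithinAt)
          (fun y hy => (cha_Q''_bound (hPc s hs') (hPb s hs') (hS s) hw (hPw s hs') y).trans
            (by have := hS s; gcongr; exact hball y hy)) hmem1 hmem2
        have j2 := (convex_closedBall (q s) 1).norm_image_sub_le_of_norm_hasDerivWithin_le
          (f := u s) (f' := ux s) (C := B * Real.exp (l * s) * (K * w x0))
          (fun y _ => (hux s hs' y).hasDerivWithinAt)
          (fun y hy => by
            have h1 : |ux s y| ≤ B * Real.exp (l * s) * w y :=
              le_trans (by linarith [abs_nonneg (u s y), abs_nonneg (ρ s y)]) (hboot s hs' y)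
            exact h1.trans (by gcongr; exact hball y hy)) hmem1 hmem2
        simp only [Real.norm_eq_abs, add_sub_cancel_left] at j1 j2
        have e : (ut s (q s + z) + u s (q s) * ux s (q s + z))
            - (ut s (q s) + u s (q s) * ux s (q s))
            = -(chaQ' (Pterm b κ α (u s) (ux s) (ρ s)) (q s + z)
                - chaQ' (Pterm b κ α (u s) (ux s) (ρ s)) (q s))
              - (u s (q s + z) - u s (q s)) * ux s (q s + z) := by
          linear_combination i2 - i1
        rw [e]
        refine (abs_sub _ _).trans ?_
        rw [abs_neg, abs_mul]
        calc _ ≤ A1 * (B * Real.exp (l * s)) * (Kc * chaJ + 1) * (K * w x0) * |z|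
              + B * Real.exp (l * s) * (K * w x0) * |z| * M := by
              gcongr
              exact bux s hs' _
          _ = _ := by ring)
    simp only [hq0] at this
    exact this
  have Ex : |ux t0 x0| ≤ |ux 0 (q 0)| +
      ((A1 * (Kc * chaJ + 1) + M) * B * (K * w x0)) / l * Real.exp (l * t0) := by
    have l1 := (hasDerivAt_iff_tendsto_slope_zero.1 (hux t0 ht0 x0)).abs
    have l2 := ((hasDerivAt_iff_tendsto_slope_zero.1 (hux 0 (hsub h0mem) (q 0))).abs).add_const
      (((A1 * (Kc * chaJ + 1) + M) * B * (K * w x0)) / l * Real.exp (l * t0))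
    refine le_of_tendsto_of_tendsto l1 l2 ?_
    have n1 : ∀ᶠ z : ℝ in nhdsWithin 0 {0}ᶜ, |z| ≤ 1 := by
      apply nhdsWithin_le_nhds
      filter_upwards [Metric.closedBall_mem_nhds (0 : ℝ) one_pos] with z hz
      simpa using hz
    filter_upwards [n1, self_mem_nhdsWithin] with z hz hz0
    have hzp : 0 < |z| := abs_pos.2 hz0
    simp only [smul_eq_mul, abs_mul, abs_inv]
    rw [inv_mul_le_iff₀ hzp]
    refine (Ez z hz).trans (le_of_eq ?_)
    field_simp
  -- conclusion
  have hin : |u 0 (q 0)| + |ux 0 (q 0)| + |ρ 0 (q 0)| ≤ C * (K * w x0) :=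
    (hdecay0 (q 0)).trans (by gcongr; exact hwq 0 h0mem)
  have hexp : 1 ≤ Real.exp (l * t0) := Real.one_le_exp (mul_nonneg hl.le ht0.1)
  have hfin : C * (K * w x0) ≤ C * (K * w x0) * Real.exp (l * t0) :=
    le_mul_of_one_le_right (by positivity) hexp
  calc |u t0 x0| + |ux t0 x0| + |ρ t0 x0|
      ≤ C * (K * w x0) * Real.exp (l * t0)
        + (A1 * B * (Kc * chaJ) * (K * w x0)) / l * Real.exp (l * t0)
        + ((A1 * (Kc * chaJ + 1) + M) * B * (K * w x0)) / l * Real.exp (l * t0)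
        + (|b - 1| * M * B * (K * w x0)) / l * Real.exp (l * t0) := by linarith
    _ = _ := by rw [hA]; field_simp; ring

/-- Persistence of algebraic decay: if a strong solution `(u,ρ)` of the
nonlocal two-component Camassa–Holm system on `[0,T)` (with `M < ∞`) has initial data with
`|u(0,x)| + |∂_x u(0,x)| + |ρ(0,x)| ≤ C (1+|x|)^{-c}`, then there is `C' > 0` with
`|u(t,x)| + |∂_x u(t,x)| + |ρ(t,x)| ≤ C' (1+|x|)^{-c}` uniformly on `[0,T) × ℝ`. -/
theorem stmt13 (b κ α T M c C : ℝ) (hT : 0 < T) (hc : 0 < c) (hC : 0 < C)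
    -- the strong solution (u, ρ) of the nonlocal system, with derivatives ut, ux, uxx, ρt, ρx
    (u ux uxx ut ρ ρt ρx : ℝ → ℝ → ℝ)
    (hu_cont : ContinuousOn (fun q : ℝ × ℝ => u q.1 q.2)
      (Set.Ico 0 T ×ˢ (Set.univ : Set ℝ)))
    (hux_cont : ContinuousOn (fun q : ℝ × ℝ => ux q.1 q.2)
      (Set.Ico 0 T ×ˢ (Set.univ : Set ℝ)))
    (huxx_cont : ContinuousOn (fun q : ℝ × ℝ => uxx q.1 q.2)
      (Set.Ico 0 T ×ˢ (Set.univ : Set ℝ)))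
    (hut_cont : ContinuousOn (fun q : ℝ × ℝ => ut q.1 q.2)
      (Set.Ico 0 T ×ˢ (Set.univ : Set ℝ)))
    (hρ_cont : ContinuousOn (fun q : ℝ × ℝ => ρ q.1 q.2)
      (Set.Ico 0 T ×ˢ (Set.univ : Set ℝ)))
    (hρt_cont : ContinuousOn (fun q : ℝ × ℝ => ρt q.1 q.2)
      (Set.Ico 0 T ×ˢ (Set.univ : Set ℝ)))
    (hρx_cont : ContinuousOn (fun q : ℝ × ℝ => ρx q.1 q.2)
      (Set.Ico 0 T ×ˢ (Set.univ : Set ℝ)))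
    (hux : ∀ t ∈ Set.Ico (0 : ℝ) T, ∀ x : ℝ, HasDerivAt (u t) (ux t x) x)
    (huxx : ∀ t ∈ Set.Ico (0 : ℝ) T, ∀ x : ℝ, HasDerivAt (ux t) (uxx t x) x)
    (hut : ∀ t ∈ Set.Ico (0 : ℝ) T, ∀ x : ℝ,
      HasDerivWithinAt (fun s => u s x) (ut t x) (Set.Ico 0 T) t)
    (hρx : ∀ t ∈ Set.Ico (0 : ℝ) T, ∀ x : ℝ, HasDerivAt (ρ t) (ρx t x) x)
    (hρt : ∀ t ∈ Set.Ico (0 : ℝ) T, ∀ x : ℝ,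
      HasDerivWithinAt (fun s => ρ s x) (ρt t x) (Set.Ico 0 T) t)
    -- the nonlocal system
    (hueq : ∀ t ∈ Set.Ico (0 : ℝ) T, ∀ x : ℝ,
      ut t x + u t x * ux t x =
        -deriv (greenConv (Pterm b κ α (u t) (ux t) (ρ t))) x)
    (hρeq : ∀ t ∈ Set.Ico (0 : ℝ) T, ∀ x : ℝ,
      ρt t x + u t x * ρx t x = -((b - 1) * ux t x * ρ t x))
    -- integrability of the solution
    (hL2Linf : ∀ t ∈ Set.Ico (0 : ℝ) T,
      MemLp (u t) 2 volume ∧ MemLp (u t) ⊤ volume ∧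
      MemLp (ux t) 2 volume ∧ MemLp (ux t) ⊤ volume ∧
      MemLp (ρ t) 2 volume ∧ MemLp (ρ t) ⊤ volume)
    -- the uniform bound M
    (hM : ∀ t ∈ Set.Ico (0 : ℝ) T,
      eLpNorm (u t) ⊤ volume + eLpNorm (ux t) ⊤ volume + eLpNorm (ρ t) ⊤ volume ≤
        ENNReal.ofReal M)
    -- initial algebraic decay
    (hdecay0 : ∀ x : ℝ, |u 0 x| + |ux 0 x| + |ρ 0 x| ≤ C * (1 + |x|) ^ (-c)) :
    ∃ C' > (0 : ℝ), ∀ t ∈ Set.Ico (0 : ℝ) T, ∀ x : ℝ,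
      |u t x| + |ux t x| + |ρ t x| ≤ C' * (1 + |x|) ^ (-c) := by
  set M0 := max M 0 with hM0
  have hM0' : 0 ≤ M0 := le_max_right _ _
  have c1 : ∀ s ∈ Set.Ico (0 : ℝ) T, Continuous (u s) := fun s hs =>
    continuous_iff_continuousAt.2 fun x => (hux s hs x).continuousAt
  have c2 : ∀ s ∈ Set.Ico (0 : ℝ) T, Continuous (ux s) := fun s hs =>
    continuous_iff_continuousAt.2 fun x => (huxx s hs x).continuousAt
  have c3 : ∀ s ∈ Set.Ico (0 : ℝ) T, Continuous (ρ s) := fun s hs =>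
    continuous_iff_continuousAt.2 fun x => (hρx s hs x).continuousAt
  have bu : ∀ t ∈ Set.Ico (0 : ℝ) T, ∀ x : ℝ, |u t x| ≤ M0 := fun t ht =>
    cha_sup (c1 t ht) (le_trans (le_trans le_self_add le_self_add) (hM t ht))
  have bux : ∀ t ∈ Set.Ico (0 : ℝ) T, ∀ x : ℝ, |ux t x| ≤ M0 := fun t ht =>
    cha_sup (c2 t ht) (le_trans (le_trans le_add_self le_self_add) (hM t ht))
  have bρ : ∀ t ∈ Set.Ico (0 : ℝ) T, ∀ x : ℝ, |ρ t x| ≤ M0 := fun t ht =>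
    cha_sup (c3 t ht) (le_trans le_add_self (hM t ht))
  have hJ := cha_J_nonneg
  obtain ⟨Kc, hKc⟩ : ∃ Kc, Kc = (1 + 2 * c) ^ c := ⟨_, rfl⟩
  have hKc' : 0 < Kc := by rw [hKc]; positivity
  obtain ⟨A1, hA1⟩ : ∃ A1, A1 = (|b| / 2 + |3 - b| / 2 + |κ| / 2) * M0 + |α| := ⟨_, rfl⟩
  obtain ⟨K, hK⟩ : ∃ K, K = Kc * Real.exp ((M0 * T + 1) / 2) := ⟨_, rfl⟩
  obtain ⟨A, hA⟩ : ∃ A, A = A1 * (Kc * chaJ) + (A1 * (Kc * chaJ + 1) + M0) + |b - 1| * M0 :=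
    ⟨_, rfl⟩
  have hA1' : 0 ≤ A1 := by rw [hA1]; positivity
  have hK' : 0 < K := by rw [hK]; positivity
  have hA' : 0 ≤ A := by rw [hA]; positivity
  obtain ⟨l, hl⟩ : ∃ l, l = 2 * (K * A) + 1 := ⟨_, rfl⟩
  have hl' : 0 < l := by rw [hl]; positivity
  have hKA : K * A / l ≤ 1 / 2 := by
    rw [div_le_div_iff₀ hl' (by norm_num), hl]; linarith
  -- the estimate for every regularised weight
  have main : ∀ ε > 0, ∀ t ∈ Set.Ico (0 : ℝ) T, ∀ x : ℝ,
      |u t x| + |ux t x| + |ρ t x| ≤ 2 * (K * C) * Real.exp (l * t) * ((1 + |x|) ^ (-c) + ε) := by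
    intro ε hε
    have hw0 : ∀ x : ℝ, 0 ≤ (1 + |x|) ^ (-c) := fun x => by positivity
    have iter : ∀ n : ℕ, ∀ t ∈ Set.Ico (0 : ℝ) T, ∀ x : ℝ,
        |u t x| + |ux t x| + |ρ t x| ≤
          (2 * (K * C) + 3 * M0 / ε * (1 / 2) ^ n) * Real.exp (l * t)
            * ((1 + |x|) ^ (-c) + ε) := by
      intro n
      induction n with
      | zero =>
        intro t ht x
        have h1 : 1 ≤ Real.exp (l * t) := Real.one_le_exp (mul_nonneg hl'.le ht.1)
        have h2 : |u t x| + |ux t x| + |ρ t x| ≤ 3 * M0 := by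
          linarith [bu t ht x, bux t ht x, bρ t ht x]
        have h3 := hw0 x
        calc _ ≤ 3 * M0 / ε * 1 * ε := by rw [mul_one, div_mul_cancel₀ _ hε.ne']; exact h2
          _ ≤ _ := by
            rw [pow_zero]
            have h4 : 0 ≤ K * C := by positivity
            have h5 : 0 ≤ 3 * M0 / ε := by positivity
            refine mul_le_mul ?_ (by linarith) hε.le (by positivity)
            refine mul_le_mul (by linarith) h1 zero_le_one (by positivity)
      | succ n ih =>
        intro t ht x
        have hB : 0 ≤ 2 * (K * C) + 3 * M0 / ε * (1 / 2) ^ n := by positivity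
        refine (cha_step b κ α T M0 C u ux uxx ut ρ ρt ρx hM0' hu_cont hux_cont hρx_cont hux huxx
          hut hρx hρt hueq hρeq bu bux bρ (w := fun x => (1 + |x|) ^ (-c) + ε) hKc'.le hC.le
          (fun x => add_nonneg (hw0 x) hε.le)
          (fun x y => by rw [hKc]; exact cha_weight hc hε.le x y)
          (fun x => (hdecay0 x).trans (by gcongr; linarith)) hA1 hK hA hl' hB ih t ht x).trans ?_
        have h3 := hw0 x
        have := mul_le_mul_of_nonneg_right hKA hB
        refine mul_le_mul_of_nonneg_right (mul_le_mul_of_nonneg_right ?_ (Real.exp_pos _).le)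
          (by positivity)
        rw [pow_succ]
        linarith
    intro t ht x
    have lim : Filter.Tendsto (fun n : ℕ => (2 * (K * C) + 3 * M0 / ε * (1 / 2) ^ n)
        * Real.exp (l * t) * ((1 + |x|) ^ (-c) + ε)) Filter.atTop
        (nhds ((2 * (K * C) + 3 * M0 / ε * 0) * Real.exp (l * t) * ((1 + |x|) ^ (-c) + ε))) :=
      ((((tendsto_pow_atTop_nhds_zero_of_lt_one (by norm_num) (by norm_num)).const_mul
        _).const_add _).mul_const _).mul_const _
    have := ge_of_tendsto' lim fun n => iter n t ht x
    simpa using this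
  refine ⟨2 * (K * C) * Real.exp (l * T), by positivity, fun t ht x => ?_⟩
  have h1 : |u t x| + |ux t x| + |ρ t x| ≤ 2 * (K * C) * Real.exp (l * t) * (1 + |x|) ^ (-c) := by
    have lim : Filter.Tendsto (fun ε : ℝ => 2 * (K * C) * Real.exp (l * t) * ((1 + |x|) ^ (-c) + ε))
        (nhdsWithin 0 (Set.Ioi 0))
        (nhds (2 * (K * C) * Real.exp (l * t) * ((1 + |x|) ^ (-c) + 0))) :=
      ((Filter.tendsto_id.mono_left nhdsWithin_le_nhds).const_add _).const_mul _
    rw [add_zero] at lim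
    refine ge_of_tendsto lim ?_
    filter_upwards [self_mem_nhdsWithin] with ε hε
    exact main ε hε t ht x
  refine h1.trans ?_
  gcongr
  exact ht.2.le
end

section
/- Let b, κ, α ∈ ℝ, 0 < T < ∞, 0 ≤ a < 1, and let (u, ρ) be a strong solution on [0,T) of the nonlocal system ∂_t u + u ∂_x u = −∂_x(G * P(u,ρ)), ∂_t ρ + u ∂_x ρ = −(b−1)(∂_x u) ρ, with G(x) = (1/2) e^{-|x|} and P(u,ρ) = (b/2) u² + ((3−b)/2)(∂_x u)² + (κ/2) ρ² − α u, such that u is C¹ in (t,x) and twice continuously differentiable in x, ρ is C¹, u(t,·), ∂_x u(t,·), ρ(t,·) ∈ L²(ℝ) ∩ L^∞(ℝ) for all t, and M := sup_{t ∈ [0,T)} ( ‖u(t,·)‖_{L^∞} + ‖∂_x u(t,·)‖_{L^∞} + ‖ρ(t,·)‖_{L^∞} ) < ∞. If there is C > 0 with |u(0,x)| + |∂_x u(0,x)| + |ρ(0,x)| ≤ C e^{-a·max(x,0)} for all x ∈ ℝ, then there is C' > 0 such that |u(t,x)| + |∂_x u(t,x)| + |ρ(t,x)| ≤ C' e^{-a·max(x,0)}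 uniformly for all (t,x) ∈ [0,T) × ℝ; that is, the one-sided pointwise decay O(e^{-ax}) as x → +∞ is preserved by the evolution. -/
open MeasureTheory
open scoped ENNReal

lemma aux_chain (T : ℝ) (f fx : ℝ → ℝ → ℝ) (q : ℝ → ℝ) (s v ft : ℝ) (hs : s ∈ Set.Ico 0 T)
    (hfx : ContinuousOn (fun p : ℝ × ℝ => fx p.1 p.2) (Set.Ico 0 T ×ˢ (Set.univ : Set ℝ)))
    (hd : ∀ t ∈ Set.Ico (0 : ℝ) T, ∀ x : ℝ, HasDerivAt (f t) (fx t x) x)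
    (hft : HasDerivWithinAt (fun r => f r (q s)) ft (Set.Ici s) s)
    (hq : HasDerivWithinAt q v (Set.Ici s) s) :
    HasDerivWithinAt (fun r => f r (q r)) (ft + fx s (q s) * v) (Set.Ici s) s := by
  have key : HasDerivWithinAt (fun r => f r (q r) - f r (q s)) (fx s (q s) * v) (Set.Ici s) s := by
    have h1 : ∀ r : ℝ, ∃ ξ : ℝ, |ξ - q s| ≤ |q r - q s| ∧
        (r ∈ Set.Ico 0 T → f r (q r) - f r (q s) = fx r ξ * (q r - q s)) := by
      intro r
      by_cases hr : r ∈ Set.Ico 0 T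
      · rcases lt_trichotomy (q s) (q r) with h | h | h
        · obtain ⟨c, hc, hc'⟩ := exists_hasDerivAt_eq_slope (f r) (fx r) h
            (fun x _ => (hd r hr x).continuousAt.continuousWithinAt) (fun x _ => hd r hr x)
          refine ⟨c, ?_, fun _ => ?_⟩
          · rw [abs_of_pos (by linarith [hc.1]), abs_of_pos (by linarith)]; linarith [hc.2]
          · rw [hc', div_mul_cancel₀]; linarith
        · exact ⟨q s, by simp, fun _ => by simp [h]⟩
        · obtain ⟨c, hc, hc'⟩ := exists_hasDerivAt_eq_slope (f r) (fx r) h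
            (fun x _ => (hd r hr x).continuousAt.continuousWithinAt) (fun x _ => hd r hr x)
          refine ⟨c, ?_, fun _ => ?_⟩
          · rw [abs_of_neg (by linarith [hc.2]), abs_of_neg (by linarith)]; linarith [hc.1]
          · rw [hc', ← neg_sub (q s) (q r), mul_neg, div_mul_cancel₀]
            · ring
            · linarith
      · exact ⟨q s, by simp, fun h => absurd h hr⟩
    choose ξ hξ1 hξ2 using h1
    have hξs : ξ s = q s := by
      have := hξ1 s
      simp only [sub_self, abs_zero] at this
      linarith [abs_nonpos_iff.mp this]
    rw [hasDerivWithinAt_iff_tendsto_slope] at hq ⊢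
    have hqc : Filter.Tendsto q (nhdsWithin s (Set.Ici s \ {s})) (nhds (q s)) := by
      have := (hasDerivWithinAt_iff_tendsto_slope.mpr hq).continuousWithinAt
      exact this.mono_left (nhdsWithin_mono _ Set.sdiff_subset)
    have hξc : Filter.Tendsto ξ (nhdsWithin s (Set.Ici s \ {s})) (nhds (q s)) := by
      rw [tendsto_iff_dist_tendsto_zero] at hqc ⊢
      exact squeeze_zero (fun _ => dist_nonneg) (fun r => by
        simpa [Real.dist_eq] using hξ1 r) hqc
    have hmem : ∀ᶠ r in nhdsWithin s (Set.Ici s \ {s}), r ∈ Set.Ico 0 T := by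
      have h0 : ∀ᶠ r in nhdsWithin s (Set.Ici s), r ∈ Set.Ico s T := Ico_mem_nhdsGE hs.2
      filter_upwards [nhdsWithin_mono _ (Set.sdiff_subset (t := {s})) h0] with r hr
      exact ⟨hs.1.trans hr.1, hr.2⟩
    have hk : Filter.Tendsto (fun r => fx r (ξ r)) (nhdsWithin s (Set.Ici s \ {s}))
        (nhds (fx s (q s))) := by
      have hc := hfx (s, q s) ⟨hs, trivial⟩
      have : Filter.Tendsto (fun r => (r, ξ r)) (nhdsWithin s (Set.Ici s \ {s}))
          (nhdsWithin (s, q s) (Set.Ico 0 T ×ˢ (Set.univ : Set ℝ))) := by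
        refine tendsto_nhdsWithin_iff.mpr ⟨?_, ?_⟩
        · exact (Filter.tendsto_id.mono_left nhdsWithin_le_nhds).prodMk_nhds hξc
        · filter_upwards [hmem] with r hr using ⟨hr, trivial⟩
      exact hc.tendsto.comp this
    refine (hk.mul hq).congr' ?_
    filter_upwards [hmem] with r hr
    simp only [slope_def_field]
    rw [hξ2 r hr]
    ring
  have := hft.add key
  refine this.congr_of_eventuallyEq ?_ ?_
  · filter_upwards with r
    simp
  · simp

lemma aux_flow (T m : ℝ) (hm : 0 ≤ m) (u ux : ℝ → ℝ → ℝ)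
    (hu_cont : ContinuousOn (fun q : ℝ × ℝ => u q.1 q.2) (Set.Ico 0 T ×ˢ (Set.univ : Set ℝ)))
    (hux : ∀ t ∈ Set.Ico (0 : ℝ) T, ∀ x : ℝ, HasDerivAt (u t) (ux t x) x)
    (hb : ∀ t ∈ Set.Ico (0 : ℝ) T, ∀ x : ℝ, |u t x| ≤ m)
    (hbx : ∀ t ∈ Set.Ico (0 : ℝ) T, ∀ x : ℝ, |ux t x| ≤ m)
    (t₀ x₀ : ℝ) (ht₀ : t₀ ∈ Set.Ico 0 T) :
    ∃ q : ℝ → ℝ, q t₀ = x₀ ∧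
      (∀ s ∈ Set.Icc 0 t₀, HasDerivWithinAt q (u s (q s)) (Set.Icc 0 t₀) s) ∧
      ∀ s ∈ Set.Icc 0 t₀, |q s - x₀| ≤ m * T := by
  have hsub : ∀ t ∈ Set.Icc 0 t₀, t ∈ Set.Ico 0 T := fun t ht => ⟨ht.1, ht.2.trans_lt ht₀.2⟩
  lift m to NNReal using hm
  have ht₀' := ht₀.1
  obtain ⟨τ, hτ⟩ : ∃ τ : NNReal, (τ : ℝ) = t₀ := ⟨⟨t₀, ht₀.1⟩, rfl⟩
  have hPL : IsPicardLindelof u (tmin := 0) (tmax := t₀) ⟨t₀, ht₀.1, le_rfl⟩ x₀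
      (m * τ) 0 m m := by
    refine ⟨?_, ?_, ?_, ?_⟩
    · intro t ht
      refine Convex.lipschitzOnWith_of_nnnorm_hasDerivWithin_le (convex_closedBall _ _)
        (f' := ux t) (fun x _ => (hux t (hsub t ht) x).hasDerivWithinAt) ?_
      intro x _
      rw [← NNReal.coe_le_coe]
      exact hbx t (hsub t ht) x
    · intro x _
      exact hu_cont.comp (f := fun t : ℝ => (t, x)) (by fun_prop)
        (fun t ht => ⟨hsub t ht, trivial⟩)
    · intro t ht x _
      exact hb t (hsub t ht) x
    · simp [ht₀.1, hτ]
  obtain ⟨q, hq0, hq⟩ := hPL.exists_eq_forall_mem_Icc_hasDerivWithinAt₀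
  refine ⟨q, hq0, hq, fun s hs => ?_⟩
  have := (convex_Icc 0 t₀).norm_image_sub_le_of_norm_hasDerivWithin_le (C := m) hq
    (fun r hr => hb r (hsub r hr) (q r)) (⟨ht₀.1, le_rfl⟩ : t₀ ∈ Set.Icc 0 t₀) hs
  simp only at hq0
  rw [hq0] at this
  refine this.trans ?_
  gcongr
  rw [Real.norm_eq_abs, abs_of_nonpos (by linarith [hs.2])]
  linarith [hs.1, ht₀.2]

/-- left half of the Green convolution -/
noncomputable def auxI (h : ℝ → ℝ) (x : ℝ) : ℝ :=
  1 / 2 * Real.exp (-x) * ∫ y in Set.Iic x, Real.exp y * h y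
/-- right half of the Green convolution -/
noncomputable def auxJ (h : ℝ → ℝ) (x : ℝ) : ℝ :=
  1 / 2 * Real.exp x * ∫ y in Set.Ioi x, Real.exp (-y) * h y

lemma aux_intI (h : ℝ → ℝ) (hc : Continuous h) (D : ℝ) (hD : ∀ y, |h y| ≤ D) (x : ℝ) :
    IntegrableOn (fun y => Real.exp y * h y) (Set.Iic x) := by
  refine Integrable.mul_bdd (c := D) (integrableOn_exp_Iic x) hc.aestronglyMeasurable ?_
  exact Filter.Eventually.of_forall hD

lemma aux_intJ (h : ℝ → ℝ) (hc : Continuous h) (D : ℝ) (hD : ∀ y, |h y| ≤ D) (x : ℝ) :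
    IntegrableOn (fun y => Real.exp (-y) * h y) (Set.Ioi x) := by
  refine Integrable.mul_bdd (c := D) (integrableOn_exp_neg_Ioi x) hc.aestronglyMeasurable ?_
  exact Filter.Eventually.of_forall hD

lemma aux_conv (h : ℝ → ℝ) (hc : Continuous h) (D : ℝ) (hD : ∀ y, |h y| ≤ D) (x : ℝ) :
    greenConv h x = auxI h x + auxJ h x := by
  have e1 : Set.EqOn (fun y => greenG (x - y) * h y)
      (fun y => 1 / 2 * Real.exp (-x) * (Real.exp y * h y)) (Set.Iic x) := by
    intro y hy
    simp only [greenG]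
    rw [abs_of_nonneg (by simpa using hy), show -(x - y) = -x + y by ring, Real.exp_add]
    ring
  have e2 : Set.EqOn (fun y => greenG (x - y) * h y)
      (fun y => 1 / 2 * Real.exp x * (Real.exp (-y) * h y)) (Set.Ioi x) := by
    intro y hy
    simp only [greenG]
    rw [abs_of_neg (by simpa using hy), show -(-(x - y)) = x + -y by ring, Real.exp_add]
    ring
  unfold greenConv auxI auxJ
  rw [← intervalIntegral.integral_Iic_add_Ioi (b := x), setIntegral_congr_fun measurableSet_Iic e1,
    setIntegral_congr_fun measurableSet_Ioi e2, integral_const_mul, integral_const_mul]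
  · exact (integrableOn_congr_fun e1 measurableSet_Iic).mpr ((aux_intI h hc D hD x).const_mul _)
  · exact (integrableOn_congr_fun e2 measurableSet_Ioi).mpr ((aux_intJ h hc D hD x).const_mul _)

lemma aux_dI (h : ℝ → ℝ) (hc : Continuous h) (D : ℝ) (hD : ∀ y, |h y| ≤ D) (x : ℝ) :
    HasDerivAt (auxI h) (-auxI h x + h x / 2) x := by
  have hc' : Continuous (fun y => Real.exp y * h y) := by fun_prop
  have e : ∀ z, ∫ y in Set.Iic z, Real.exp y * h y =
      (∫ y in Set.Iic 0, Real.exp y * h y) + ∫ y in (0:ℝ)..z, Real.exp y * h y := by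
    intro z
    rw [← intervalIntegral.integral_Iic_sub_Iic (aux_intI h hc D hD 0) (aux_intI h hc D hD z)]
    ring
  have h1 : HasDerivAt (fun z => ∫ y in Set.Iic z, Real.exp y * h y) (Real.exp x * h x) x := by
    rw [funext e]
    exact (hc'.integral_hasStrictDerivAt 0 x).hasDerivAt.const_add _
  have h2 : HasDerivAt (fun z : ℝ => 1 / 2 * Real.exp (-z)) (1 / 2 * (Real.exp (-x) * (-1))) x :=
    ((hasDerivAt_neg x).exp).const_mul _
  have := h2.mul h1
  refine this.congr_deriv ?_
  have : Real.exp (-x) * Real.exp x = 1 := by rw [← Real.exp_add]; simp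
  unfold auxI
  linear_combination (h x / 2) * this

lemma aux_dJ (h : ℝ → ℝ) (hc : Continuous h) (D : ℝ) (hD : ∀ y, |h y| ≤ D) (x : ℝ) :
    HasDerivAt (auxJ h) (auxJ h x - h x / 2) x := by
  have hc' : Continuous (fun y => Real.exp (-y) * h y) := by fun_prop
  have e : ∀ z, ∫ y in Set.Ioi z, Real.exp (-y) * h y =
      (∫ y in Set.Ioi 0, Real.exp (-y) * h y) - ∫ y in (0:ℝ)..z, Real.exp (-y) * h y := by
    intro z
    rw [← intervalIntegral.integral_Ioi_sub_Ioi' (aux_intJ h hc D hD 0) (aux_intJ h hc D hD z)]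
    ring
  have h1 : HasDerivAt (fun z => ∫ y in Set.Ioi z, Real.exp (-y) * h y)
      (-(Real.exp (-x) * h x)) x := by
    rw [funext e]
    exact (hc'.integral_hasStrictDerivAt 0 x).hasDerivAt.const_sub _
  have h2 : HasDerivAt (fun z : ℝ => 1 / 2 * Real.exp z) (1 / 2 * Real.exp x) x :=
    (Real.hasDerivAt_exp x).const_mul _
  have := h2.mul h1
  refine this.congr_deriv ?_
  have : Real.exp (-x) * Real.exp x = 1 := by rw [← Real.exp_add]; simp
  unfold auxJ
  linear_combination (-h x / 2) * this

lemma aux_bI (h L : ℝ → ℝ) (D a : ℝ) (ha0 : 0 ≤ a) (ha1 : a < 1) (hD0 : 0 ≤ D)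
    (hL : ∀ x y, |L x - L y| ≤ |x - y|)
    (hD : ∀ y, |h y| ≤ D * Real.exp (-a * L y)) (x : ℝ) :
    |auxI h x| ≤ D / (1 - a) * Real.exp (-a * L x) / 2 := by
  have ha : 0 < 1 - a := by linarith
  have h1 : |∫ y in Set.Iic x, Real.exp y * h y| ≤
      ∫ y in Set.Iic x, D * Real.exp (-a * L x) * Real.exp (a * x) * Real.exp ((1 - a) * y) := by
    rw [← Real.norm_eq_abs]
    refine norm_integral_le_of_norm_le ((integrableOn_exp_mul_Iic ha x).const_mul _) ?_
    filter_upwards [ae_restrict_mem measurableSet_Iic] with y hy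
    rw [Real.norm_eq_abs, abs_mul, abs_of_pos (Real.exp_pos _)]
    have h3 : -a * L y ≤ -a * L x + a * (x - y) := by
      have := (le_abs_self _).trans (hL x y)
      rw [abs_of_nonneg (sub_nonneg.mpr hy)] at this
      nlinarith
    calc Real.exp y * |h y| ≤ Real.exp y * (D * Real.exp (-a * L x + a * (x - y))) := by
          gcongr
          exact (hD y).trans (by gcongr)
      _ = _ := by
          rw [show (1 - a) * y = y + -(a * y) by ring, show -a * L x + a * (x - y) =
            -a * L x + a * x + -(a * y) by ring]
          simp only [Real.exp_add]
          ring
  rw [integral_const_mul, integral_exp_mul_Iic ha] at h1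
  unfold auxI
  rw [abs_mul, abs_of_pos (by positivity)]
  calc _ ≤ 1 / 2 * Real.exp (-x) * (D * Real.exp (-a * L x) * Real.exp (a * x) *
        (Real.exp ((1 - a) * x) / (1 - a))) := by gcongr
    _ = _ := by
      have : Real.exp (-x) * Real.exp (a * x) * Real.exp ((1 - a) * x) = 1 := by
        rw [← Real.exp_add, ← Real.exp_add, Real.exp_eq_one_iff]; ring
      linear_combination (D * Real.exp (-a * L x) / (1 - a) / 2) * this

lemma aux_bJ (h L : ℝ → ℝ) (D a : ℝ) (ha0 : 0 ≤ a) (ha1 : a < 1) (hD0 : 0 ≤ D)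
    (hL : ∀ x y, |L x - L y| ≤ |x - y|)
    (hD : ∀ y, |h y| ≤ D * Real.exp (-a * L y)) (x : ℝ) :
    |auxJ h x| ≤ D / (1 - a) * Real.exp (-a * L x) / 2 := by
  have ha : 0 < 1 - a := by linarith
  have ha' : -(1 - a) < 0 := by linarith
  have h1 : |∫ y in Set.Ioi x, Real.exp (-y) * h y| ≤
      ∫ y in Set.Ioi x,
        D * Real.exp (-a * L x) * Real.exp (-(a * x)) * Real.exp (-(1 - a) * y) := by
    rw [← Real.norm_eq_abs]
    refine norm_integral_le_of_norm_le ((integrableOn_exp_mul_Ioi ha' x).const_mul _) ?_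
    filter_upwards [ae_restrict_mem measurableSet_Ioi] with y hy
    rw [Real.norm_eq_abs, abs_mul, abs_of_pos (Real.exp_pos _)]
    have h3 : -a * L y ≤ -a * L x + a * (y - x) := by
      have := (le_abs_self _).trans (hL x y)
      rw [abs_of_neg (sub_neg.mpr hy)] at this
      nlinarith
    calc Real.exp (-y) * |h y| ≤ Real.exp (-y) * (D * Real.exp (-a * L x + a * (y - x))) := by
          gcongr
          exact (hD y).trans (by gcongr)
      _ = _ := by
          rw [show -(1 - a) * y = -y + (a * y) by ring, show -a * L x + a * (y - x) =
            -a * L x + -(a * x) + (a * y) by ring]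
          simp only [Real.exp_add]
          ring
  rw [integral_const_mul, integral_exp_mul_Ioi ha'] at h1
  unfold auxJ
  rw [abs_mul, abs_of_pos (by positivity)]
  calc _ ≤ 1 / 2 * Real.exp x * (D * Real.exp (-a * L x) * Real.exp (-(a * x)) *
        (-Real.exp (-(1 - a) * x) / -(1 - a))) := by gcongr
    _ = _ := by
      have : Real.exp x * Real.exp (-(a * x)) * Real.exp (-(1 - a) * x) = 1 := by
        rw [← Real.exp_add, ← Real.exp_add, Real.exp_eq_one_iff]; ring
      rw [neg_div_neg_eq]
      linear_combination (D * Real.exp (-a * L x) / (1 - a) / 2) * this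

lemma aux_intG (h : ℝ → ℝ) (hc : Continuous h) (D : ℝ) (hD : ∀ y, |h y| ≤ D) (x : ℝ) :
    Integrable (fun y => greenG (x - y) * h y) := by
  have e1 : Set.EqOn (fun y => greenG (x - y) * h y)
      (fun y => 1 / 2 * Real.exp (-x) * (Real.exp y * h y)) (Set.Iic x) := by
    intro y hy
    simp only [greenG]
    rw [abs_of_nonneg (by simpa using hy), show -(x - y) = -x + y by ring, Real.exp_add]
    ring
  have e2 : Set.EqOn (fun y => greenG (x - y) * h y)
      (fun y => 1 / 2 * Real.exp x * (Real.exp (-y) * h y)) (Set.Ioi x) := by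
    intro y hy
    simp only [greenG]
    rw [abs_of_neg (by simpa using hy), show -(-(x - y)) = x + -y by ring, Real.exp_add]
    ring
  rw [← integrableOn_univ, ← Set.Iic_union_Ioi (a := x)]
  exact ((integrableOn_congr_fun e1 measurableSet_Iic).mpr
      ((aux_intI h hc D hD x).const_mul _)).union
    ((integrableOn_congr_fun e2 measurableSet_Ioi).mpr ((aux_intJ h hc D hD x).const_mul _))

lemma aux_greenCont (T D : ℝ) (p : ℝ → ℝ → ℝ)
    (hp : ContinuousOn (fun q : ℝ × ℝ => p q.1 q.2) (Set.Ico 0 T ×ˢ (Set.univ : Set ℝ)))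
    (hpx : ∀ t ∈ Set.Ico 0 T, Continuous (p t))
    (hD : ∀ t ∈ Set.Ico 0 T, ∀ x, |p t x| ≤ D) (x : ℝ) :
    ContinuousOn (fun s => greenConv (p s) x) (Set.Ico 0 T) := by
  intro s hs
  unfold greenConv
  have hG : Continuous (fun y => greenG (x - y)) := by unfold greenG; fun_prop
  have hG0 : ∀ y, 0 ≤ greenG y := fun y => by unfold greenG; positivity
  refine continuousWithinAt_of_dominated (bound := fun y => greenG (x - y) * |D|) ?_ ?_ ?_ ?_
  · filter_upwards [self_mem_nhdsWithin] with r hr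
    exact (hG.mul (hpx r hr)).aestronglyMeasurable
  · filter_upwards [self_mem_nhdsWithin] with r hr
    refine Filter.Eventually.of_forall fun y => ?_
    rw [Real.norm_eq_abs, abs_mul, abs_of_nonneg (hG0 _)]
    exact mul_le_mul_of_nonneg_left ((hD r hr y).trans (le_abs_self _)) (hG0 _)
  · exact aux_intG (fun _ => |D|) continuous_const |D| (by simp) x
  · refine Filter.Eventually.of_forall fun y => ?_
    refine ContinuousWithinAt.mul continuousWithinAt_const ?_
    exact (hp.comp (f := fun t : ℝ => (t, y)) (by fun_prop) (fun t ht => ⟨ht, trivial⟩)) s hs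

lemma aux_right {T s : ℝ} {f : ℝ → ℝ} {f' : ℝ} (hs : s ∈ Set.Ico 0 T)
    (h : HasDerivWithinAt f f' (Set.Ico 0 T) s) : HasDerivWithinAt f f' (Set.Ici s) s := by
  refine h.mono_of_mem_nhdsWithin ?_
  exact Filter.mem_of_superset (Ico_mem_nhdsGE hs.2) (Set.Ico_subset_Ico_left hs.1)

lemma aux_uxt (T : ℝ) (u ux ut v : ℝ → ℝ → ℝ)
    (hut_cont : ContinuousOn (fun q : ℝ × ℝ => ut q.1 q.2) (Set.Ico 0 T ×ˢ (Set.univ : Set ℝ)))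
    (hux : ∀ t ∈ Set.Ico (0 : ℝ) T, ∀ x : ℝ, HasDerivAt (u t) (ux t x) x)
    (hut : ∀ t ∈ Set.Ico (0 : ℝ) T, ∀ x : ℝ,
      HasDerivWithinAt (fun s => u s x) (ut t x) (Set.Ico 0 T) t)
    (hv : ∀ t ∈ Set.Ico (0 : ℝ) T, ∀ x : ℝ, HasDerivAt (ut t) (v t x) x)
    (hvc : ∀ x, ContinuousOn (fun s => v s x) (Set.Ico 0 T))
    (hvb : ∀ t₀ ∈ Set.Ico (0 : ℝ) T, ∀ x, ∃ Kb, ∀ s ∈ Set.Icc 0 t₀,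
      ∀ y ∈ Metric.closedBall x 1, |v s y| ≤ Kb)
    (s x : ℝ) (hs : s ∈ Set.Ico 0 T) :
    HasDerivWithinAt (fun r => ux r x) (v s x) (Set.Ici s) s := by
  have h0 : (0:ℝ) ∈ Set.Ico 0 T := ⟨le_rfl, hs.1.trans_lt hs.2⟩
  have hsub : ∀ r ∈ Set.Ico 0 T, Set.Icc 0 r ⊆ Set.Ico 0 T :=
    fun r hr z hz => ⟨hz.1, hz.2.trans_lt hr.2⟩
  have hutc : ∀ y, ContinuousOn (fun z => ut z y) (Set.Ico 0 T) := fun y =>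
    hut_cont.comp (f := fun t : ℝ => (t, y)) (by fun_prop) (fun t ht => ⟨ht, trivial⟩)
  have hitg : ∀ g : ℝ → ℝ, ContinuousOn g (Set.Ico 0 T) → ∀ r ∈ Set.Ico 0 T,
      IntervalIntegrable g volume 0 r := by
    intro g hg r hr
    refine (hg.mono ?_).intervalIntegrable
    rw [Set.uIcc_of_le hr.1]
    exact hsub r hr
  have e1 : ∀ r ∈ Set.Ico 0 T, ∀ y, u r y = u 0 y + ∫ z in (0:ℝ)..r, ut z y := by
    intro r hr y
    rw [intervalIntegral.integral_eq_sub_of_hasDeriv_right_of_le hr.1 (f := fun z => u z y)]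
    · ring
    · intro z hz
      exact ((hut z (hsub r hr hz) y).continuousWithinAt).mono (hsub r hr)
    · intro z hz
      have hz' := hsub r hr ⟨hz.1.le, hz.2.le⟩
      exact (aux_right hz' (hut z hz' y)).mono Set.Ioi_subset_Ici_self
    · exact hitg _ (hutc y) r hr
  have e2 : ∀ r ∈ Set.Ico 0 T, ux r x = ux 0 x + ∫ z in (0:ℝ)..r, v z x := by
    intro r hr
    obtain ⟨Kb, hKb⟩ := hvb r hr x
    have hioc : ∀ z ∈ Set.uIoc 0 r, z ∈ Set.Icc 0 r := by
      intro z hz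
      rw [Set.uIoc_of_le hr.1] at hz
      exact ⟨hz.1.le, hz.2⟩
    have hmeas : ∀ g : ℝ → ℝ, ContinuousOn g (Set.Ico 0 T) →
        AEStronglyMeasurable g (volume.restrict (Set.uIoc 0 r)) := by
      intro g hg
      exact (hg.mono (fun z hz => hsub r hr (hioc z hz))).aestronglyMeasurable measurableSet_uIoc
    have key := intervalIntegral.hasDerivAt_integral_of_dominated_loc_of_deriv_le
      (μ := volume) (a := 0) (b := r) (F := fun y z => ut z y) (F' := fun y z => v z y) (x₀ := x)
      (s := Metric.closedBall x 1) (bound := fun _ => Kb)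
      (Metric.closedBall_mem_nhds x one_pos) (Filter.Eventually.of_forall fun y => hmeas _ (hutc y))
      (hitg _ (hutc x) r hr) (hmeas _ (hvc x))
      (Filter.Eventually.of_forall fun z hz y hy => hKb z (hioc z hz) y hy)
      intervalIntegrable_const
      (Filter.Eventually.of_forall fun z hz y hy => hv z (hsub r hr (hioc z hz)) y)
    have h2 := (hux 0 h0 x).add key.2
    refine (hux r hr x).unique (h2.congr_of_eventuallyEq ?_)
    exact Filter.Eventually.of_forall fun y => e1 r hr y
  have hIoo : Set.Ioo s T ∈ nhdsWithin s (Set.Ioi s) := Ioo_mem_nhdsGT hs.2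
  have h3 : HasDerivWithinAt (fun r => ∫ z in (0:ℝ)..r, v z x) (v s x) (Set.Ici s) s := by
    refine intervalIntegral.integral_hasDerivWithinAt_right (t := Set.Ioi s) (hitg _ (hvc x) s hs)
      ?_ ?_
    · refine ⟨Set.Ioo s T, hIoo, ?_⟩
      exact ((hvc x).mono (fun z hz => ⟨hs.1.trans hz.1.le, hz.2⟩)).aestronglyMeasurable
        measurableSet_Ioo
    · exact ((hvc x) s hs).mono_of_mem_nhdsWithin
        (Filter.mem_of_superset hIoo (fun z hz => ⟨hs.1.trans hz.1.le, hz.2⟩))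
  refine (h3.const_add (ux 0 x)).congr_of_eventuallyEq ?_ (e2 s hs)
  filter_upwards [Ico_mem_nhdsGE hs.2] with r hr
  exact e2 r ⟨hs.1.trans hr.1, hr.2⟩

lemma aux_bd (M : ℝ) (f g h : ℝ → ℝ) (hf : Continuous f) (hg : Continuous g) (hh : Continuous h)
    (hM : eLpNorm f ⊤ volume + eLpNorm g ⊤ volume + eLpNorm h ⊤ volume ≤ ENNReal.ofReal M)
    (x : ℝ) : |f x| + |g x| + |h x| ≤ max M 0 := by
  have hae : ∀ᵐ y ∂(volume : Measure ℝ), |f y| + |g y| + |h y| ≤ max M 0 := by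
    simp only [eLpNorm_exponent_top] at hM
    filter_upwards [ae_le_eLpNormEssSup (f := f) (μ := volume),
      ae_le_eLpNormEssSup (f := g) (μ := volume),
      ae_le_eLpNormEssSup (f := h) (μ := volume)] with y h1 h2 h3
    have h4 := (add_le_add (add_le_add h1 h2) h3).trans hM
    rw [Real.enorm_eq_ofReal_abs, Real.enorm_eq_ofReal_abs, Real.enorm_eq_ofReal_abs,
      ← ENNReal.ofReal_add (by positivity) (by positivity),
      ← ENNReal.ofReal_add (by positivity) (by positivity), ENNReal.ofReal_le_ofReal_iff'] at h4
    rcases h4 with h4 | h4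
    · exact h4.trans (le_max_left _ _)
    · exact h4.trans (le_max_right _ _)
  have hd := Measure.dense_of_ae hae
  have hcl : IsClosed {y | |f y| + |g y| + |h y| ≤ max M 0} :=
    isClosed_le (by fun_prop) continuous_const
  have := hcl.closure_eq ▸ hd.closure_eq
  exact (Set.eq_univ_iff_forall.mp this) x

lemma aux_P (b κ α m : ℝ) (u w ρ : ℝ → ℝ) (x : ℝ) (h : |u x| + |w x| + |ρ x| ≤ m) :
    |Pterm b κ α u w ρ x| ≤
      ((|b| + |3 - b| + |κ|) * m + |α|) * (|u x| + |w x| + |ρ x|) := by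
  have hsq : ∀ c z : ℝ, |z| ≤ m → |c / 2 * z ^ 2| ≤ |c| * m * |z| := by
    intro c z hz
    rw [abs_mul, abs_pow, abs_div, abs_two]
    have h1 : |z| * |z| ≤ m * |z| := mul_le_mul_of_nonneg_right hz (abs_nonneg _)
    have h2 := mul_le_mul_of_nonneg_left h1 (abs_nonneg c)
    have h3 : 0 ≤ |c| * (|z| * |z|) := by positivity
    nlinarith
  have hu := abs_nonneg (u x)
  have hw := abs_nonneg (w x)
  have hr := abs_nonneg (ρ x)
  have hm : 0 ≤ m := by linarith
  have h1 := hsq b (u x) (by linarith)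
  have h2 := hsq (3 - b) (w x) (by linarith)
  have h3 := hsq κ (ρ x) (by linarith)
  have h4 : |α * u x| = |α| * |u x| := abs_mul _ _
  unfold Pterm
  have h5 : |b / 2 * u x ^ 2 + (3 - b) / 2 * w x ^ 2 + κ / 2 * ρ x ^ 2 - α * u x| ≤
      |b| * m * |u x| + |3 - b| * m * |w x| + |κ| * m * |ρ x| + |α| * |u x| := by
    refine (abs_sub _ _).trans ?_
    refine add_le_add ((abs_add_three _ _ _).trans ?_) h4.le
    linarith
  refine h5.trans ?_
  have i1 : 0 ≤ |b| * m := by positivity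
  have i2 : 0 ≤ |3 - b| * m := by positivity
  have i3 : 0 ≤ |κ| * m := by positivity
  have i4 : 0 ≤ |α| := by positivity
  nlinarith [mul_nonneg i1 hw, mul_nonneg i1 hr, mul_nonneg i2 hu, mul_nonneg i2 hr,
    mul_nonneg i3 hu, mul_nonneg i3 hw, mul_nonneg i4 hw, mul_nonneg i4 hr]

lemma aux_growth (f f' : ℝ → ℝ) (t D K : ℝ) (ht : 0 ≤ t) (hD : 0 ≤ D) (hK : 0 < K)
    (hc : ContinuousOn f (Set.Icc 0 t))
    (hf : ∀ s ∈ Set.Ico 0 t, HasDerivWithinAt f (f' s) (Set.Ici s) s)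
    (hb : ∀ s ∈ Set.Ico 0 t, |f' s| ≤ D * Real.exp (K * s)) :
    |f t| ≤ |f 0| + D / K * Real.exp (K * t) := by
  have hB : ∀ x, HasDerivAt (fun s => |f 0| + D / K * Real.exp (K * s)) (D * Real.exp (K * x)) x := by
    intro x
    have := ((((hasDerivAt_id x).const_mul K).exp).const_mul (D / K)).const_add |f 0|
    refine this.congr_deriv ?_
    simp only [id]
    field_simp
  exact image_norm_le_of_norm_deriv_right_le_deriv_boundary hc hf
    (by simp only [Real.norm_eq_abs]; have : 0 ≤ D / K * Real.exp (K * 0) := by positivity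
        linarith) hB hb (Set.right_mem_Icc.mpr ht)

lemma aux_L (N x y : ℝ) : |min (max x 0) N - min (max y 0) N| ≤ |x - y| := by
  have h1 := abs_min_sub_min_le_max (max x 0) N (max y 0) N
  have h2 := abs_max_sub_max_le_max x 0 y 0
  simp only [sub_self, abs_zero, abs_nonneg, sup_of_le_left] at h1 h2
  exact h1.trans h2

/-- Persistence of one-sided exponential decay: if a strong solution `(u,ρ)`
of the nonlocal two-component Camassa–Holm system on `[0,T)` (with `M < ∞`) has initial data
with `|u(0,x)| + |∂_x u(0,x)| + |ρ(0,x)| ≤ C e^{-a·max(x,0)}` for some `0 ≤ a < 1`, then there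
is `C' > 0` with `|u(t,x)| + |∂_x u(t,x)| + |ρ(t,x)| ≤ C' e^{-a·max(x,0)}` uniformly on
`[0,T) × ℝ`: the pointwise decay `O(e^{-ax})` as `x → +∞` is preserved by the evolution. -/
theorem stmt14 (b κ α T M a C : ℝ) (hT : 0 < T) (ha0 : 0 ≤ a) (ha1 : a < 1) (hC : 0 < C)
    -- the strong solution (u, ρ) of the nonlocal system, with derivatives ut, ux, uxx, ρt, ρx
    (u ux uxx ut ρ ρt ρx : ℝ → ℝ → ℝ)
    (hu_cont : ContinuousOn (fun q : ℝ × ℝ => u q.1 q.2)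
      (Set.Ico 0 T ×ˢ (Set.univ : Set ℝ)))
    (hux_cont : ContinuousOn (fun q : ℝ × ℝ => ux q.1 q.2)
      (Set.Ico 0 T ×ˢ (Set.univ : Set ℝ)))
    (huxx_cont : ContinuousOn (fun q : ℝ × ℝ => uxx q.1 q.2)
      (Set.Ico 0 T ×ˢ (Set.univ : Set ℝ)))
    (hut_cont : ContinuousOn (fun q : ℝ × ℝ => ut q.1 q.2)
      (Set.Ico 0 T ×ˢ (Set.univ : Set ℝ)))
    (hρ_cont : ContinuousOn (fun q : ℝ × ℝ => ρ q.1 q.2)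
      (Set.Ico 0 T ×ˢ (Set.univ : Set ℝ)))
    (hρt_cont : ContinuousOn (fun q : ℝ × ℝ => ρt q.1 q.2)
      (Set.Ico 0 T ×ˢ (Set.univ : Set ℝ)))
    (hρx_cont : ContinuousOn (fun q : ℝ × ℝ => ρx q.1 q.2)
      (Set.Ico 0 T ×ˢ (Set.univ : Set ℝ)))
    (hux : ∀ t ∈ Set.Ico (0 : ℝ) T, ∀ x : ℝ, HasDerivAt (u t) (ux t x) x)
    (huxx : ∀ t ∈ Set.Ico (0 : ℝ) T, ∀ x : ℝ, HasDerivAt (ux t) (uxx t x) x)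
    (hut : ∀ t ∈ Set.Ico (0 : ℝ) T, ∀ x : ℝ,
      HasDerivWithinAt (fun s => u s x) (ut t x) (Set.Ico 0 T) t)
    (hρx : ∀ t ∈ Set.Ico (0 : ℝ) T, ∀ x : ℝ, HasDerivAt (ρ t) (ρx t x) x)
    (hρt : ∀ t ∈ Set.Ico (0 : ℝ) T, ∀ x : ℝ,
      HasDerivWithinAt (fun s => ρ s x) (ρt t x) (Set.Ico 0 T) t)
    -- the nonlocal system
    (hueq : ∀ t ∈ Set.Ico (0 : ℝ) T, ∀ x : ℝ,
      ut t x + u t x * ux t x =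
        -deriv (greenConv (Pterm b κ α (u t) (ux t) (ρ t))) x)
    (hρeq : ∀ t ∈ Set.Ico (0 : ℝ) T, ∀ x : ℝ,
      ρt t x + u t x * ρx t x = -((b - 1) * ux t x * ρ t x))
    -- integrability of the solution
    (hL2Linf : ∀ t ∈ Set.Ico (0 : ℝ) T,
      MemLp (u t) 2 volume ∧ MemLp (u t) ⊤ volume ∧
      MemLp (ux t) 2 volume ∧ MemLp (ux t) ⊤ volume ∧
      MemLp (ρ t) 2 volume ∧ MemLp (ρ t) ⊤ volume)
    -- the uniform bound M
    (hM : ∀ t ∈ Set.Ico (0 : ℝ) T,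
      eLpNorm (u t) ⊤ volume + eLpNorm (ux t) ⊤ volume + eLpNorm (ρ t) ⊤ volume ≤
        ENNReal.ofReal M)
    -- initial one-sided exponential decay
    (hdecay0 : ∀ x : ℝ, |u 0 x| + |ux 0 x| + |ρ 0 x| ≤ C * Real.exp (-a * max x 0)) :
    ∃ C' > (0 : ℝ), ∀ t ∈ Set.Ico (0 : ℝ) T, ∀ x : ℝ,
      |u t x| + |ux t x| + |ρ t x| ≤ C' * Real.exp (-a * max x 0) := by
  have h0 : (0:ℝ) ∈ Set.Ico 0 T := ⟨le_rfl, hT⟩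
  obtain ⟨m, hm⟩ : ∃ m, m = max M 0 := ⟨_, rfl⟩
  have hm0 : 0 ≤ m := hm ▸ le_max_right _ _
  have huc : ∀ t ∈ Set.Ico 0 T, Continuous (u t) := fun t ht =>
    continuous_iff_continuousAt.mpr fun x => (hux t ht x).continuousAt
  have huxc : ∀ t ∈ Set.Ico 0 T, Continuous (ux t) := fun t ht =>
    continuous_iff_continuousAt.mpr fun x => (huxx t ht x).continuousAt
  have hρc : ∀ t ∈ Set.Ico 0 T, Continuous (ρ t) := fun t ht =>
    continuous_iff_continuousAt.mpr fun x => (hρx t ht x).continuousAt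
  have hE : ∀ t ∈ Set.Ico 0 T, ∀ x, |u t x| + |ux t x| + |ρ t x| ≤ m := fun t ht x =>
    hm ▸ aux_bd M (u t) (ux t) (ρ t) (huc t ht) (huxc t ht) (hρc t ht) (hM t ht) x
  have hub : ∀ t ∈ Set.Ico (0 : ℝ) T, ∀ x : ℝ, |u t x| ≤ m := fun t ht x => by
    linarith [hE t ht x, abs_nonneg (ux t x), abs_nonneg (ρ t x)]
  have huxb : ∀ t ∈ Set.Ico (0 : ℝ) T, ∀ x : ℝ, |ux t x| ≤ m := fun t ht x => by
    linarith [hE t ht x, abs_nonneg (u t x), abs_nonneg (ρ t x)]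
  obtain ⟨p, hp⟩ : ∃ p : ℝ → ℝ → ℝ, p = fun t => Pterm b κ α (u t) (ux t) (ρ t) := ⟨_, rfl⟩
  obtain ⟨K2, hK2⟩ : ∃ K2, K2 = (|b| + |3 - b| + |κ|) * m + |α| := ⟨_, rfl⟩
  have hK20 : 0 ≤ K2 := by rw [hK2]; positivity
  have hpE : ∀ t ∈ Set.Ico 0 T, ∀ x, |p t x| ≤ K2 * (|u t x| + |ux t x| + |ρ t x|) := by
    intro t ht x
    rw [hp, hK2]
    exact aux_P b κ α m _ _ _ x (hE t ht x)
  have hpb : ∀ t ∈ Set.Ico 0 T, ∀ x, |p t x| ≤ K2 * m := fun t ht x =>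
    (hpE t ht x).trans (mul_le_mul_of_nonneg_left (hE t ht x) hK20)
  have hpc : ∀ t ∈ Set.Ico 0 T, Continuous (p t) := by
    intro t ht
    have h1 := huc t ht
    have h2 := huxc t ht
    have h3 := hρc t ht
    rw [hp]
    unfold Pterm
    fun_prop
  have hpcont : ContinuousOn (fun q : ℝ × ℝ => p q.1 q.2)
      (Set.Ico 0 T ×ˢ (Set.univ : Set ℝ)) := by
    rw [hp]
    unfold Pterm
    exact ((((hu_cont.pow 2).const_mul _).add ((hux_cont.pow 2).const_mul _)).add
      ((hρ_cont.pow 2).const_mul _)).sub (hu_cont.const_mul _)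
  have hconv : ∀ t ∈ Set.Ico 0 T, greenConv (p t) = fun x => auxI (p t) x + auxJ (p t) x :=
    fun t ht => funext fun x => aux_conv (p t) (hpc t ht) _ (hpb t ht) x
  have hut' : ∀ t ∈ Set.Ico 0 T, ∀ x,
      ut t x = -(u t x * ux t x) - (auxJ (p t) x - auxI (p t) x) := by
    intro t ht x
    have h1 := hueq t ht x
    have h2 : HasDerivAt (greenConv (p t)) (auxJ (p t) x - auxI (p t) x) x := by
      rw [hconv t ht]
      refine ((aux_dI (p t) (hpc t ht) _ (hpb t ht) x).add
        (aux_dJ (p t) (hpc t ht) _ (hpb t ht) x)).congr_deriv ?_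
      ring
    have h3 : deriv (greenConv (Pterm b κ α (u t) (ux t) (ρ t))) x =
        auxJ (p t) x - auxI (p t) x := by
      rw [← h2.deriv, hp]
    rw [h3] at h1
    linarith
  obtain ⟨v, hv⟩ : ∃ v : ℝ → ℝ → ℝ, v = fun t x =>
      (-(ux t x * ux t x + u t x * uxx t x) + p t x) - greenConv (p t) x := ⟨_, rfl⟩
  have hvd : ∀ t ∈ Set.Ico (0 : ℝ) T, ∀ x : ℝ, HasDerivAt (ut t) (v t x) x := by
    intro t ht x
    rw [funext (hut' t ht)]
    refine ((((hux t ht x).mul (huxx t ht x)).neg).sub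
      ((aux_dJ (p t) (hpc t ht) _ (hpb t ht) x).sub
        (aux_dI (p t) (hpc t ht) _ (hpb t ht) x))).congr_deriv ?_
    rw [hv]
    simp only
    rw [hconv t ht]
    ring
  have hwcont : ContinuousOn (fun q : ℝ × ℝ =>
      -(ux q.1 q.2 * ux q.1 q.2 + u q.1 q.2 * uxx q.1 q.2) + p q.1 q.2)
      (Set.Ico 0 T ×ˢ (Set.univ : Set ℝ)) :=
    (((hux_cont.mul hux_cont).add (hu_cont.mul huxx_cont)).neg).add hpcont
  have hvc : ∀ x, ContinuousOn (fun s => v s x) (Set.Ico 0 T) := by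
    intro x
    rw [hv]
    refine ContinuousOn.sub ?_ (aux_greenCont T _ p hpcont hpc hpb x)
    exact hwcont.comp (f := fun t : ℝ => (t, x)) (by fun_prop) (fun t ht => ⟨ht, trivial⟩)
  have h1a : 0 < 1 - a := by linarith
  have hIJ : ∀ t ∈ Set.Ico 0 T, ∀ (L : ℝ → ℝ) (c D : ℝ), 0 ≤ c → c < 1 → 0 ≤ D →
      (∀ x y, |L x - L y| ≤ |x - y|) → (∀ y, |p t y| ≤ D * Real.exp (-c * L y)) → ∀ x,
      |greenConv (p t) x| ≤ D / (1 - c) * Real.exp (-c * L x) ∧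
      |auxJ (p t) x - auxI (p t) x| ≤ D / (1 - c) * Real.exp (-c * L x) := by
    intro t ht L c D hc0 hc1 hD hL hb x
    have i1 := aux_bI (p t) L D c hc0 hc1 hD hL hb x
    have i2 := aux_bJ (p t) L D c hc0 hc1 hD hL hb x
    rw [hconv t ht]
    exact ⟨(abs_add_le _ _).trans (by linarith), (abs_sub _ _).trans (by linarith)⟩
  have hvb : ∀ t₀ ∈ Set.Ico (0 : ℝ) T, ∀ x, ∃ Kb, ∀ s ∈ Set.Icc 0 t₀,
      ∀ y ∈ Metric.closedBall x 1, |v s y| ≤ Kb := by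
    intro t₀ ht₀ x
    have hsub : ∀ s ∈ Set.Icc 0 t₀, s ∈ Set.Ico 0 T := fun s hs => ⟨hs.1, hs.2.trans_lt ht₀.2⟩
    obtain ⟨k, hk⟩ := (isCompact_Icc.prod (isCompact_closedBall x 1)).exists_bound_of_continuousOn
      (hwcont.mono (fun q (hq : q ∈ Set.Icc 0 t₀ ×ˢ Metric.closedBall x 1) =>
        ⟨hsub _ hq.1, trivial⟩))
    refine ⟨k + K2 * m, fun s hs y hy => ?_⟩
    have i1 := hk (s, y) ⟨hs, hy⟩
    have i2 := (hIJ s (hsub s hs) (fun _ => 0) 0 (K2 * m) le_rfl one_pos (by positivity)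
      (by simp) (by simpa using hpb s (hsub s hs)) y).1
    simp only [sub_zero, div_one, mul_zero, Real.exp_zero, mul_one] at i2
    rw [hv]
    exact (abs_sub _ _).trans (add_le_add i1 i2)
  have huxt := aux_uxt T u ux ut v hut_cont hux hut hvd hvc hvb
  -- constants
  obtain ⟨K1, hK1⟩ : ∃ K1, K1 = 1 + K2 / (1 - a) + m + K2 + |b - 1| * m := ⟨_, rfl⟩
  have hK2a : 0 ≤ K2 / (1 - a) := by positivity
  have hbm : 0 ≤ |b - 1| * m := by positivity
  have hK10 : 0 < K1 := by linarith
  obtain ⟨Q, hQ⟩ : ∃ Q, Q = Real.exp (a * (m * T)) := ⟨_, rfl⟩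
  have hQ0 : 0 < Q := hQ ▸ Real.exp_pos _
  obtain ⟨K, hK⟩ : ∃ K, K = 6 * K1 * Q := ⟨_, rfl⟩
  have hK0 : 0 < K := by rw [hK]; positivity
  -- the main step
  have step : ∀ N B : ℝ, 0 ≤ B →
      (∀ t ∈ Set.Ico 0 T, ∀ x, |u t x| + |ux t x| + |ρ t x| ≤
        B * Real.exp (K * t) * Real.exp (-a * min (max x 0) N)) →
      ∀ t ∈ Set.Ico 0 T, ∀ x, |u t x| + |ux t x| + |ρ t x| ≤
        (C * Q + B / 2) * Real.exp (K * t) * Real.exp (-a * min (max x 0) N) := by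
    intro N B hB hEB t₀ ht₀ x₀
    obtain ⟨L, hLdef⟩ : ∃ L : ℝ → ℝ, L = fun x => min (max x 0) N := ⟨_, rfl⟩
    have hL : ∀ x y, |L x - L y| ≤ |x - y| := by rw [hLdef]; exact aux_L N
    have hEL : ∀ t ∈ Set.Ico 0 T, ∀ x, |u t x| + |ux t x| + |ρ t x| ≤
        B * Real.exp (K * t) * Real.exp (-a * L x) := by rw [hLdef]; exact hEB
    have hLe : ∀ x, L x ≤ max x 0 := fun x => by rw [hLdef]; exact min_le_left _ _
    suffices |u t₀ x₀| + |ux t₀ x₀| + |ρ t₀ x₀| ≤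
        (C * Q + B / 2) * Real.exp (K * t₀) * Real.exp (-a * L x₀) by
      rw [hLdef] at this; exact this
    have hsub : ∀ s ∈ Set.Icc 0 t₀, s ∈ Set.Ico 0 T := fun s hs => ⟨hs.1, hs.2.trans_lt ht₀.2⟩
    have hsub' : ∀ s ∈ Set.Ico 0 t₀, s ∈ Set.Ico 0 T := fun s hs => ⟨hs.1, hs.2.trans ht₀.2⟩
    obtain ⟨q, hq0, hqd, hqb⟩ := aux_flow T m hm0 u ux hu_cont hux hub huxb t₀ x₀ ht₀
    have hqc : ContinuousOn q (Set.Icc 0 t₀) := fun s hs => (hqd s hs).continuousWithinAt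
    have hqr : ∀ s ∈ Set.Ico 0 t₀, HasDerivWithinAt q (u s (q s)) (Set.Ici s) s := by
      intro s hs
      refine (hqd s ⟨hs.1, hs.2.le⟩).mono_of_mem_nhdsWithin ?_
      exact Filter.mem_of_superset (Icc_mem_nhdsGE hs.2) (Set.Icc_subset_Icc_left hs.1)
    have hcomp : ∀ f : ℝ → ℝ → ℝ, ContinuousOn (fun q : ℝ × ℝ => f q.1 q.2)
        (Set.Ico 0 T ×ˢ (Set.univ : Set ℝ)) →
        ContinuousOn (fun s => f s (q s)) (Set.Icc 0 t₀) := fun f hf =>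
      hf.comp (f := fun s : ℝ => (s, q s)) (continuousOn_id.prodMk hqc)
        (fun s hs => ⟨hsub s hs, trivial⟩)
    have hexp : ∀ s ∈ Set.Icc 0 t₀, Real.exp (-a * L (q s)) ≤ Q * Real.exp (-a * L x₀) := by
      intro s hs
      rw [hQ, ← Real.exp_add, Real.exp_le_exp]
      have h2 := (hL (q s) x₀).trans (hqb s hs)
      have h3 := (abs_le.mp h2).1
      nlinarith
    obtain ⟨D, hD⟩ : ∃ D, D = K1 * B * Q * Real.exp (-a * L x₀) := ⟨_, rfl⟩
    have hD0 : 0 ≤ D := by rw [hD]; positivity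
    -- from a bound in terms of the energy at `(s, q s)` to the growth bound
    have hbound : ∀ s ∈ Set.Ico 0 t₀, ∀ z : ℝ,
        |z| ≤ K1 * (B * Real.exp (K * s) * Real.exp (-a * L (q s))) →
        |z| ≤ D * Real.exp (K * s) := by
      intro s hs z hz
      refine hz.trans ?_
      calc K1 * (B * Real.exp (K * s) * Real.exp (-a * L (q s)))
          ≤ K1 * (B * Real.exp (K * s) * (Q * Real.exp (-a * L x₀))) := by
            gcongr
            exact hexp s ⟨hs.1, hs.2.le⟩
        _ = D * Real.exp (K * s) := by rw [hD]; ring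
    have hgI : ∀ s ∈ Set.Ico 0 t₀,
        |greenConv (p s) (q s)| ≤ K2 / (1 - a) *
          (B * Real.exp (K * s) * Real.exp (-a * L (q s))) ∧
        |auxJ (p s) (q s) - auxI (p s) (q s)| ≤ K2 / (1 - a) *
          (B * Real.exp (K * s) * Real.exp (-a * L (q s))) := by
      intro s hs
      have := hIJ s (hsub' s hs) L a (K2 * (B * Real.exp (K * s))) ha0 ha1 (by positivity) hL
        (fun y => (hpE s (hsub' s hs) y).trans (by
          have := mul_le_mul_of_nonneg_left (hEL s (hsub' s hs) y) hK20
          linarith)) (q s)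
      have e : K2 * (B * Real.exp (K * s)) / (1 - a) * Real.exp (-a * L (q s)) =
        K2 / (1 - a) * (B * Real.exp (K * s) * Real.exp (-a * L (q s))) := by ring
      rwa [e] at this
    have hU : |u t₀ x₀| ≤ |u 0 (q 0)| + D / K * Real.exp (K * t₀) := by
      have := aux_growth (fun s => u s (q s)) (fun s => ut s (q s) + ux s (q s) * u s (q s)) t₀ D K
        ht₀.1 hD0 hK0 (hcomp u hu_cont)
        (fun s hs => aux_chain T u ux q s _ _ (hsub' s hs) hux_cont hux
          (aux_right (hsub' s hs) (hut s (hsub' s hs) (q s))) (hqr s hs))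
        (fun s hs => by
          apply hbound s hs
          rw [hut' s (hsub' s hs), show -(u s (q s) * ux s (q s)) -
            (auxJ (p s) (q s) - auxI (p s) (q s)) + ux s (q s) * u s (q s) =
            -(auxJ (p s) (q s) - auxI (p s) (q s)) by ring, abs_neg]
          refine (hgI s hs).2.trans ?_
          gcongr
          linarith)
      simpa only [hq0] using this
    have hW : |ux t₀ x₀| ≤ |ux 0 (q 0)| + D / K * Real.exp (K * t₀) := by
      have := aux_growth (fun s => ux s (q s)) (fun s => v s (q s) + uxx s (q s) * u s (q s)) t₀ D K
        ht₀.1 hD0 hK0 (hcomp ux hux_cont)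
        (fun s hs => aux_chain T ux uxx q s _ _ (hsub' s hs) huxx_cont huxx
          (huxt s (q s) (hsub' s hs)) (hqr s hs))
        (fun s hs => by
          apply hbound s hs
          have hs' := hsub' s hs
          have e : v s (q s) + uxx s (q s) * u s (q s) =
            -(ux s (q s) * ux s (q s)) + p s (q s) + -greenConv (p s) (q s) := by
            rw [hv]; ring
          rw [e]
          have i1 := (hgI s hs).1
          have i2 := hEL s hs' (q s)
          have i3 : |-(ux s (q s) * ux s (q s))| ≤
              m * (B * Real.exp (K * s) * Real.exp (-a * L (q s))) := by
            rw [abs_neg, abs_mul]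
            refine mul_le_mul (huxb s hs' _) ?_ (abs_nonneg _) hm0
            linarith [abs_nonneg (u s (q s)), abs_nonneg (ρ s (q s))]
          have i4 := (hpE s hs' (q s)).trans (mul_le_mul_of_nonneg_left i2 hK20)
          refine (abs_add_three _ _ _).trans ?_
          rw [abs_neg (greenConv _ _)]
          generalize hX : B * Real.exp (K * s) * Real.exp (-a * L (q s)) = X at *
          have hX0 : 0 ≤ X := by rw [← hX]; positivity
          rw [hK1]
          nlinarith [mul_nonneg hbm hX0])
      simpa only [hq0] using this
    have hR : |ρ t₀ x₀| ≤ |ρ 0 (q 0)| + D / K * Real.exp (K * t₀) := by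
      have := aux_growth (fun s => ρ s (q s)) (fun s => ρt s (q s) + ρx s (q s) * u s (q s)) t₀ D K
        ht₀.1 hD0 hK0 (hcomp ρ hρ_cont)
        (fun s hs => aux_chain T ρ ρx q s _ _ (hsub' s hs) hρx_cont hρx
          (aux_right (hsub' s hs) (hρt s (hsub' s hs) (q s))) (hqr s hs))
        (fun s hs => by
          apply hbound s hs
          have hs' := hsub' s hs
          have e : ρt s (q s) + ρx s (q s) * u s (q s) =
            -((b - 1) * ux s (q s) * ρ s (q s)) := by
            rw [← hρeq s hs' (q s)]; ring
          rw [e, abs_neg, abs_mul, abs_mul]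
          have i2 := hEL s hs' (q s)
          have i3 : |b - 1| * |ux s (q s)| * |ρ s (q s)| ≤ |b - 1| * m *
              (B * Real.exp (K * s) * Real.exp (-a * L (q s))) := by
            refine mul_le_mul (mul_le_mul_of_nonneg_left (huxb s hs' _) (abs_nonneg _)) ?_
              (abs_nonneg _) hbm
            linarith [abs_nonneg (u s (q s)), abs_nonneg (ux s (q s))]
          refine i3.trans ?_
          gcongr
          linarith)
      simpa only [hq0] using this
    have hstart : |u 0 (q 0)| + |ux 0 (q 0)| + |ρ 0 (q 0)| ≤
        C * Q * Real.exp (K * t₀) * Real.exp (-a * L x₀) := by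
      have i1 : Real.exp (-a * max (q 0) 0) ≤ Real.exp (-a * L (q 0)) := by
        rw [Real.exp_le_exp]
        nlinarith [hLe (q 0)]
      have i2 := i1.trans (hexp 0 ⟨le_rfl, ht₀.1⟩)
      have i3 : 1 ≤ Real.exp (K * t₀) := Real.one_le_exp (mul_nonneg hK0.le ht₀.1)
      calc _ ≤ C * Real.exp (-a * max (q 0) 0) := hdecay0 (q 0)
        _ ≤ C * (Q * Real.exp (-a * L x₀)) := by gcongr
        _ = C * Q * 1 * Real.exp (-a * L x₀) := by ring
        _ ≤ _ := by gcongr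
    have hDK : 3 * (D / K * Real.exp (K * t₀)) =
        B / 2 * Real.exp (K * t₀) * Real.exp (-a * L x₀) := by
      rw [hD, hK]
      field_simp
      ring
    linarith
  -- absorb: the optimal constant is at most `2 C Q`
  have concl : ∀ N : ℝ, 0 ≤ N → ∀ t ∈ Set.Ico 0 T, ∀ x, |u t x| + |ux t x| + |ρ t x| ≤
      (2 * (C * Q)) * Real.exp (K * t) * Real.exp (-a * min (max x 0) N) := by
    intro N hN
    have iter : ∀ n : ℕ, ∀ t ∈ Set.Ico 0 T, ∀ x, |u t x| + |ux t x| + |ρ t x| ≤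
        (2 * (C * Q) + m * Real.exp (a * N) * (1 / 2) ^ n) * Real.exp (K * t) *
          Real.exp (-a * min (max x 0) N) := by
      intro n
      induction n with
      | zero =>
        intro t ht x
        have i3 : 1 ≤ Real.exp (K * t) := Real.one_le_exp (mul_nonneg hK0.le ht.1)
        have i4 : 1 ≤ Real.exp (a * N) * Real.exp (-a * min (max x 0) N) := by
          rw [← Real.exp_add]
          apply Real.one_le_exp
          nlinarith [min_le_right (max x 0) N]
        have i5 : 1 ≤ Real.exp (K * t) *
            (Real.exp (a * N) * Real.exp (-a * min (max x 0) N)) := one_le_mul_of_one_le_of_one_le i3 i4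
        have i6 : 0 ≤ 2 * (C * Q) * Real.exp (K * t) * Real.exp (-a * min (max x 0) N) := by
          positivity
        have i7 := mul_le_mul_of_nonneg_left i5 hm0
        have i8 := hE t ht x
        rw [pow_zero]
        linarith
      | succ n ih =>
        intro t ht x
        have := step N _ (by positivity) ih t ht x
        refine this.trans (le_of_eq ?_)
        rw [pow_succ]
        ring
    intro t ht x
    refine ge_of_tendsto' (f := fun n : ℕ => (2 * (C * Q) + m * Real.exp (a * N) * (1 / 2) ^ n) *
      Real.exp (K * t) * Real.exp (-a * min (max x 0) N)) (x := Filter.atTop) ?_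
      (fun n => iter n t ht x)
    have h1 : Filter.Tendsto (fun n : ℕ => (1 / 2 : ℝ) ^ n) Filter.atTop (nhds 0) :=
      tendsto_pow_atTop_nhds_zero_of_lt_one (by norm_num) (by norm_num)
    have h2 := (((h1.const_mul (m * Real.exp (a * N))).const_add (2 * (C * Q))).mul_const
      (Real.exp (K * t))).mul_const (Real.exp (-a * min (max x 0) N))
    simpa using h2
  refine ⟨2 * (C * Q) * Real.exp (K * T), by positivity, fun t ht x => ?_⟩
  have := concl (max x 0) (le_max_right _ _) t ht x
  rw [min_self] at this
  refine this.trans ?_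
  gcongr
  exact ht.2.le
end
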